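/- Let K be a number field, not isomorphic to the 12th cyclotomic field ℚ(ζ₁₂), whose class number is 1, and suppose that condition cond_A(K) or condition cond_B(K) holds. Let L be a quadratic extension of K and let (t, X₁, X₃) be a non-trivial point of the curve 𝒞 over L. Then t lies in (the image of) K, and moreover X₁ ∈ K or X₃ ∈ K. -/

import Mathlib

noncomputable section

/-- `x` lies in the image of `ℚ`. -/
def inQ {L : Type*} [DivisionRing L] [CharZero L] (x : L) : Prop :=
  ∃ q : ℚ, (q : L) = x

/-- `cond_A(K)`: every `K`-point of `E₁`, `E₁⁻¹`, `E₄`, `E₆`, `E₆⁻¹` is rational. -/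
def condA (K : Type*) [Field K] [CharZero K] : Prop :=
  (∀ x y : K, y ^ 2 = x ^ 3 - x ^ 2 + x → inQ x ∧ inQ y) ∧
  (∀ x y : K, y ^ 2 = x ^ 3 + x ^ 2 + x → inQ x ∧ inQ y) ∧
  (∀ x y : K, y ^ 2 = x ^ 3 - x ^ 2 - 64 * x + 220 → inQ x ∧ inQ y) ∧
  (∀ x y : K, y ^ 2 = x ^ 3 - x ^ 2 - 4 * x + 4 → inQ x ∧ inQ y) ∧
  (∀ x y : K, y ^ 2 = x ^ 3 + x ^ 2 - 4 * x - 4 → inQ x ∧ inQ y)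

/-- `cond_B(K)`: `E₁(K)` and `E₁⁻¹(K)` are finite (rank `0`), and `[K:ℚ] < 8` or `[K:ℚ]` odd. -/
def condB (K : Type*) [Field K] [CharZero K] : Prop :=
  {p : K × K | p.2 ^ 2 = p.1 ^ 3 - p.1 ^ 2 + p.1}.Finite ∧
  {p : K × K | p.2 ^ 2 = p.1 ^ 3 + p.1 ^ 2 + p.1}.Finite ∧
  (Module.finrank ℚ K < 8 ∨ Odd (Module.finrank ℚ K))

/-- `(t, X₁, X₃)` is a point of the genus-5 curve `𝒞`: `X₁² = G(t)` and `X₃² = G(-t)`,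
where `G(x) = x⁴ - 2x³ + 2x² + 2x + 1`. -/
def CPt {L : Type*} [Field L] (t X₁ X₃ : L) : Prop :=
  X₁ ^ 2 = t ^ 4 - 2 * t ^ 3 + 2 * t ^ 2 + 2 * t + 1 ∧
  X₃ ^ 2 = t ^ 4 + 2 * t ^ 3 + 2 * t ^ 2 - 2 * t + 1

/-- The point `(t, X₁, X₃)` of `𝒞` is non-trivial. -/
def CNontrivial {L : Type*} [Field L] (t X₁ X₃ : L) : Prop :=
  t ≠ 0 ∧ t ≠ 1 ∧ t ≠ -1 ∧ X₁ ≠ 0 ∧ X₃ ≠ 0 ∧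
  t ^ 2 + 1 ≠ 0 ∧ t ^ 2 - 2 * t - 1 ≠ 0 ∧ t ^ 2 + 2 * t - 1 ≠ 0

/-- `t` belongs to the set `𝒯` of roots of `(x⁴ + x³ + 2x² - x + 1)(x⁴ - x³ + 2x² + x + 1)`. -/
def inT {L : Type*} [Field L] (t : L) : Prop :=
  (t ^ 4 + t ^ 3 + 2 * t ^ 2 - t + 1) * (t ^ 4 - t ^ 3 + 2 * t ^ 2 + t + 1) = 0

section Part1
structure OrdData (K : Type*) [Field K] where
  o : K → ℤ
  e : ℤ
  he : 0 < e
  hmul : ∀ x y, x ≠ 0 → y ≠ 0 → o (x * y) = o x + o y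
  hadd : ∀ x y, x ≠ 0 → y ≠ 0 → x + y ≠ 0 → min (o x) (o y) ≤ o (x + y)
  h2 : o 2 = e
  h20 : (2 : K) ≠ 0

namespace OrdData
variable {K : Type*} [Field K] (O : OrdData K)

def V (x : K) (n : ℤ) : Prop := x ≠ 0 ∧ O.o x = n
def G (x : K) (n : ℤ) : Prop := x = 0 ∨ n ≤ O.o x

variable {O}

theorem exV {x : K} (hx : x ≠ 0) : ∃ n, O.V x n := ⟨_, hx, rfl⟩

theorem V.uniq {x : K} {n m : ℤ} (h : O.V x n) (h' : O.V x m) : n = m := h.2.symm.trans h'.2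

theorem V.mul {x y : K} {n m : ℤ} (h : O.V x n) (h' : O.V y m) : O.V (x * y) (n + m) :=
  ⟨mul_ne_zero h.1 h'.1, by rw [O.hmul _ _ h.1 h'.1, h.2, h'.2]⟩

theorem V.sq {x : K} {n : ℤ} (h : O.V x n) : O.V (x ^ 2) (2 * n) := by
  rw [pow_two, two_mul]; exact h.mul h

theorem V.G {x : K} {n m : ℤ} (h : O.V x n) (hm : m ≤ n) : O.G x m := Or.inr (by rw [h.2]; exact hm)

theorem V.le {x : K} {n m : ℤ} (h : O.V x n) (h' : O.G x m) : m ≤ n := by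
  rcases h' with h' | h'
  · exact absurd h' h.1
  · rwa [h.2] at h'

theorem one : O.V 1 0 := by
  refine ⟨one_ne_zero, ?_⟩
  have := O.hmul 1 1 one_ne_zero one_ne_zero
  rw [mul_one] at this; omega

theorem two : O.V 2 O.e := ⟨O.h20, O.h2⟩

theorem G.mono {x : K} {n m : ℤ} (h : O.G x n) (hm : m ≤ n) : O.G x m := by
  rcases h with h | h
  · exact Or.inl h
  · exact Or.inr (by omega)

theorem G.mul {x y : K} {n m : ℤ} (h : O.G x n) (h' : O.G y m) : O.G (x * y) (n + m) := by
  rcases h with h | h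
  · left; simp [h]
  rcases h' with h' | h'
  · left; simp [h']
  by_cases hx : x = 0
  · left; simp [hx]
  by_cases hy : y = 0
  · left; simp [hy]
  right; rw [O.hmul _ _ hx hy]; omega

theorem G.add {x y : K} {n : ℤ} (h : O.G x n) (h' : O.G y n) : O.G (x + y) n := by
  by_cases hx : x = 0
  · simpa [hx] using h'
  by_cases hy : y = 0
  · simpa [hy] using h
  by_cases hxy : x + y = 0
  · exact Or.inl hxy
  have h1 := h.resolve_left hx
  have h2 := h'.resolve_left hy
  have := O.hadd x y hx hy hxy
  right; omega

theorem negone : O.V (-1) 0 := by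
  have h : (-1 : K) ≠ 0 := neg_ne_zero.mpr one_ne_zero
  refine ⟨h, ?_⟩
  have := O.hmul (-1) (-1) h h
  rw [neg_one_mul, neg_neg, one.2] at this; omega

theorem V.neg {x : K} {n : ℤ} (h : O.V x n) : O.V (-x) n := by
  have := negone.mul h
  simpa using this

theorem G.neg {x : K} {n : ℤ} (h : O.G x n) : O.G (-x) n := by
  have := (negone.G le_rfl).mul h
  simpa using this

theorem V.add {x y : K} {n m : ℤ} (h : O.V x n) (h' : O.G y m) (hm : n < m) : O.V (x + y) n := by
  have hne : x + y ≠ 0 := by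
    intro h0
    have : x = -y := eq_neg_of_add_eq_zero_left h0
    have h2 := h'.neg
    rw [← this] at h2
    have := h.le h2
    omega
  obtain ⟨k, hk⟩ := exV (O := O) hne
  have h1 : n ≤ k := hk.le ((h.G le_rfl).add (h'.mono hm.le))
  have h2 : ¬ (n < k) := by
    intro hlt
    have h3 : O.G x (min k m) := by
      have := (hk.G (min_le_left k m)).add ((h'.mono (min_le_right k m)).neg)
      simpa using this
    have := h.le h3
    omega
  have : k = n := by omega
  exact this ▸ hk

theorem nat (n : ℕ) : O.G (n : K) 0 := by
  induction n with
  | zero => left; simp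
  | succ k ih => push_cast; exact ih.add (one.G le_rfl)

theorem V.of_mul {x y : K} {n m : ℤ} (h : O.V (x * y) n) (h' : O.V y m) : O.V x (n - m) := by
  have hx : x ≠ 0 := left_ne_zero_of_mul h.1
  obtain ⟨k, hk⟩ := exV (O := O) hx
  have := (hk.mul h').uniq h
  have : k = n - m := by omega
  exact this ▸ hk

/-- `m(m+2u)`-type quadratic relation. -/
theorem quad {m a : K} {n : ℤ} (ha : O.V a O.e) (h : O.V (m * (m + a)) n) (hn : n < 2 * O.e) (hm : O.G m 1) :
    ∃ k, O.V m k ∧ 2 * k = n := by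
  have hm0 : m ≠ 0 := left_ne_zero_of_mul h.1
  obtain ⟨k, hk⟩ := exV (O := O) hm0
  refine ⟨k, hk, ?_⟩
  have h1 : (1:ℤ) ≤ k := hk.le hm
  have := O.he
  rcases lt_or_ge k O.e with h2 | h2
  · have h3 := hk.mul (hk.add (ha.G le_rfl) h2)
    have := h.uniq h3
    omega
  · exfalso
    have h3 := (hk.G h2).mul ((hk.G h2).add (ha.G le_rfl))
    have := h.le h3
    omega

theorem three : O.V 3 0 := by
  have : (3:K) = 1 + 2 := by norm_num
  rw [this]
  exact one.add (two.G le_rfl) O.he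

end OrdData
open OrdData

theorem ord_common {K : Type*} [Field K] (O : OrdData K) (ε : K) (hε : ε = 1 ∨ ε = -1) (A : Set K)
    (hfin : A.Finite) (hdbl : ∀ x ∈ A, ∀ y, y ^ 2 = x ^ 3 + ε * x ^ 2 + x → y ≠ 0 ∧ (x ^ 2 - 1) ^ 2 / (4 * y ^ 2) ∈ A)
    (hy : ∀ x ∈ A, ∃ y, y ^ 2 = x ^ 3 + ε * x ^ 2 + x) (hne : A.Nonempty) :
    ∃ x y z: K, ∃ k l : ℤ, z = x - 1 ∧ y ^ 2 = x ^ 3 + ε * x ^ 2 + x ∧ O.V y 0 ∧ O.V z k ∧ 2 * k = O.e ∧ 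
      O.V (z ^ 2 + 2 * z - 2 * y) (O.e + l) ∧ 4 * l = O.e := by
  have he := O.he
  have hεV : O.V ε 0 := by
    rcases hε with rfl | rfl
    · exact one
    · exact negone
  have hx0 : ∀ x ∈ A, x ≠ 0 := by
    rintro x hx rfl
    obtain ⟨y, h⟩ := hy _ hx
    have := (hdbl _ hx y h).1
    apply this
    simpa using h
  have h4 : ∀ x y : K, y ≠ 0 → (x ^ 2 - 1) ^ 2 / (4 * y ^ 2) * (2 * y) ^ 2 = (x ^ 2 - 1) ^ 2 := by
    intro x y h
    have := O.h20
    have h3 : (4:K) ≠ 0 := by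
      have : (4:K) = 2 * 2 := by norm_num
      rw [this]; exact mul_ne_zero O.h20 O.h20
    field_simp
    ring
  -- minimal element
  have hpos : ∀ x ∈ A, ∀ n, O.V x n → 0 ≤ n := by
    obtain ⟨a, haA, hmin⟩ := hfin.exists_minimalFor O.o A hne
    obtain ⟨n, hn⟩ := exV (O := O) (hx0 a haA)
    have hn0 : 0 ≤ n := by
      by_contra hlt
      push Not at hlt
      obtain ⟨y, h⟩ := hy a haA
      obtain ⟨hy0, hd⟩ := hdbl a haA y h
      obtain ⟨m, hm⟩ := exV (O := O) hy0
      have e1 : O.V (a ^ 3 + ε * a ^ 2 + a) (3 * n) := by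
        have t1 : O.V (a ^ 3) (3 * n) := by
          have := hn.sq.mul hn
          rw [← pow_succ] at this
          convert this using 1; ring
        have t2 := hεV.mul hn.sq
        exact (t1.add (t2.G le_rfl) (by omega)).add (hn.G le_rfl) (by omega)
      rw [← h] at e1
      have e2 := hm.sq.uniq e1
      have e3 : O.V (a ^ 2 - 1) (2 * n) := by
        rw [sub_eq_add_neg]; exact hn.sq.add (negone.G le_rfl) (by omega)
      have e4 := e3.sq
      rw [← h4 a y hy0] at e4
      have e5 := e4.of_mul (two.mul hm).sq
      have := hmin hd (by rw [e5.2, hn.2]; omega)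
      rw [e5.2, hn.2] at this
      omega
    intro x hx k hk
    by_contra hlt
    push Not at hlt
    have := hmin hx (by rw [hk.2, hn.2]; omega)
    rw [hk.2, hn.2] at this
    omega
  have hunit : ∀ x ∈ A, O.V x 0 := by
    intro a haA
    obtain ⟨n, hn⟩ := exV (O := O) (hx0 a haA)
    have hn0 := hpos a haA n hn
    rcases hn0.eq_or_lt with h0 | hlt
    · rw [← h0] at hn; exact hn
    exfalso
    obtain ⟨y, h⟩ := hy a haA
    obtain ⟨hy0, hd⟩ := hdbl a haA y h
    obtain ⟨m, hm⟩ := exV (O := O) hy0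
    have e1 : O.V (a ^ 3 + ε * a ^ 2 + a) n := by
      have t1 : O.V (a ^ 3) (3 * n) := by
        have := hn.sq.mul hn
        rw [← pow_succ] at this
        convert this using 1; ring
      have t2 := hεV.mul hn.sq
      rw [add_comm]
      exact hn.add ((t1.G (show 2 * n ≤ _ by omega)).add (t2.G (by omega))) (by omega)
    rw [← h] at e1
    have e2 := hm.sq.uniq e1
    have e3 : O.V (a ^ 2 - 1) 0 := by
      rw [sub_eq_add_neg, add_comm]; exact negone.add (hn.sq.G le_rfl) (by omega)
    have e4 := e3.sq
    rw [← h4 a y hy0] at e4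
    have e5 := e4.of_mul (two.mul hm).sq
    have := hpos _ hd _ e5
    omega
  have hz : ∀ x ∈ A, ∀ y, y ^ 2 = x ^ 3 + ε * x ^ 2 + x → O.V y 0 ∧ ∃ k, O.V (x - 1) k ∧ 2 * k = O.e := by
    intro x hx y h
    obtain ⟨hy0, hd⟩ := hdbl x hx y h
    have hu := hunit x hx
    have hu' := hunit _ hd
    have e1 := hu'.mul (two.mul (exV (O := O) hy0).choose_spec).sq
    obtain ⟨m, hm⟩ := exV (O := O) hy0
    have e1 := hu'.mul (two.mul hm).sq
    rw [h4 x y hy0] at e1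
    have hz0 : x ^ 2 - 1 ≠ 0 := fun h0 => e1.1 (by rw [h0]; ring)
    obtain ⟨q, hq⟩ := exV (O := O) hz0
    have e2 := hq.sq.uniq e1
    have hfac : x ^ 2 - 1 = (x - 1) * ((x - 1) + 2) := by ring
    rw [hfac] at hq hz0
    have hz1 := left_ne_zero_of_mul hz0
    obtain ⟨k, hk⟩ := exV (O := O) hz1
    have hk0 : 0 ≤ k := hk.le (by rw [sub_eq_add_neg]; exact (hu.G le_rfl).add (negone.G le_rfl))
    have hG : O.G (y ^ 2) 0 := by
      rw [h]
      have g := hu.G le_rfl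
      have t1 : O.G (x ^ 3) 0 := by
        have := (g.mul g).mul g
        rw [show x ^ 3 = x * x * x by ring]; simpa using this
      exact (t1.add ((hεV.mul hu.sq).G (by omega))).add g
    have hm0 := hm.sq.le hG
    have hk1 : 1 ≤ k := by
      by_contra hlt
      have : k = 0 := by omega
      subst this
      have := hk.mul (hk.add (two.G le_rfl) he)
      have := this.uniq hq
      omega
    have hyV : O.V (y ^ 2) 0 := by
      rcases hε with rfl | rfl
      · have : y ^ 2 = x * (3 + (x - 1) * ((x - 1) + 3)) := by rw [h]; ring
        rw [this]
        exact hu.mul (three.add ((hk.G hk1).mul ((hk.G hk0).add (three.G le_rfl))) (by omega))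
      · have : y ^ 2 = x * (1 + (x - 1) * ((x - 1) + 1)) := by rw [h]; ring
        rw [this]
        exact hu.mul (one.add ((hk.G hk1).mul ((hk.G hk0).add (one.G le_rfl))) (by omega))
    have hm' := hm.sq.uniq hyV
    have : m = 0 := by omega
    subst this
    refine ⟨hm, ?_⟩
    have hqe : q = O.e := by omega
    subst hqe
    exact quad two hq (by omega) (hk.G hk1)
  obtain ⟨x, hx⟩ := hne
  obtain ⟨y, h⟩ := hy x hx
  obtain ⟨hyV, k, hk, hke⟩ := hz x hx y h
  obtain ⟨hy0, hd⟩ := hdbl x hx y h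
  obtain ⟨y', h'⟩ := hy _ hd
  obtain ⟨-, k', hk', hke'⟩ := hz _ hd y' h'
  set x' := (x ^ 2 - 1) ^ 2 / (4 * y ^ 2) with hx'
  set ρ := (x ^ 2 - 1) / (2 * y) with hρ
  have hρ2 : x' = ρ ^ 2 := by rw [hx', hρ, div_pow]; congr 1; ring
  have hfac : x' - 1 = (ρ - 1) * ((ρ - 1) + 2) := by rw [hρ2]; ring
  have hxu := hunit _ hd
  rw [hfac] at hk'
  have hρu : O.V ρ 0 := by
    have h0 : ρ ≠ 0 := by
      intro h0
      exact hxu.1 (by rw [hρ2, h0]; ring)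
    obtain ⟨m, hm⟩ := exV (O := O) h0
    have := hm.sq
    rw [← hρ2] at this
    have := this.uniq hxu
    have : m = 0 := by omega
    exact this ▸ hm
  have hρ1 : O.G (ρ - 1) 1 := by
    have h0 : ρ - 1 ≠ 0 := left_ne_zero_of_mul hk'.1
    obtain ⟨m, hm⟩ := exV (O := O) h0
    have hm0 : 0 ≤ m := hm.le (by rw [sub_eq_add_neg]; exact (hρu.G le_rfl).add (negone.G le_rfl))
    by_contra hlt
    have hm1 : m = 0 := by
      by_contra hne
      exact hlt (hm.G (by omega))
    subst hm1
    have := hk'.uniq (hm.mul (hm.add (two.G le_rfl) he))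
    omega
  obtain ⟨l, hl, hle⟩ := quad two hk' (by omega) hρ1
  refine ⟨x, y, x - 1, k, l, rfl, h, hyV, hk, hke, ?_, by omega⟩
  have := (two.mul hyV).mul hl
  convert this using 1
  · have := O.h20
    rw [hρ]; field_simp; ring
  · ring

theorem ord_E1 {K : Type*} [Field K] (O : OrdData K) (A : Set K)
    (hfin : A.Finite) (hdbl : ∀ x ∈ A, ∀ y, y ^ 2 = x ^ 3 + (-1) * x ^ 2 + x → y ≠ 0 ∧ (x ^ 2 - 1) ^ 2 / (4 * y ^ 2) ∈ A)
    (hy : ∀ x ∈ A, ∃ y, y ^ 2 = x ^ 3 + (-1) * x ^ 2 + x) (hne : A.Nonempty) : (8 : ℤ) ∣ O.e := by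
  have he := O.he
  obtain ⟨x, y, z, k, l, hz, h, hyV, hk, hke, hl, hle⟩ := ord_common O (-1) (Or.inr rfl) A hfin hdbl hy hne
  obtain rfl : x = z + 1 := by rw [hz]; ring
  clear hz
  have hw : (y - 1) * ((y - 1) + 2) = 2 * z + z * z ^ 2 + 2 * z ^ 2 := by
    linear_combination h
  have G1 : O.G ((y - 1) * ((y - 1) + 2)) (3 * k) := by
    rw [hw]
    exact (((two.mul hk).G (by omega)).add ((hk.mul hk.sq).G (by omega))).add ((two.mul hk.sq).G (by omega))
  have G2 : O.G (y - 1) (3 * l) := by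
    by_cases h0 : y - 1 = 0
    · exact Or.inl h0
    obtain ⟨m, hm⟩ := exV (O := O) h0
    rcases lt_or_ge m O.e with h2 | h2
    · have := (hm.mul (hm.add (two.G le_rfl) h2)).le G1
      exact hm.G (by omega)
    · exact hm.G (by omega)
  have V1 : O.V (z ^ 2 - 2) (O.e + l) := by
    have : z ^ 2 - 2 = (z ^ 2 + 2 * z - 2 * y) + (2 * (y - 1) + - (2 * z)) := by ring
    rw [this]
    exact hl.add (m := O.e + k) (((two.G le_rfl).mul G2).mono (by omega) |>.add ((two.mul hk).neg.G (by omega))) (by omega)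
  have V2 : O.V (z ^ 2 + 2) (O.e + l) := by
    have : z ^ 2 + 2 = (z ^ 2 - 2) + 2 * 2 := by ring
    rw [this]
    exact V1.add ((two.mul two).G le_rfl) (by omega)
  have V3 : O.V ((y - 1) * ((y - 1) + 2)) (k + (O.e + l)) := by
    have : 2 * z + z * z ^ 2 + 2 * z ^ 2 = z * (z ^ 2 + 2) + 2 * z ^ 2 := by ring
    rw [hw, this]
    exact (hk.mul V2).add ((two.mul hk.sq).G le_rfl) (by omega)
  obtain ⟨m, hm, hme⟩ := quad two V3 (by omega) (G2.mono (by omega))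
  omega

theorem ord_E1m {K : Type*} [Field K] (O : OrdData K) (A : Set K)
    (hfin : A.Finite) (hdbl : ∀ x ∈ A, ∀ y, y ^ 2 = x ^ 3 + 1 * x ^ 2 + x → y ≠ 0 ∧ (x ^ 2 - 1) ^ 2 / (4 * y ^ 2) ∈ A)
    (hy : ∀ x ∈ A, ∃ y, y ^ 2 = x ^ 3 + 1 * x ^ 2 + x) (hne : A.Nonempty) : (8 : ℤ) ∣ O.e := by
  have he := O.he
  obtain ⟨x, y, z, k, l, hz, h, hyV, hk, hke, hl, hle⟩ := ord_common O 1 (Or.inl rfl) A hfin hdbl hy hne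
  obtain rfl : x = z + 1 := by rw [hz]; ring
  clear hz
  have hw : (y - 1) * ((y - 1) + 2) = 2 + (2 * (3 * z) + (z * z ^ 2 + 2 * (2 * z ^ 2))) := by
    linear_combination h
  have V0 : O.V ((y - 1) * ((y - 1) + 2)) O.e := by
    rw [hw]
    exact two.add (m := 3 * k) (((two.mul (three.mul hk)).G (by omega)).add (((hk.mul hk.sq).G (by omega)).add ((two.mul (two.mul hk.sq)).G (by omega)))) (by omega)
  have hw1 : O.G (y - 1) 1 := by
    have h0 : y - 1 ≠ 0 := left_ne_zero_of_mul V0.1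
    obtain ⟨m, hm⟩ := exV (O := O) h0
    have hm0 : 0 ≤ m := hm.le (by rw [sub_eq_add_neg]; exact (hyV.G le_rfl).add (negone.G le_rfl))
    by_contra hlt
    have hm1 : m = 0 := by
      by_contra hne
      exact hlt (hm.G (by omega))
    subst hm1
    have := V0.uniq (hm.mul (hm.add (two.G le_rfl) he))
    omega
  obtain ⟨j, hj, hje⟩ := quad two V0 (by omega) hw1
  have V1 : O.V (z ^ 2 - 2) (O.e + l) := by
    have : z ^ 2 - 2 = (z ^ 2 + 2 * z - 2 * y) + (2 * (y - 1) + - (2 * z)) := by ring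
    rw [this]
    exact hl.add (m := O.e + k) (((two.mul hj).G (by omega)).add ((two.mul hk).neg.G (by omega))) (by omega)
  have V2 : O.V (z ^ 2 + 6) (O.e + l) := by
    have : z ^ 2 + 6 = (z ^ 2 - 2) + 2 * (2 * 2) := by ring
    rw [this]
    exact V1.add ((two.mul (two.mul two)).G le_rfl) (by omega)
  have V3 : O.V (z * (z ^ 2 + 6) + 2 * (2 * z ^ 2)) (k + (O.e + l)) := 
    (hk.mul V2).add ((two.mul (two.mul hk.sq)).G le_rfl) (by omega)
  have V4 : O.V ((z ^ 2 + 2 * z - 2 * y) + 2 * (y - 1)) (O.e + l) := 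
    hl.add ((two.mul hj).G le_rfl) (by omega)
  have V5 : O.V ((y - 1 - z) * ((y - 1 - z) + 2 * (1 + z))) (O.e + l) := by
    have : (y - 1 - z) * ((y - 1 - z) + 2 * (1 + z)) = -((z ^ 2 + 2 * z - 2 * y) + 2 * (y - 1)) + (z * (z ^ 2 + 6) + 2 * (2 * z ^ 2)) := by
      linear_combination hw
    rw [this]
    exact V4.neg.add (V3.G le_rfl) (by omega)
  have hd : O.G (y - 1 - z) 1 := by
    rw [sub_eq_add_neg (y-1)]; exact (hj.G (by omega)).add (hk.neg.G (by omega))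
  have ha : O.V (2 * (1 + z)) O.e := by
    have := two.mul (one.add (hk.G le_rfl) (by omega))
    simpa using this
  obtain ⟨m, hm, hme⟩ := quad ha V5 (by omega) hd
  omega

end Part1

section Part2
open OrdData

open IsDedekindDomain NumberField UniqueFactorizationMonoid WithZero in
/-- The `OrdData` of a prime above 2. -/
noncomputable def ordOfPrime (K : Type*) [Field K] [NumberField K] (v : HeightOneSpectrum (𝓞 K))
    (hv : Ideal.span {(2 : 𝓞 K)} ≤ v.asIdeal) : OrdData K where
  o x := - log (v.valuation K x)
  e := multiplicity v.asIdeal (Ideal.span {(2 : 𝓞 K)})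
  he := by
    have h2 : (2 : 𝓞 K) ≠ 0 := two_ne_zero
    have : v.intValuation 2 < 1 := by
      rw [v.intValuation_lt_one_iff_mem]; exact hv (Ideal.mem_span_singleton_self _)
    rw [v.intValuation_eq_exp_neg_multiplicity h2, ← exp_zero, exp_lt_exp] at this
    omega
  hmul x y hx hy := by
    rw [map_mul, log_mul]; ring
    · simpa using hx
    · simpa using hy
  hadd x y hx hy hxy := by
    have h := (v.valuation K).map_add x y
    have h1 : (v.valuation K) x ≠ 0 := by simpa using hx
    have h2 : (v.valuation K) y ≠ 0 := by simpa using hy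
    have h3 : (v.valuation K) (x + y) ≠ 0 := by simpa using hxy
    rcases le_max_iff.mp h with h | h
    · have := (log_le_log h3 h1).mpr h
      omega
    · have := (log_le_log h3 h2).mpr h
      omega
  h2 := by
    have h2 : (2 : 𝓞 K) ≠ 0 := two_ne_zero
    have e : (2 : K) = algebraMap (𝓞 K) K 2 := (map_ofNat (algebraMap (𝓞 K) K) 2).symm
    rw [e, v.valuation_of_algebraMap, v.intValuation_eq_exp_neg_multiplicity h2, log_exp]; ring
  h20 := two_ne_zero

open IsDedekindDomain NumberField UniqueFactorizationMonoid WithZero in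
theorem eight_dvd_finrank (K : Type*) [Field K] [NumberField K]
    (h : ∀ O : OrdData K, (8 : ℤ) ∣ O.e) : 8 ∣ Module.finrank ℚ K := by
  classical
  set I : Ideal (𝓞 K) := Ideal.span {(2 : 𝓞 K)} with hI
  have h2 : (2 : 𝓞 K) ≠ 0 := two_ne_zero
  have hI0 : I ≠ ⊥ := by rw [hI, Ne, Ideal.span_singleton_eq_bot]; exact h2
  have hI0' : I ≠ 0 := hI0
  have key : ∀ P ∈ normalizedFactors I, 8 ∣ Multiset.count P (normalizedFactors I) := by
    intro P hP
    have hprime := prime_of_normalized_factor P hP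
    have hdvd := dvd_of_mem_normalizedFactors hP
    let v : HeightOneSpectrum (𝓞 K) := ⟨P, Ideal.isPrime_of_prime hprime, hprime.ne_zero⟩
    have h8 := h (ordOfPrime K v (Ideal.le_of_dvd hdvd))
    have : (ordOfPrime K v (Ideal.le_of_dvd hdvd)).e = multiplicity P I := rfl
    rw [this] at h8
    have hfm : FiniteMultiplicity P I := FiniteMultiplicity.of_prime_left hprime hI0'
    have e1 := emultiplicity_eq_count_normalizedFactors hprime.irreducible hI0'
    rw [normalize_eq, hfm.emultiplicity_eq_multiplicity] at e1
    have e2 : multiplicity P I = Multiset.count P (normalizedFactors I) := by exact_mod_cast e1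
    rw [← e2]; exact_mod_cast h8
  obtain ⟨u, hu⟩ := Multiset.exists_smul_of_dvd_count _ key
  have hprod := Ideal.prod_normalizedFactors_eq_self hI0
  rw [hu, Multiset.prod_nsmul] at hprod
  have hn : Ideal.absNorm I = 2 ^ Module.finrank ℚ K := by
    rw [hI, Ideal.absNorm_span_singleton]
    have := Algebra.norm_algebraMap (S := 𝓞 K) (2 : ℤ)
    simp only [map_ofNat] at this
    rw [this, RingOfIntegers.rank]; simp [Int.natAbs_pow]
  rw [← hprod, map_pow] at hn
  obtain ⟨j, -, hj⟩ := (Nat.dvd_prime_pow Nat.prime_two).mp (⟨_, by rw [← hn, pow_succ']⟩ : Ideal.absNorm u.prod ∣ 2 ^ Module.finrank ℚ K)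
  rw [hj, ← pow_mul] at hn
  have := Nat.pow_right_injective le_rfl hn
  exact ⟨j, by omega⟩

end Part2

section Part3
def SysT (ε x y a b : ℤ) : Prop :=
  IsCoprime x y ∧ x * y = 2 * (a * b) ∧ x ^ 2 + ε * y ^ 2 = a ^ 2 + ε * b ^ 2 ∧ x * y ≠ 0

theorem sq_mod8 (x : ℤ) : (x % 2 = 1 ∧ x ^ 2 % 8 = 1) ∨ (x % 2 = 0 ∧ (x ^ 2 % 8 = 0 ∨ x ^ 2 % 8 = 4)) := by
  have h : x % 8 = 0 ∨ x % 8 = 1 ∨ x % 8 = 2 ∨ x % 8 = 3 ∨ x % 8 = 4 ∨ x % 8 = 5 ∨ x % 8 = 6 ∨ x % 8 = 7 := by omega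
  have h2 : x % 2 = (x % 8) % 2 := by omega
  rcases h with h | h | h | h | h | h | h | h <;> rw [h2] <;> simp [h, pow_two, Int.mul_emod]

theorem pyth {x y z : ℤ} (h : x ^ 2 + y ^ 2 = z ^ 2) (hc : IsCoprime x y) (hx : x % 2 = 1) :
    ∃ m n, x = m ^ 2 - n ^ 2 ∧ y = 2 * m * n ∧ |z| = m ^ 2 + n ^ 2 ∧ IsCoprime m n ∧
      (m % 2 = 0 ∧ n % 2 = 1 ∨ m % 2 = 1 ∧ n % 2 = 0) := by
  have hz : 0 < |z| := by
    rw [abs_pos]; rintro rfl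
    have h1 : x = 0 := by nlinarith [sq_nonneg x, sq_nonneg y]
    rw [h1] at hx; norm_num at hx
  have hp : PythagoreanTriple x y |z| := by
    unfold PythagoreanTriple; rw [abs_mul_abs_self]; linarith
  obtain ⟨m, n, h1, h2, h3, h4, h5, -⟩ := hp.coprime_classification' (Int.isCoprime_iff_gcd_eq_one.mp hc) hx hz
  exact ⟨m, n, h1, h2, h3, Int.isCoprime_iff_gcd_eq_one.mpr h4, h5⟩

theorem sysT_split {ε x y a b : ℤ} (hε : ε = 1 ∨ ε = -1) (h : SysT ε x y a b) (hx : x % 2 = 1) :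
    ∃ α β γ δ k : ℤ, x = α * β ∧ y = 2 * (γ * δ) ∧ α % 2 = 1 ∧ β % 2 = 1 ∧ IsCoprime α γ ∧ IsCoprime α δ ∧
      IsCoprime β γ ∧ IsCoprime β δ ∧ γ ≠ 0 ∧ δ ≠ 0 ∧ β ^ 2 - γ ^ 2 = k * δ ^ 2 ∧ β ^ 2 - 4 * γ ^ 2 = ε * k * α ^ 2 ∧
      (k = 1 ∨ k = -1 ∨ k = 3 ∨ k = -3) := by
  obtain ⟨hc, hxy, hq, hne⟩ := h
  have hx2 : IsCoprime x 2 := by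
    have : x = 2 * (x / 2) + 1 := by omega
    exact ⟨1, -(x / 2), by omega⟩
  have hy : (2 : ℤ) ∣ y := by
    have : (2:ℤ) ∣ x * y := ⟨_, hxy⟩
    exact hx2.symm.dvd_of_dvd_mul_left this
  obtain ⟨y', rfl⟩ := hy
  have hxy' : x * y' = a * b := by linarith
  obtain ⟨α, β, ⟨γ, rfl⟩, ⟨δ, rfl⟩, rfl⟩ := exists_dvd_and_dvd_of_dvd_mul (⟨y', hxy'.symm⟩ : x ∣ a * b)
  have hα0 : α ≠ 0 := by rintro rfl; simp at hne
  have hβ0 : β ≠ 0 := by rintro rfl; simp at hne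
  have hy' : y' = γ * δ := by
    have : (α * β) * (y' - γ * δ) = 0 := by linear_combination hxy'
    rcases mul_eq_zero.mp this with h | h
    · exact absurd h (mul_ne_zero hα0 hβ0)
    · linarith
  subst hy'
  have hγ0 : γ ≠ 0 := by rintro rfl; simp at hne
  have hδ0 : δ ≠ 0 := by rintro rfl; simp at hne
  have hα2 : α % 2 = 1 := by
    rcases Int.emod_two_eq_zero_or_one α with h | h
    · rw [Int.mul_emod, h] at hx; simp at hx
    · exact h
  have hβ2 : β % 2 = 1 := by
    rcases Int.emod_two_eq_zero_or_one β with h | h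
    · rw [Int.mul_emod, h] at hx; simp at hx
    · exact h
  have hc1 : IsCoprime (α * β) (γ * δ) := hc.of_mul_right_right
  have cαγ : IsCoprime α γ := hc1.of_mul_left_left.of_mul_right_left
  have cαδ : IsCoprime α δ := hc1.of_mul_left_left.of_mul_right_right
  have cβγ : IsCoprime β γ := hc1.of_mul_left_right.of_mul_right_left
  have cβδ : IsCoprime β δ := hc1.of_mul_left_right.of_mul_right_right
  have hε2 : ε * ε = 1 := by rcases hε with rfl | rfl <;> norm_num
  have key : α ^ 2 * (β ^ 2 - γ ^ 2) = ε * δ ^ 2 * (β ^ 2 - 4 * γ ^ 2) := by linear_combination hq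
  have hdvd : δ ^ 2 ∣ β ^ 2 - γ ^ 2 := by
    apply (cαδ.symm.pow (m := 2) (n := 2)).dvd_of_dvd_mul_left
    rw [key]; exact ⟨ε * (β ^ 2 - 4 * γ ^ 2), by ring⟩
  obtain ⟨k, hk⟩ := hdvd
  have hk2 : β ^ 2 - 4 * γ ^ 2 = ε * k * α ^ 2 := by
    have : ε * δ ^ 2 * (β ^ 2 - 4 * γ ^ 2 - ε * k * α ^ 2) = 0 := by
      rw [hk] at key
      linear_combination -key - hε2 * k * δ ^ 2 * α ^ 2
    rcases mul_eq_zero.mp this with h | h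
    · exfalso
      rcases mul_eq_zero.mp h with h | h
      · rw [h] at hε2; norm_num at hε2
      · exact hδ0 (pow_eq_zero_iff (two_ne_zero) |>.mp h)
    · linarith
  refine ⟨α, β, γ, δ, k, rfl, rfl, hα2, hβ2, cαγ, cαδ, cβγ, cβδ, hγ0, hδ0, by linarith, hk2, ?_⟩
  have hkγ : IsCoprime k (γ ^ 2) := by
    have h1 : IsCoprime (β ^ 2) (γ ^ 2) := cβγ.pow
    have h2 : IsCoprime (δ ^ 2 * k) (γ ^ 2) := by
      rw [← hk]
      obtain ⟨u, v, huv⟩ := h1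
      exact ⟨u, u + v, by linear_combination huv⟩
    exact h2.of_mul_left_right
  have h3 : k ∣ 3 := by
    apply hkγ.dvd_of_dvd_mul_right
    exact ⟨δ ^ 2 - ε * α ^ 2, by linear_combination hk - hk2⟩
  have h4 : k ≤ 3 := Int.le_of_dvd (by norm_num) h3
  have h5 : -k ≤ 3 := Int.le_of_dvd (by norm_num) ((neg_dvd).mpr h3)
  have h6 : k ≠ 0 := by rintro rfl; norm_num at h3
  have h7 : k ≠ 2 := by rintro rfl; norm_num at h3
  have h8 : k ≠ -2 := by rintro rfl; norm_num at h3
  omega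

theorem sysT_wlog {ε x y a b : ℤ} (hε : ε = 1 ∨ ε = -1) (h : SysT ε x y a b) :
    ∃ x' y' a' b', SysT ε x' y' a' b' ∧ x' % 2 = 1 ∧ |x' * y'| = |x * y| := by
  rcases Int.emod_two_eq_zero_or_one x with hx | hx
  · obtain ⟨hc, hxy, hq, hne⟩ := h
    have hy : y % 2 = 1 := by
      by_contra hy
      have h1 : (2:ℤ) ∣ x := by omega
      have h2 : (2:ℤ) ∣ y := by omega
      have := hc.isUnit_of_dvd' h1 h2
      rw [Int.isUnit_iff] at this; omega
    rcases hε with rfl | rfl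
    · exact ⟨y, x, a, b, ⟨hc.symm, by linarith, by linarith, by rwa [mul_comm]⟩, hy, by rw [mul_comm]⟩
    · exact ⟨y, x, b, a, ⟨hc.symm, by linarith, by linarith, by rwa [mul_comm]⟩, hy, by rw [mul_comm]⟩
  · exact ⟨x, y, a, b, h, hx, rfl⟩

theorem odd_coprime {α m : ℤ} (h2 : α % 2 = 1) (h : IsCoprime α (2 * m)) : IsCoprime α (4 * m) := by
  have hx2 : IsCoprime α 2 := ⟨1, -(α / 2), by omega⟩
  have := hx2.mul_right h
  rwa [← mul_assoc] at this

/-- quartic `m⁴ + 14 m² n² + n⁴`-step -/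
theorem stepA {α δ γ β : ℤ} (hα : α % 2 = 1) (hc : IsCoprime α δ) (h1 : γ ^ 2 = α ^ 2 + δ ^ 2)
    (h2 : β ^ 2 = α ^ 2 + 4 * δ ^ 2) (hδ : δ ≠ 0) : ∃ x y a b, SysT (-1) x y a b ∧ x * y = δ := by
  obtain ⟨m, n, e1, e2, e3, e4, e5⟩ := pyth h1.symm hc hα
  have hc' : IsCoprime α (2 * δ) := by
    have hx2 : IsCoprime α 2 := ⟨1, -(α / 2), by omega⟩
    exact hx2.mul_right hc
  obtain ⟨a, b, f1, f2, f3, f4, f5⟩ := pyth (z := β) (by rw [h2]; ring) hc' hα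
  have : a * b = 2 * (m * n) := by
    have : 2 * (a * b) = 2 * (2 * (m * n)) := by linear_combination -f2 + 2 * e2
    linarith
  exact ⟨a, b, m, n, ⟨f4, this, by linarith, by rw [this]; rw [e2] at hδ; rwa [← mul_assoc]⟩, by rw [this, e2]; ring⟩

theorem sysT_neg (N : ℕ) : ∀ x y a b, (x * y).natAbs = N → ¬ SysT (-1) x y a b := by
  induction N using Nat.strong_induction_on with
  | _ N ih =>
  intro x y a b hN h
  obtain ⟨x, y, a, b, h, hx, hxy⟩ := sysT_wlog (Or.inr rfl) h
  have hN : (x * y).natAbs = N := by rw [← hN]; exact Int.natAbs_eq_natAbs_iff.mpr (abs_eq_abs.mp hxy)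
  obtain ⟨α, β, γ, δ, k, rfl, rfl, hα2, hβ2, cαγ, cαδ, cβγ, cβδ, hγ0, hδ0, q1, q2, hk⟩ := sysT_split (Or.inr rfl) h hx
  have sα := sq_mod8 α
  have sβ := sq_mod8 β
  have sγ := sq_mod8 γ
  have sδ := sq_mod8 δ
  have pα := sq_nonneg α
  have pδ := sq_nonneg δ
  have pγ : 0 < γ ^ 2 := by positivity
  rcases hk with rfl | rfl | rfl | rfl
  · omega
  · omega
  · obtain ⟨x', y', a', b', h', e⟩ := stepA (β := β) hα2 cαδ (γ := γ) (by linarith) (by linarith) hδ0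
    refine ih (x' * y').natAbs ?_ x' y' a' b' rfl h'
    rw [e, ← hN]
    have : (α * β * (2 * (γ * δ))).natAbs = 2 * ((α.natAbs * β.natAbs * γ.natAbs) * δ.natAbs) := by
      simp only [Int.natAbs_mul]; norm_num; ring
    rw [this]
    have h1 : 0 < α.natAbs * β.natAbs * γ.natAbs := by
      have : α ≠ 0 := by rintro rfl; simp at hα2
      have : β ≠ 0 := by rintro rfl; simp at hβ2
      positivity
    have h2 : 0 < δ.natAbs := by positivity
    nlinarith
  · omega

theorem sysT_pos (N : ℕ) : ∀ x y a b, (x * y).natAbs = N → ¬ SysT 1 x y a b := by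
  induction N using Nat.strong_induction_on with
  | _ N ih =>
  intro x y a b hN h
  obtain ⟨x, y, a, b, h, hx, hxy⟩ := sysT_wlog (Or.inl rfl) h
  have hN : (x * y).natAbs = N := by rw [← hN]; exact Int.natAbs_eq_natAbs_iff.mpr (abs_eq_abs.mp hxy)
  have hab := h.2.1
  obtain ⟨α, β, γ, δ, k, rfl, rfl, hα2, hβ2, cαγ, cαδ, cβγ, cβδ, hγ0, hδ0, q1, q2, hk⟩ := sysT_split (Or.inl rfl) h hx
  have sα := sq_mod8 α
  have sβ := sq_mod8 β
  have sγ := sq_mod8 γ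
  have sδ := sq_mod8 δ
  have pα := sq_nonneg α
  have pδ := sq_nonneg δ
  have pγ : 0 < γ ^ 2 := by positivity
  have hα0 : α ≠ 0 := by rintro rfl; simp at hα2
  have hβ0 : β ≠ 0 := by rintro rfl; simp at hβ2
  have small : ∀ d, d = γ ∨ d = δ → ∀ x' y' a' b', x' * y' = d → ¬ SysT 1 x' y' a' b' := by
    intro d hd x' y' a' b' e
    refine ih (x' * y').natAbs ?_ x' y' a' b' rfl
    rw [e, ← hN]
    have : (α * β * (2 * (γ * δ))).natAbs = 2 * ((α.natAbs * β.natAbs) * (γ.natAbs * δ.natAbs)) := by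
      simp only [Int.natAbs_mul]; norm_num; ring
    rw [this]
    have h1 : 0 < α.natAbs * β.natAbs := by positivity
    have h2 : 0 < δ.natAbs := by positivity
    have h3 : 0 < γ.natAbs := by positivity
    have h4 : γ.natAbs ≤ γ.natAbs * δ.natAbs := Nat.le_mul_of_pos_right _ h2
    have h5 : δ.natAbs ≤ γ.natAbs * δ.natAbs := Nat.le_mul_of_pos_left _ h3
    have h6 : (γ.natAbs * δ.natAbs) ≤ (α.natAbs * β.natAbs) * (γ.natAbs * δ.natAbs) := Nat.le_mul_of_pos_left _ h1
    rcases hd with rfl | rfl <;> omega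
  -- common step : A² + (2D)² = (m²+n²)², D = 2mn
  have step : ∀ A D m n : ℤ, A % 2 = 1 → IsCoprime A D → D = 2 * m * n → D ≠ 0 → A ^ 2 + (2 * D) ^ 2 = (m ^ 2 + n ^ 2) ^ 2 →
      ∃ x y a b, SysT 1 x y a b ∧ x * y = D := by
    intro A D m n hA hc hD hD0 hq
    have hc' : IsCoprime A (2 * D) := by
      have hx2 : IsCoprime A 2 := ⟨1, -(A / 2), by omega⟩
      exact hx2.mul_right hc
    obtain ⟨a, b, f1, f2, f3, f4, f5⟩ := pyth hq hc' hA
    rw [abs_of_nonneg (by positivity)] at f3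
    have : a * b = 2 * (m * n) := by
      have : 2 * (a * b) = 2 * (2 * (m * n)) := by linear_combination -f2 + 2 * hD
      linarith
    exact ⟨a, b, m, n, ⟨f4, this, by linarith, by rw [this]; rw [hD] at hD0; rwa [← mul_assoc]⟩, by rw [this, hD]; ring⟩
  rcases hk with rfl | rfl | rfl | rfl
  · -- β² = γ² + δ², α² = δ² - 3γ²
    have hδ2 : δ % 2 = 1 := by omega
    have hcδγ : IsCoprime δ γ := by
      have : IsCoprime δ (γ ^ 2) := by
        have h1 := cβδ.pow_left (m := 2)
        have h2 : β ^ 2 = γ ^ 2 + δ ^ 2 := by linarith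
        rw [h2] at h1
        obtain ⟨u, v, huv⟩ := h1
        exact ⟨v + u * δ, u, by linear_combination huv⟩
      exact (IsCoprime.pow_right_iff (by norm_num)).mp this
    obtain ⟨m, n, e1, e2, e3, e4, e5⟩ := pyth (x := δ) (y := γ) (z := β) (by linarith) hcδγ hδ2
    obtain ⟨x', y', a', b', h', e⟩ := step α γ m n hα2 cαγ e2 hγ0 (by
      have : α ^ 2 = δ ^ 2 - 3 * γ ^ 2 := by linarith
      rw [this, e1, e2]; ring)
    exact small _ (Or.inl rfl) _ _ _ _ e h'
  · omega
  · omega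
  · -- γ² = α² - δ², β² = α² - 4δ²
    have hγ2 : γ % 2 = 1 := by omega
    have hcδγ : IsCoprime γ δ := by
      have : IsCoprime δ (γ ^ 2) := by
        have h1 := cαδ.pow_left (m := 2)
        have h2 : α ^ 2 = γ ^ 2 + δ ^ 2 := by linarith
        rw [h2] at h1
        obtain ⟨u, v, huv⟩ := h1
        exact ⟨v + u * δ, u, by linear_combination huv⟩
      exact ((IsCoprime.pow_right_iff (by norm_num)).mp this).symm
    obtain ⟨m, n, e1, e2, e3, e4, e5⟩ := pyth (x := γ) (y := δ) (z := α) (by linarith) hcδγ hγ2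
    obtain ⟨x', y', a', b', h', e⟩ := step β δ m n hβ2 cβδ e2 hδ0 (by
      have : β ^ 2 = γ ^ 2 - 3 * δ ^ 2 := by linarith
      rw [this, e1, e2]; ring)
    exact small _ (Or.inr rfl) _ _ _ _ e h'

theorem quartic_neg {p q z : ℤ} (hc : IsCoprime p q) (h : p ^ 4 - p ^ 2 * q ^ 2 + q ^ 4 = z ^ 2) :
    p * q = 0 ∨ p ^ 2 = q ^ 2 := by
  by_contra! hne
  obtain ⟨h0, h1⟩ := hne
  have hcp : IsCoprime (p ^ 2 - q ^ 2) (p * q) := by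
    apply IsCoprime.mul_right
    · obtain ⟨u, v, huv⟩ := (hc.symm.pow_left (m := 2))
      exact ⟨-u, v + u * p, by linear_combination huv⟩
    · obtain ⟨u, v, huv⟩ := (hc.pow_left (m := 2))
      exact ⟨u, v + u * q, by linear_combination huv⟩
  rcases Int.emod_two_eq_zero_or_one (p * q) with hpq | hpq
  · have hodd : (p ^ 2 - q ^ 2) % 2 = 1 := by
      by_contra hh
      have := hcp.isUnit_of_dvd' (show (2:ℤ) ∣ _ by omega) (show (2:ℤ) ∣ _ by omega)
      rw [Int.isUnit_iff] at this; omega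
    obtain ⟨a, b, f1, f2, f3, f4, f5⟩ := pyth (x := p ^ 2 - q ^ 2) (y := p * q) (z := z) (by linarith) hcp hodd
    exact sysT_neg _ p q a b rfl ⟨hc, by linarith, by linarith, h0⟩
  · obtain ⟨a, b, f1, f2, f3, f4, f5⟩ := pyth (x := p * q) (y := p ^ 2 - q ^ 2) (z := z) (by linarith) hcp.symm hpq
    have hp : p % 2 = 1 := by
      rcases Int.emod_two_eq_zero_or_one p with h | h
      · rw [Int.mul_emod, h] at hpq; simp at hpq
      · exact h
    have hq : q % 2 = 1 := by
      rcases Int.emod_two_eq_zero_or_one q with h | h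
      · rw [Int.mul_emod, h] at hpq; simp at hpq
      · exact h
    obtain ⟨m, hm⟩ : ∃ m, p + q = 2 * m := ⟨(p + q) / 2, by omega⟩
    obtain ⟨n, hn⟩ : ∃ n, p - q = 2 * n := ⟨(p - q) / 2, by omega⟩
    obtain rfl : p = m + n := by linarith
    obtain rfl : q = m - n := by linarith
    refine sysT_neg _ a b m n rfl ⟨f4, by linarith, by linarith, fun h => h1 ?_⟩
    linear_combination f2 + 2 * h

theorem quartic_pos {p q z : ℤ} (hc : IsCoprime p q) (h : p ^ 4 + p ^ 2 * q ^ 2 + q ^ 4 = z ^ 2) :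
    p * q = 0 := by
  by_contra h0
  have sz := sq_mod8 z
  have hz1 : z % 2 = 1 ∧ (p * q) % 2 = 0 := by
    have sp : p % 2 = 0 ∨ p % 2 = 1 := by omega
    have sq : q % 2 = 0 ∨ q % 2 = 1 := by omega
    have hm : z ^ 2 % 8 = ((p ^ 2 % 8) ^ 2 + (p ^ 2 % 8) * (q ^ 2 % 8) + (q ^ 2 % 8) ^ 2) % 8 := by
      rw [← h]
      have : p ^ 4 + p ^ 2 * q ^ 2 + q ^ 4 = (p ^ 2) ^ 2 + p ^ 2 * q ^ 2 + (q ^ 2) ^ 2 := by ring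
      rw [this]; simp [Int.add_emod, Int.mul_emod, pow_two]
    have hnot : ¬ (p % 2 = 0 ∧ q % 2 = 0) := by
      rintro ⟨h1, h2⟩
      have := hc.isUnit_of_dvd' (show (2:ℤ) ∣ _ by omega) (show (2:ℤ) ∣ _ by omega)
      rw [Int.isUnit_iff] at this; omega
    have hpq : (p * q) % 2 = ((p % 2) * (q % 2)) % 2 := Int.mul_emod _ _ _
    rcases sq_mod8 p with ⟨h1, h2⟩ | ⟨h1, h2 | h2⟩ <;> rcases sq_mod8 q with ⟨h3, h4⟩ | ⟨h3, h4 | h4⟩ <;>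
      rw [h2, h4] at hm <;> rw [h1, h3] at hpq <;> norm_num at hm hpq <;> omega
  have hcp : IsCoprime z (p * q) := by
    have : IsCoprime (z ^ 2) (p * q) := by
      rw [← h]
      apply IsCoprime.mul_right
      · obtain ⟨u, v, huv⟩ := (hc.symm.pow_left (m := 4))
        exact ⟨u, v - u * (p ^ 3 + p * q ^ 2), by linear_combination huv⟩
      · obtain ⟨u, v, huv⟩ := (hc.pow_left (m := 4))
        exact ⟨u, v - u * (q ^ 3 + q * p ^ 2), by linear_combination huv⟩
    exact (IsCoprime.pow_left_iff (by norm_num)).mp this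
  obtain ⟨a, b, f1, f2, f3, f4, f5⟩ := pyth (x := z) (y := p * q) (z := p ^ 2 + q ^ 2) (by linarith) hcp hz1.1
  rw [abs_of_nonneg (by positivity)] at f3
  exact sysT_pos _ p q a b rfl ⟨hc, by linarith, by linarith, h0⟩

theorem curve_rat {ε : ℤ} (hε : ε = 1 ∨ ε = -1) {x y : ℚ} (h : y ^ 2 = x * (x ^ 2 + ε * x + 1)) (hx : x ≠ 0) :
    ∃ p q z : ℤ, IsCoprime p q ∧ q ≠ 0 ∧ p ≠ 0 ∧ x = (p : ℚ) ^ 2 / (q:ℚ) ^ 2 ∧ p ^ 4 + ε * (p ^ 2 * q ^ 2) + q ^ 4 = z ^ 2 := by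
  set A := x.num with hA
  set B : ℤ := (x.den : ℤ) with hB
  have hB0 : 0 < B := by rw [hB]; exact_mod_cast x.den_pos
  have hA0 : A ≠ 0 := by rw [hA]; exact Rat.num_ne_zero.mpr hx
  have hxAB : x = (A : ℚ) / B := by rw [hA, hB, Int.cast_natCast]; exact (Rat.num_div_den x).symm
  have hcop : IsCoprime A B := by
    rw [Int.isCoprime_iff_gcd_eq_one]; exact_mod_cast x.reduced
  have hBq : (B : ℚ) ≠ 0 := by exact_mod_cast hB0.ne'
  have hsq : ∃ w : ℤ, A * B * (A ^ 2 + ε * (A * B) + B ^ 2) = w ^ 2 := by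
    have e : ((A * B * (A ^ 2 + ε * (A * B) + B ^ 2) : ℤ) : ℚ) = (y * B ^ 2) ^ 2 := by
      rw [mul_pow, h, hxAB]; push_cast; field_simp
    have hs : IsSquare (((A * B * (A ^ 2 + ε * (A * B) + B ^ 2) : ℤ)) : ℚ) := ⟨y * B ^ 2, by rw [e]; ring⟩
    rw [Rat.isSquare_intCast_iff] at hs
    obtain ⟨w, hw⟩ := hs
    exact ⟨w, by rw [hw]; ring⟩
  obtain ⟨w, hw⟩ := hsq
  have hpos : 0 < A ^ 2 + ε * (A * B) + B ^ 2 := by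
    have : 0 < A ^ 2 := by positivity
    rcases hε with rfl | rfl
    · nlinarith [sq_nonneg (A + B), sq_nonneg B]
    · nlinarith [sq_nonneg (A - B), sq_nonneg B]
  have hAB : 0 < A * B := by
    have h1 : 0 ≤ A * B := by
      by_contra hlt
      push Not at hlt
      have := mul_neg_of_neg_of_pos hlt hpos
      rw [hw] at this
      nlinarith [sq_nonneg w]
    exact lt_of_le_of_ne h1 (mul_ne_zero hA0 hB0.ne').symm
  have hApos : 0 < A := by
    by_contra hh
    push Not at hh
    nlinarith
  have c1 : IsCoprime (A * B) (A ^ 2 + ε * (A * B) + B ^ 2) := by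
    apply IsCoprime.mul_left
    · obtain ⟨u, v, huv⟩ := (hcop.pow_right (n := 2))
      exact ⟨u - v * (A + ε * B), v, by linear_combination huv⟩
    · obtain ⟨u, v, huv⟩ := (hcop.symm.pow_right (n := 2))
      exact ⟨u - v * (B + ε * A), v, by linear_combination huv⟩
  obtain ⟨r, hr | hr⟩ := Int.sq_of_isCoprime c1 hw
  swap
  · nlinarith [sq_nonneg r]
  obtain ⟨p, hp | hp⟩ := Int.sq_of_isCoprime hcop hr
  swap
  · nlinarith [sq_nonneg p]
  obtain ⟨q, hq | hq⟩ := Int.sq_of_isCoprime hcop.symm (show B * A = r ^ 2 by linarith)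
  swap
  · nlinarith [sq_nonneg q]
  obtain ⟨z, hz | hz⟩ := Int.sq_of_isCoprime c1.symm (show _ * _ = w ^ 2 by rw [mul_comm]; exact hw)
  swap
  · nlinarith [sq_nonneg z]
  refine ⟨p, q, z, ?_, ?_, ?_, ?_, ?_⟩
  · rw [hp, hq] at hcop
    exact (IsCoprime.pow_iff (by norm_num) (by norm_num)).mp hcop
  · rintro rfl; rw [hq] at hB0; norm_num at hB0
  · rintro rfl; rw [hp] at hApos; norm_num at hApos
  · rw [hxAB, hp, hq]; push_cast; rfl
  · rw [← hz, hp, hq]; ring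

theorem E1_rat {x y : ℚ} (h : y ^ 2 = x * (x ^ 2 + (-1) * x + 1)) : x = 0 ∨ x = 1 := by
  by_cases hx : x = 0
  · exact Or.inl hx
  obtain ⟨p, q, z, hc, hq, hp, e, h2⟩ := curve_rat (ε := -1) (Or.inr rfl) (by push_cast; exact h) hx
  right
  rcases quartic_neg hc (z := z) (by linarith) with h3 | h3
  · exact absurd h3 (mul_ne_zero hp hq)
  · have h4 : (p : ℚ) ^ 2 = (q : ℚ) ^ 2 := by exact_mod_cast h3
    have h5 : (q : ℚ) ≠ 0 := by exact_mod_cast hq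
    rw [e, h4]; field_simp

theorem E1m_rat {x y : ℚ} (h : y ^ 2 = x * (x ^ 2 + 1 * x + 1)) : x = 0 := by
  by_contra hx
  obtain ⟨p, q, z, hc, hq, hp, e, h2⟩ := curve_rat (ε := 1) (Or.inl rfl) (by push_cast; exact h) hx
  exact (mul_ne_zero hp hq) (quartic_pos hc (z := z) (by linarith))

end Part3

section Part4
open Polynomial

theorem deg_dvd {K : Type*} [Field K] [NumberField K] (x : K) :
    (minpoly ℚ x).natDegree ∣ Module.finrank ℚ K := by
  rw [← IntermediateField.adjoin.finrank (Algebra.IsIntegral.isIntegral (R := ℚ) x)]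
  exact Dvd.intro _ (Module.finrank_mul_finrank ℚ (IntermediateField.adjoin ℚ {x}) K)

theorem deg_gen {K : Type*} [Field K] [NumberField K] (x : K) (h : (minpoly ℚ x).natDegree = Module.finrank ℚ K) (y : K) :
    ∃ q : ℚ[X], aeval x q = y := by
  have hintg := Algebra.IsIntegral.isIntegral (R := ℚ) x
  have htop : IntermediateField.adjoin ℚ {x} = ⊤ := by
    apply IntermediateField.eq_of_le_of_finrank_eq le_top
    rw [IntermediateField.finrank_top', IntermediateField.adjoin.finrank hintg, h]
  have hy : y ∈ (IntermediateField.adjoin ℚ {x}).toSubalgebra := by rw [htop]; trivial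
  rw [IntermediateField.adjoin_simple_toSubalgebra_of_isAlgebraic hintg.isAlgebraic, Algebra.adjoin_singleton_eq_range_aeval] at hy
  exact hy

theorem deg_gen4 {K : Type*} [Field K] [NumberField K] (x : K) (h4 : (minpoly ℚ x).natDegree = 4)
    (h : Module.finrank ℚ K = 4) (y : K) :
    ∃ a b c d : ℚ, y = a + b * x + c * x ^ 2 + d * x ^ 3 := by
  obtain ⟨q, hq⟩ := deg_gen x (h4.trans h.symm) y
  have hintg := Algebra.IsIntegral.isIntegral (R := ℚ) x
  have hm := minpoly.monic hintg
  have e : aeval x (q %ₘ minpoly ℚ x) = y := by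
    rw [← hq]
    conv_rhs => rw [← modByMonic_add_div q (minpoly ℚ x)]
    simp
  have hlt : (q %ₘ minpoly ℚ x).natDegree < 4 := by
    rw [← h4]; apply natDegree_modByMonic_lt _ hm
    intro h1; rw [h1] at h4; simp at h4
  rw [as_sum_range' _ 4 hlt] at e
  simp [Finset.sum_range_succ, aeval_monomial] at e
  exact ⟨_, _, _, _, e.symm⟩

theorem minpoly_eisen {K : Type*} [Field K] [NumberField K] (x : K) (p : ℤ[X]) (hm : p.Monic) (q : ℤ) (hq : Prime q)
    (h1 : ∀ n < p.natDegree, q ∣ p.coeff n) (h2 : ¬ q ^ 2 ∣ p.coeff 0) (h3 : 0 < p.natDegree)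
    (hx : aeval x p = 0) : (minpoly ℚ x).natDegree = p.natDegree := by
  have hE : p.IsEisensteinAt (Ideal.span {q}) := by
    refine ⟨?_, ?_, ?_⟩
    · rw [hm.leadingCoeff, Ideal.mem_span_singleton]
      exact fun h => hq.not_isUnit (isUnit_of_dvd_one h)
    · intro n hn; rw [Ideal.mem_span_singleton]; exact h1 n hn
    · rw [Ideal.span_singleton_pow, Ideal.mem_span_singleton]; exact h2
  have hirr := hE.irreducible ((Ideal.span_singleton_prime hq.ne_zero).mpr hq) hm.isPrimitive h3
  rw [hm.irreducible_iff_irreducible_map_fraction_map (K := ℚ)] at hirr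
  have hx' : aeval x (p.map (algebraMap ℤ ℚ)) = 0 := by rw [aeval_map_algebraMap]; exact hx
  rw [← minpoly.eq_of_irreducible_of_monic hirr hx' (hm.map _), hm.natDegree_map]

theorem deg_c {K : Type*} [Field K] [NumberField K] (c : K) (h : c ^ 4 = 12) : (minpoly ℚ c).natDegree = 4 := by
  have hd : (X ^ 4 - 12 : ℤ[X]).natDegree = 4 := by compute_degree!
  rw [minpoly_eisen c (X ^ 4 - 12) (by monicity!) 3 Int.prime_three, hd]
  · intro n hn
    rw [hd] at hn
    interval_cases n <;> norm_num [coeff_X_pow, coeff_ofNat_zero, coeff_ofNat_succ]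
  · simp [coeff_X_pow]
  · omega
  · have : aeval c (12 : ℤ[X]) = 12 := map_ofNat _ 12
    simp [h, this]

theorem deg_z {K : Type*} [Field K] [NumberField K] (z : K) (h : z ^ 8 + 4 * z ^ 6 - 4 * z ^ 5 + 6 * z ^ 4 + 2 = 0) : (minpoly ℚ z).natDegree = 8 := by
  have hd : (X ^ 8 + 4 * X ^ 6 - 4 * X ^ 5 + 6 * X ^ 4 + 2 : ℤ[X]).natDegree = 8 := by compute_degree!
  have hc : ∀ n, (X ^ 8 + 4 * X ^ 6 - 4 * X ^ 5 + 6 * X ^ 4 + 2 : ℤ[X]).coeff n = 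
      (if n = 8 then 1 else 0) + 4 * (if n = 6 then 1 else 0) - 4 * (if n = 5 then 1 else 0) + 6 * (if n = 4 then 1 else 0) + (if n = 0 then 2 else 0) := by
    intro n
    have e : (X ^ 8 + 4 * X ^ 6 - 4 * X ^ 5 + 6 * X ^ 4 + 2 : ℤ[X]) = X ^ 8 + C 4 * X ^ 6 - C 4 * X ^ 5 + C 6 * X ^ 4 + C 2 := by simp
    rw [e]; simp only [coeff_add, coeff_sub, coeff_C_mul, coeff_X_pow, coeff_C]
  rw [minpoly_eisen z (X ^ 8 + 4 * X ^ 6 - 4 * X ^ 5 + 6 * X ^ 4 + 2) (by monicity!) 2 Int.prime_two, hd]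
  · intro n hn
    rw [hd] at hn
    rw [hc]
    interval_cases n <;> norm_num
  · rw [hc]; norm_num
  · omega
  · have e4 : aeval z (4 : ℤ[X]) = 4 := map_ofNat _ 4
    have e6 : aeval z (6 : ℤ[X]) = 6 := map_ofNat _ 6
    have e2 : aeval z (2 : ℤ[X]) = 2 := map_ofNat _ 2
    simpa [e4, e6, e2] using h

theorem deg_prim {K : Type*} [Field K] [NumberField K] (z : K) (n : ℕ) (hn : 0 < n) (h : IsPrimitiveRoot z n) : (minpoly ℚ z).natDegree = n.totient := by
  rw [← cyclotomic_eq_minpoly_rat h hn, natDegree_cyclotomic]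

theorem prim8 {K : Type*} [Field K] [CharZero K] (z : K) (h : z ^ 4 = -1) : IsPrimitiveRoot z 8 := by
  have : z ^ (2 ^ 2) ≠ 1 := by norm_num [h]
  have h2 : orderOf z = 2 ^ (2 + 1) := orderOf_eq_prime_pow this (by norm_num; rw [show 8 = 4 * 2 by norm_num, pow_mul, h]; norm_num)
  norm_num at h2
  exact h2 ▸ IsPrimitiveRoot.orderOf z

theorem prim12 {K : Type*} [Field K] [CharZero K] (z : K) (h : z ^ 4 - z ^ 2 + 1 = 0) : IsPrimitiveRoot z 12 := by
  have h6 : z ^ 6 = -1 := by linear_combination (z ^ 2 + 1) * h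
  have h12 : z ^ 12 = 1 := by rw [show 12 = 6 * 2 by norm_num, pow_mul, h6]; norm_num
  have h4 : z ^ 4 ≠ 1 := by
    intro h4
    have h2 : z ^ 2 = 2 := by linear_combination h4 - h
    have : z ^ 4 = 4 := by rw [show 4 = 2 * 2 by norm_num, pow_mul, h2]; norm_num
    rw [this] at h4; norm_num at h4
  have : orderOf z = 12 := by
    apply orderOf_eq_of_pow_and_pow_div_prime (by norm_num) h12
    intro p hp hpd
    have : p ≤ 12 := Nat.le_of_dvd (by norm_num) hpd
    interval_cases p <;> first | (exfalso; revert hp; decide) | (exfalso; revert hpd; decide) | skip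
    · norm_num [h6]
    · norm_num; exact h4
  exact this ▸ IsPrimitiveRoot.orderOf z

theorem cyc12 {K : Type*} [Field K] [NumberField K] (z : K) (h : z ^ 4 - z ^ 2 + 1 = 0) (h4 : Module.finrank ℚ K = 4) :
    IsCyclotomicExtension {12} ℚ K := by
  have hp := prim12 z h
  have hd : (minpoly ℚ z).natDegree = 4 := by rw [deg_prim z 12 (by norm_num) hp]; decide
  refine ⟨?_, ?_⟩
  · rintro n hn -
    obtain rfl : n = 12 := hn
    exact ⟨z, hp⟩
  · intro y
    obtain ⟨q, rfl⟩ := deg_gen z (hd.trans h4.symm) y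
    have : aeval z q ∈ Algebra.adjoin ℚ {z} := by
      rw [Algebra.adjoin_singleton_eq_range_aeval]; exact ⟨q, rfl⟩
    refine Algebra.adjoin_mono ?_ this
    rintro _ rfl
    exact ⟨12, rfl, by norm_num, hp.pow_eq_one⟩

end Part4

section Part5
open OrdData

/-- every point is 2-power torsion: induction along doubling on `y² = x (x² + a x + b)`. -/
def IndP (K : Type*) [Field K] (a b : K) : Prop :=
  ∀ S : K → Prop, (∀ x, x * (x ^ 2 + a * x + b) = 0 → S x) →
    (∀ x y, y ^ 2 = x * (x ^ 2 + a * x + b) → y ≠ 0 → S ((x ^ 2 - b) ^ 2 / (4 * y ^ 2)) → S x) →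
    ∀ x y, y ^ 2 = x * (x ^ 2 + a * x + b) → S x

theorem dbl_on {K : Type*} [Field K] [CharZero K] {a b x y : K} (h : y ^ 2 = x * (x ^ 2 + a * x + b)) (hy : y ≠ 0) :
    ((x ^ 2 - b) * (x ^ 4 + 2 * a * x ^ 3 + 6 * b * x ^ 2 + 2 * a * b * x + b ^ 2) / (8 * y ^ 3)) ^ 2 =
    ((x ^ 2 - b) ^ 2 / (4 * y ^ 2)) * (((x ^ 2 - b) ^ 2 / (4 * y ^ 2)) ^ 2 + a * ((x ^ 2 - b) ^ 2 / (4 * y ^ 2)) + b) := by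
  have h4 : y ^ 4 = (x * (x ^ 2 + a * x + b)) ^ 2 := by rw [← h]; ring
  field_simp
  rw [h]
  ring_nf
  try rw [h4]
  try ring

theorem isog_aux {K : Type*} [Field K] [CharZero K] (x f g a b : K) (hx : x ≠ 0) (hf0 : f ≠ 0) (hg0 : g ≠ 0)
    (hf : f = x ^ 2 + a * x + b) (hg : g = x ^ 2 - b) :
    ((f / x) ^ 2 - (a ^ 2 - 4 * b)) ^ 2 / (4 * (x * f * g ^ 2 / (x ^ 2) ^ 2)) =
    ((g ^ 2 / (4 * (x * f))) ^ 2 + a * (g ^ 2 / (4 * (x * f))) + b) / (g ^ 2 / (4 * (x * f))) := by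
  field_simp
  subst hf hg
  ring

theorem IndP.isog {K : Type*} [Field K] [CharZero K] {a b : K} (h : IndP K a b) : IndP K (-2 * a) (a ^ 2 - 4 * b) := by
  intro S hS0 hS
  have key : ∀ x y, y ^ 2 = x * (x ^ 2 + a * x + b) → (x = 0 ∨ S ((x ^ 2 + a * x + b) / x)) := by
    refine h _ ?_ ?_
    · intro x hx
      rcases mul_eq_zero.mp hx with hx | hx
      · exact Or.inl hx
      · right; rw [hx, zero_div]; exact hS0 0 (by simp)
    · intro x y hxy hy hd
      have hx0 : x ≠ 0 := by rintro rfl; apply hy; simpa using hxy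
      right
      have hX : (x ^ 2 + a * x + b) / x = y ^ 2 / x ^ 2 := by rw [hxy]; field_simp
      have hcurve : (y * (b - x ^ 2) / x ^ 2) ^ 2 = ((x ^ 2 + a * x + b) / x) * (((x ^ 2 + a * x + b) / x) ^ 2 + (-2 * a) * ((x ^ 2 + a * x + b) / x) + (a ^ 2 - 4 * b)) := by
        rw [div_pow, mul_pow, hxy]; field_simp; ring
      by_cases hxb : x ^ 2 = b
      · apply hS0
        rw [← hcurve, hxb]; ring
      · have hd' := hd.resolve_left (by
          have : x ^ 2 - b ≠ 0 := sub_ne_zero.mpr hxb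
          exact div_ne_zero (pow_ne_zero _ this) (mul_ne_zero (by norm_num) (pow_ne_zero _ hy)))
        refine hS _ _ hcurve ?_ ?_
        · have : b - x ^ 2 ≠ 0 := sub_ne_zero.mpr (Ne.symm hxb)
          exact div_ne_zero (mul_ne_zero hy this) (pow_ne_zero _ hx0)
        · convert hd' using 1
          have h1 : x ^ 2 - b ≠ 0 := sub_ne_zero.mpr hxb
          have h1' : b - x ^ 2 ≠ 0 := sub_ne_zero.mpr (Ne.symm hxb)
          have h2 : x ^ 2 + a * x + b ≠ 0 := by intro h2; apply hy; rw [h2] at hxy; simpa using hxy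
          rw [div_pow (y * (b - x ^ 2)), mul_pow y, hxy]
          have e3 : (b - x ^ 2) ^ 2 = (x ^ 2 - b) ^ 2 := by ring
          rw [e3]
          exact isog_aux _ _ _ _ _ hx0 h2 h1 rfl rfl
  intro X Y hXY
  by_cases hY : Y = 0
  · apply hS0; rw [← hXY, hY]; ring
  have hX0 : X ≠ 0 := by rintro rfl; apply hY; simpa using hXY
  have hcurve : (Y * ((a ^ 2 - 4 * b) - X ^ 2) / (8 * X ^ 2)) ^ 2 = (Y ^ 2 / (4 * X ^ 2)) * ((Y ^ 2 / (4 * X ^ 2)) ^ 2 + a * (Y ^ 2 / (4 * X ^ 2)) + b) := by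
    rw [div_pow, mul_pow, hXY]; field_simp; ring
  have h1 := (key _ _ hcurve).resolve_left (div_ne_zero (pow_ne_zero _ hY) (mul_ne_zero (by norm_num) (pow_ne_zero _ hX0)))
  apply hS X Y hXY hY
  convert h1 using 1
  have h2 : X ^ 2 + -2 * a * X + (a ^ 2 - 4 * b) ≠ 0 := by intro h2; apply hY; rw [h2] at hXY; simpa using hXY
  rw [hXY]; field_simp; ring

theorem indB {K : Type*} [Field K] [NumberField K] (ε : K) (hε : ε = 1 ∨ ε = -1)
    (hfin : {p : K × K | p.2 ^ 2 = p.1 ^ 3 + ε * p.1 ^ 2 + p.1}.Finite)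
    (hdeg : Module.finrank ℚ K < 8 ∨ Odd (Module.finrank ℚ K)) : IndP K ε 1 := by
  intro S hS0 hS x₀ y₀ h₀
  by_contra hnot
  set A : Set K := {x | (∃ y, y ^ 2 = x ^ 3 + ε * x ^ 2 + x) ∧ ¬ S x} with hA
  have e1 : ∀ x : K, x * (x ^ 2 + ε * x + 1) = x ^ 3 + ε * x ^ 2 + x := fun x => by ring
  have hAfin : A.Finite := by
    refine (hfin.image Prod.fst).subset ?_
    rintro x ⟨⟨y, hy⟩, -⟩
    exact ⟨(x, y), hy, rfl⟩
  have hne : A.Nonempty := ⟨x₀, ⟨y₀, by rw [h₀, e1]⟩, hnot⟩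
  have hdbl : ∀ x ∈ A, ∀ y, y ^ 2 = x ^ 3 + ε * x ^ 2 + x → y ≠ 0 ∧ (x ^ 2 - 1) ^ 2 / (4 * y ^ 2) ∈ A := by
    rintro x ⟨-, hx⟩ y hy
    rw [← e1] at hy
    have hy0 : y ≠ 0 := by
      rintro rfl
      exact hx (hS0 x (by rw [← hy]; ring))
    refine ⟨hy0, ⟨_, (dbl_on hy hy0).trans (e1 _)⟩, fun h => hx (hS x y hy hy0 h)⟩
  have h8 : ∀ O : OrdData K, (8 : ℤ) ∣ O.e := by
    intro O
    rcases hε with rfl | rfl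
    · exact ord_E1m O A hAfin hdbl (fun x hx => hx.1) hne
    · exact ord_E1 O A hAfin hdbl (fun x hx => hx.1) hne
  have := eight_dvd_finrank K h8
  have hpos : 0 < Module.finrank ℚ K := Module.finrank_pos
  rcases hdeg with h | h
  · have := Nat.le_of_dvd hpos this; omega
  · obtain ⟨k, hk⟩ := h; omega

theorem indA1 {K : Type*} [Field K] [CharZero K] (h : ∀ x y : K, y ^ 2 = x ^ 3 - x ^ 2 + x → (∃ q : ℚ, (q : K) = x) ∧ (∃ q : ℚ, (q : K) = y)) : IndP K (-1) 1 := by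
  intro S hS0 hS x y hxy
  have e1 : ∀ x : K, x * (x ^ 2 + (-1) * x + 1) = x ^ 3 - x ^ 2 + x := fun x => by ring
  obtain ⟨⟨q, rfl⟩, ⟨r, rfl⟩⟩ := h x y (by rw [hxy, e1])
  have hq : r ^ 2 = q * (q ^ 2 + (-1) * q + 1) := by exact_mod_cast hxy
  rcases E1_rat hq with rfl | rfl
  · exact hS0 _ (by simp)
  · have : S ((1 : K)) := by
      refine hS 1 1 (by norm_num) one_ne_zero ?_
      apply hS0; norm_num
    simpa using this

theorem indA2 {K : Type*} [Field K] [CharZero K] (h : ∀ x y : K, y ^ 2 = x ^ 3 + x ^ 2 + x → (∃ q : ℚ, (q : K) = x) ∧ (∃ q : ℚ, (q : K) = y)) : IndP K 1 1 := by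
  intro S hS0 hS x y hxy
  have e1 : ∀ x : K, x * (x ^ 2 + 1 * x + 1) = x ^ 3 + x ^ 2 + x := fun x => by ring
  obtain ⟨⟨q, rfl⟩, ⟨r, rfl⟩⟩ := h x y (by rw [hxy, e1])
  have hq : r ^ 2 = q * (q ^ 2 + 1 * q + 1) := by exact_mod_cast hxy
  have := E1m_rat hq
  subst this
  exact hS0 _ (by simp)

noncomputable def ordRat : OrdData ℚ where
  o x := padicValRat 2 x
  e := 1
  he := one_pos
  hmul x y hx hy := padicValRat.mul hx hy
  hadd x y hx hy hxy := padicValRat.min_le_padicValRat_add hxy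
  h2 := by
    have := padicValRat.self (p := 2) (by norm_num)
    exact_mod_cast this
  h20 := two_ne_zero

theorem no_rat {K : Type*} [Field K] [CharZero K] (ε : ℚ) (hε : ε = 1 ∨ ε = -1) (h : IndP K (ε : K) 1)
    (q : ℚ) (n : ℤ) (hn : n ≠ 0) (hq : ordRat.V q n) (y : K) :
    y ^ 2 ≠ (q : K) * ((q : K) ^ 2 + ε * q + 1) := by
  intro hy
  refine h (fun x => ¬ ∃ q : ℚ, (q : K) = x ∧ ∃ n : ℤ, n ≠ 0 ∧ ordRat.V q n) ?_ ?_ _ _ hy ⟨q, rfl, n, hn, hq⟩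
  · rintro _ h0 ⟨q, rfl, n, hn, hq⟩
    have h1 : q * (q ^ 2 + ε * q + 1) = 0 := by exact_mod_cast h0
    rcases mul_eq_zero.mp h1 with h1 | h1
    · exact hq.1 h1
    · rcases hε with rfl | rfl
      · nlinarith [sq_nonneg (2 * q + 1)]
      · nlinarith [sq_nonneg (2 * q - 1)]
  · rintro _ y hy hy0 hd ⟨q, rfl, n, hn, hq⟩
    apply hd
    have hεV : ordRat.V ε 0 := by
      rcases hε with rfl | rfl
      · exact one
      · exact negone
    have he : ordRat.e = 1 := rfl
    have h2 : ordRat.V 2 1 := two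
    have hw : ordRat.V (2 * 2 : ℚ) 2 := by simpa using h2.mul h2
    rcases lt_or_gt_of_ne hn with hlt | hlt
    · have f1 : ordRat.V (q ^ 2 + ε * q + 1) (2 * n) :=
        (hq.sq.add ((hεV.mul hq).G le_rfl) (by omega)).add (one.G le_rfl) (by omega)
      have f2 : ordRat.V (q ^ 2 - 1) (2 * n) := by
        rw [sub_eq_add_neg]; exact hq.sq.add (negone.G le_rfl) (by omega)
      have hden := hw.mul (hq.mul f1)
      refine ⟨(q ^ 2 - 1) ^ 2 / ((2 * 2) * (q * (q ^ 2 + ε * q + 1))), ?_, n - 2, by omega, ?_⟩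
      · rw [hy]; push_cast; norm_num
      · have : ordRat.V ((q ^ 2 - 1) ^ 2 / ((2 * 2) * (q * (q ^ 2 + ε * q + 1))) * ((2 * 2) * (q * (q ^ 2 + ε * q + 1)))) (2 * (2 * n)) := by
          rw [div_mul_cancel₀ _ hden.1]; exact f2.sq
        have := this.of_mul hden
        convert this using 1; ring
    · have f1 : ordRat.V (q ^ 2 + ε * q + 1) 0 := by
        rw [add_comm]
        exact one.add (m := n) ((hq.sq.G (by omega)).add ((hεV.mul hq).G (by omega))) (by omega)
      have f2 : ordRat.V (q ^ 2 - 1) 0 := by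
        rw [sub_eq_add_neg, add_comm]; exact negone.add (hq.sq.G le_rfl) (by omega)
      have hden := hw.mul (hq.mul f1)
      refine ⟨(q ^ 2 - 1) ^ 2 / ((2 * 2) * (q * (q ^ 2 + ε * q + 1))), ?_, -2 - n, by omega, ?_⟩
      · rw [hy]; push_cast; norm_num
      · have : ordRat.V ((q ^ 2 - 1) ^ 2 / ((2 * 2) * (q * (q ^ 2 + ε * q + 1))) * ((2 * 2) * (q * (q ^ 2 + ε * q + 1)))) (2 * 0) := by
          rw [div_mul_cancel₀ _ hden.1]; exact f2.sq
        have := this.of_mul hden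
        convert this using 1; ring

theorem no_sqrt6 {K : Type*} [Field K] [CharZero K] (h : IndP K (-1) 1) (y : K) : y ^ 2 ≠ 6 := by
  intro hy
  have h2 : ordRat.V 2 1 := two
  refine no_rat (K := K) (-1) (Or.inr rfl) (by push_cast; exact h) 2 1 one_ne_zero h2 y ?_
  rw [hy]; push_cast; norm_num

theorem v6 (q : ℚ) (hq : q = 64 / 735 ∨ q = -64 / 735) : ordRat.V q 6 := by
  have h2 : ordRat.V 2 1 := two
  have h64 : ordRat.V (2 * 2 * 2 * 2 * 2 * 2) 6 := ((((h2.mul h2).mul h2).mul h2).mul h2).mul h2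
  have h735 : ordRat.V 735 0 := by
    have : (735 : ℚ) = 1 + 2 * ((367 : ℕ) : ℚ) := by norm_num
    rw [this]
    exact one.add ((h2.G le_rfl).mul (nat 367)) (by omega)
  rcases hq with rfl | rfl
  · have : ordRat.V (64 / 735 * 735) 6 := by norm_num at h64 ⊢; exact h64
    have := this.of_mul h735
    simpa using this
  · have : ordRat.V (-64 / 735 * 735) 6 := by norm_num at h64 ⊢; exact h64.neg
    have := this.of_mul h735
    simpa using this

theorem no_sqrt15 {K : Type*} [Field K] [CharZero K] (h : IndP K 1 1) (y : K) : y ^ 2 ≠ 15 := by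
  intro hy
  have hy0 : y ≠ 0 := by rintro rfl; norm_num at hy
  have hc : (7 * y / 9) ^ 2 = (5 / 3 : K) * ((5 / 3) ^ 2 + 1 * (5 / 3) + 1) := by
    rw [div_pow, mul_pow, hy]; norm_num
  have := dbl_on hc (div_ne_zero (mul_ne_zero (by norm_num) hy0) (by norm_num))
  have e : (((5 / 3 : K) ^ 2 - 1) ^ 2 / (4 * (7 * y / 9) ^ 2)) = ((64 / 735 : ℚ) : K) := by
    rw [hc]; push_cast; norm_num
  rw [e] at this
  exact no_rat (K := K) 1 (Or.inl rfl) (by push_cast; exact h) (64 / 735) 6 (by norm_num) (v6 _ (Or.inl rfl)) _ (by rw [this]; push_cast; ring)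

theorem no_sqrtm15 {K : Type*} [Field K] [CharZero K] (h : IndP K (-1) 1) (y : K) : y ^ 2 ≠ -15 := by
  intro hy
  have hy0 : y ≠ 0 := by rintro rfl; norm_num at hy
  have hc : (7 * y / 9) ^ 2 = (-5 / 3 : K) * ((-5 / 3) ^ 2 + (-1) * (-5 / 3) + 1) := by
    rw [div_pow, mul_pow, hy]; norm_num
  have := dbl_on hc (div_ne_zero (mul_ne_zero (by norm_num) hy0) (by norm_num))
  have e : (((-5 / 3 : K) ^ 2 - 1) ^ 2 / (4 * (7 * y / 9) ^ 2)) = ((-64 / 735 : ℚ) : K) := by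
    rw [hc]; push_cast; norm_num
  rw [e] at this
  exact no_rat (K := K) (-1) (Or.inr rfl) (by push_cast; exact h) (-64 / 735) 6 (by norm_num) (v6 _ (Or.inr rfl)) _ (by rw [this]; push_cast; ring)

end Part5

section Part6
/-- All the arithmetic facts about `K` used below. -/
structure Good (K : Type*) [Field K] : Prop where
  ind6 : IndP K 2 (-3)
  ind6m : IndP K (-2) (-3)
  no12 : ∀ i θ : K, i ^ 2 = -1 → θ ^ 2 = 3 → False
  no6 : ∀ x : K, x ^ 2 ≠ 6
  no15 : ∀ x : K, x ^ 2 ≠ 15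
  nom15 : ∀ x : K, x ^ 2 ≠ -15
  z8 : ∀ i w : K, i ^ 2 = -1 → w ^ 2 = 2 → ∀ x : K, ∃ p q r s : ℚ, x = p + q * i + (r + s * i) * w
  z8deg : ∀ i z : K, i ^ 2 = -1 → z ^ 8 + 4 * z ^ 6 - 4 * z ^ 5 + 6 * z ^ 4 + 2 ≠ 0
  c4 : ∀ θ c : K, θ ^ 2 = 3 → c ^ 2 = 2 * θ → ∀ x : K, ∃ p q r s : ℚ, x = p + q * θ + (r + s * θ) * c

theorem rat_sq_ne (n : ℚ) (hn : ¬ IsSquare n) (q : ℚ) : q ^ 2 ≠ n := by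
  intro h; exact hn ⟨q, by rw [← h]; ring⟩

theorem good_of (K : Type*) [Field K] [NumberField K] (hKcyc : ¬ IsCyclotomicExtension {12} ℚ K)
    (h : ((∀ x y : K, y ^ 2 = x ^ 3 - x ^ 2 + x → (∃ q : ℚ, (q : K) = x) ∧ (∃ q : ℚ, (q : K) = y)) ∧
      (∀ x y : K, y ^ 2 = x ^ 3 + x ^ 2 + x → (∃ q : ℚ, (q : K) = x) ∧ (∃ q : ℚ, (q : K) = y))) ∨
     ({p : K × K | p.2 ^ 2 = p.1 ^ 3 - p.1 ^ 2 + p.1}.Finite ∧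
      {p : K × K | p.2 ^ 2 = p.1 ^ 3 + p.1 ^ 2 + p.1}.Finite ∧
      (Module.finrank ℚ K < 8 ∨ Odd (Module.finrank ℚ K)))) : Good K := by
  have ind : IndP K (-1) 1 ∧ IndP K 1 1 := by
    rcases h with ⟨h1, h2⟩ | ⟨h1, h2, h3⟩
    · exact ⟨indA1 h1, indA2 h2⟩
    · refine ⟨indB _ (Or.inr rfl) ?_ h3, indB _ (Or.inl rfl) ?_ h3⟩
      · convert h1 using 4; ring
      · convert h2 using 4; ring
  have hpos : 0 < Module.finrank ℚ K := Module.finrank_pos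
  have iA : (∀ x y : K, y ^ 2 = x ^ 3 + x ^ 2 + x → (∃ q : ℚ, (q : K) = x) ∧ (∃ q : ℚ, (q : K) = y)) → ∀ i : K, i ^ 2 = -1 → False := by
    intro h2 i hi
    obtain ⟨-, ⟨q, rfl⟩⟩ := h2 (-1) i (by rw [hi]; ring)
    have : q ^ 2 = -1 := by exact_mod_cast hi
    nlinarith [sq_nonneg q]
  have tA : (∀ x y : K, y ^ 2 = x ^ 3 + x ^ 2 + x → (∃ q : ℚ, (q : K) = x) ∧ (∃ q : ℚ, (q : K) = y)) → ∀ i : K, i ^ 2 = 3 → False := by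
    intro h2 i hi
    obtain ⟨-, ⟨q, rfl⟩⟩ := h2 1 i (by rw [hi]; ring)
    have : q ^ 2 = 3 := by exact_mod_cast hi
    exact rat_sq_ne 3 (by norm_num) q this
  have f4 : ∀ z : K, (minpoly ℚ z).natDegree = 4 → (Module.finrank ℚ K < 8 ∨ Odd (Module.finrank ℚ K)) → Module.finrank ℚ K = 4 := by
    intro z hz hd
    have := deg_dvd z
    rw [hz] at this
    obtain ⟨m, hm⟩ := this
    rcases hd with hd | ⟨k, hk⟩ <;> omega
  refine ⟨?_, ?_, ?_, no_sqrt6 ind.1, no_sqrt15 ind.2, no_sqrtm15 ind.1, ?_, ?_, ?_⟩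
  · have := ind.1.isog; norm_num at this; exact this
  · have := ind.2.isog; norm_num at this; exact this
  · intro i θ hi hθ
    rcases h with ⟨h1, h2⟩ | ⟨h1, h2, h3⟩
    · exact iA h2 i hi
    · have hz : ((θ + i) / 2) ^ 4 - ((θ + i) / 2) ^ 2 + 1 = 0 := by
        linear_combination (1 / 16 * (i ^ 2 + 4 * i * θ + 6 * θ ^ 2 - 5)) * hi + (1 / 16 * (θ ^ 2 + 4 * i * θ - 7)) * hθ
      refine hKcyc (cyc12 _ hz (f4 ((θ + i) / 2) ?_ h3))
      rw [deg_prim _ 12 (by norm_num) (prim12 _ hz)]; decide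
  · intro i w hi hw x
    rcases h with ⟨h1, h2⟩ | ⟨h1, h2, h3⟩
    · exact (iA h2 i hi).elim
    · have hz2 : ((1 + i) * w / 2) ^ 2 = i := by
        linear_combination (w ^ 2 / 4) * hi + (i / 2) * hw
      have hz : ((1 + i) * w / 2) ^ 4 = -1 := by
        rw [show 4 = 2 * 2 by norm_num, pow_mul, hz2, hi]
      have hd : (minpoly ℚ ((1 + i) * w / 2)).natDegree = 4 := by
        rw [deg_prim _ 8 (by norm_num) (prim8 _ hz)]; decide
      obtain ⟨a, b, c, d, e⟩ := deg_gen4 _ hd (f4 _ hd h3) x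
      refine ⟨a, c, (b - d) / 2, (b + d) / 2, ?_⟩
      rw [e, show ((1 + i) * w / 2) ^ 3 = ((1 + i) * w / 2) ^ 2 * ((1 + i) * w / 2) by ring, hz2]
      push_cast
      linear_combination (d * w / 2) * hi
  · intro i z hi hz
    rcases h with ⟨h1, h2⟩ | ⟨h1, h2, h3⟩
    · exact (iA h2 i hi).elim
    · have := deg_dvd z
      rw [deg_z z hz] at this
      obtain ⟨m, hm⟩ := this
      rcases h3 with hd | ⟨k, hk⟩ <;> omega
  · intro θ c hθ hc x
    rcases h with ⟨h1, h2⟩ | ⟨h1, h2, h3⟩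
    · exact (tA h2 θ hθ).elim
    · have hd : (minpoly ℚ c).natDegree = 4 := deg_c c (by linear_combination (c ^ 2 + 2 * θ) * hc + 4 * hθ)
      obtain ⟨a, b, e, d, h⟩ := deg_gen4 _ hd (f4 _ hd h3) x
      refine ⟨a, 2 * e, b, 2 * d, ?_⟩
      rw [h]; push_cast; linear_combination (e + d * c) * hc

section
variable {K : Type*} [Field K] [CharZero K]

/-- if `1, α` are independent over `ℚ` -/
theorem lin2 (α : K) (n : ℚ) (hα : α ^ 2 = n) (hn : ¬ IsSquare n) (a b : ℚ) (h : (a : K) + b * α = 0) : a = 0 ∧ b = 0 := by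
  have hb : b = 0 := by
    by_contra hb
    have h1 : (a : K) ^ 2 = b ^ 2 * n := by rw [← hα]; linear_combination (a - b * α) * h
    have h2 : a ^ 2 = b ^ 2 * n := by exact_mod_cast h1
    exact hn ⟨a / b, by field_simp; rw [mul_comm, ← h2]⟩
  subst hb
  simp at h
  exact ⟨h, rfl⟩

theorem z8sq0 (hG : Good K) (i w : K) (hi : i ^ 2 = -1) (hw : w ^ 2 = 2) (a b c d : ℚ) (y : K)
    (hy : y ^ 2 = a + b * i + (c + d * i) * w) :
    ∃ p q r s : ℚ, a = p ^ 2 - q ^ 2 + 2 * (r ^ 2 - s ^ 2) ∧ b = 2 * p * q + 4 * r * s ∧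
      c = 2 * p * r - 2 * q * s ∧ d = 2 * p * s + 2 * q * r := by
  obtain ⟨p, q, r, s, rfl⟩ := hG.z8 i w hi hw y
  have hi' : i ^ 2 = ((-1 : ℚ) : K) := by rw [hi]; norm_num
  have hm1 : ¬ IsSquare (-1 : ℚ) := by norm_num
  have h1 : ((p ^ 2 - q ^ 2 + 2 * (r ^ 2 - s ^ 2) - a : ℚ) + (2 * p * q + 4 * r * s - b : ℚ) * i : K)
      + ((2 * p * r - 2 * q * s - c : ℚ) + (2 * p * s + 2 * q * r - d : ℚ) * i) * w = 0 := by
    push_cast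
    linear_combination hy - (q ^ 2 + 2 * q * s * w + s ^ 2 * w ^ 2) * hi - (r ^ 2 + 2 * r * s * i - s ^ 2) * hw
  generalize hA : p ^ 2 - q ^ 2 + 2 * (r ^ 2 - s ^ 2) - a = A at h1
  generalize hB : 2 * p * q + 4 * r * s - b = B at h1
  generalize hC : 2 * p * r - 2 * q * s - c = C at h1
  generalize hD : 2 * p * s + 2 * q * r - d = D at h1
  have h2 : ((A ^ 2 - B ^ 2 - 2 * (C ^ 2 - D ^ 2) : ℚ) : K) + ((2 * A * B - 4 * C * D : ℚ) : K) * i = 0 := by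
    push_cast
    linear_combination (A + B * i - (C + D * i) * w) * h1 + (C + D * i) ^ 2 * hw + (2 * D ^ 2 - B ^ 2) * hi
  obtain ⟨h3, h4⟩ := lin2 i (-1) hi' hm1 _ _ h2
  have hCD : C = 0 ∧ D = 0 := by
    by_contra hne
    have hN : C ^ 2 + D ^ 2 ≠ 0 := by
      intro h0; apply hne; constructor <;> nlinarith [sq_nonneg C, sq_nonneg D]
    have e1 : (A * C + B * D) * (B * C - A * D) = 0 := by
      linear_combination (C ^ 2 - D ^ 2) / 2 * h4 - C * D * h3
    have e2 : (A * C + B * D) ^ 2 - (B * C - A * D) ^ 2 = 2 * (C ^ 2 + D ^ 2) ^ 2 := by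
      linear_combination (C ^ 2 - D ^ 2) * h3 + 2 * C * D * h4
    rcases mul_eq_zero.mp e1 with e | e
    · rw [e] at e2
      have : 0 < (C ^ 2 + D ^ 2) ^ 2 := by positivity
      nlinarith [sq_nonneg (B * C - A * D)]
    · rw [e] at e2
      refine rat_sq_ne 2 (by norm_num) ((A * C + B * D) / (C ^ 2 + D ^ 2)) ?_
      field_simp; linear_combination e2
  obtain ⟨rfl, rfl⟩ := hCD
  simp only [Rat.cast_zero, zero_mul, add_zero] at h1
  obtain ⟨rfl, rfl⟩ := lin2 i (-1) hi' hm1 _ _ h1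
  exact ⟨p, q, r, s, by linarith, by linarith, by linarith, by linarith⟩

theorem z8sq (hG : Good K) (i w : K) (hi : i ^ 2 = -1) (hw : w ^ 2 = 2) (a b c d : ℚ) (y : K)
    (hy : y ^ 2 = a + b * i + (c + d * i) * w) :
    ∃ p q : ℚ, p ^ 2 - q ^ 2 = a ^ 2 - b ^ 2 - 2 * (c ^ 2 - d ^ 2) ∧ p * q = a * b - 2 * (c * d) := by
  obtain ⟨p, q, r, s, rfl, rfl, rfl, rfl⟩ := z8sq0 hG i w hi hw a b c d y hy
  exact ⟨p ^ 2 - q ^ 2 - 2 * (r ^ 2 - s ^ 2), 2 * p * q - 4 * r * s, by ring, by ring⟩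

theorem z8Qi (hG : Good K) (i w : K) (hi : i ^ 2 = -1) (hw : w ^ 2 = 2) (a b : ℚ) (y : K)
    (hy : y ^ 2 = a + b * i) :
    ∃ p q : ℚ, (a = p ^ 2 - q ^ 2 ∧ b = 2 * p * q) ∨ (a = 2 * (p ^ 2 - q ^ 2) ∧ b = 4 * p * q) := by
  obtain ⟨p, q, r, s, h1, h2, h3, h4⟩ := z8sq0 hG i w hi hw a b 0 0 y (by rw [hy]; push_cast; ring)
  by_cases h0 : r = 0 ∧ s = 0
  · obtain ⟨rfl, rfl⟩ := h0
    exact ⟨p, q, Or.inl ⟨by linarith, by linarith⟩⟩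
  · have h5 : r ^ 2 + s ^ 2 ≠ 0 := by
      intro h; apply h0; constructor <;> nlinarith [sq_nonneg r, sq_nonneg s]
    have h6 : p * (r ^ 2 + s ^ 2) = 0 := by linear_combination - r / 2 * h3 - s / 2 * h4
    have h7 : q * (r ^ 2 + s ^ 2) = 0 := by linear_combination s / 2 * h3 - r / 2 * h4
    obtain rfl := (mul_eq_zero.mp h6).resolve_right h5
    obtain rfl := (mul_eq_zero.mp h7).resolve_right h5
    exact ⟨r, s, Or.inr ⟨by linarith, by linarith⟩⟩

theorem z8norm (hG : Good K) (i w : K) (hi : i ^ 2 = -1) (hw : w ^ 2 = 2) (a b : ℚ) (y : K)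
    (hy : y ^ 2 = a + b * i) : IsSquare (a ^ 2 + b ^ 2) := by
  obtain ⟨p, q, ⟨rfl, rfl⟩ | ⟨rfl, rfl⟩⟩ := z8Qi hG i w hi hw a b y hy
  · exact ⟨p ^ 2 + q ^ 2, by ring⟩
  · exact ⟨2 * (p ^ 2 + q ^ 2), by ring⟩

theorem z8five (hG : Good K) (i w : K) (hi : i ^ 2 = -1) (hw : w ^ 2 = 2) (y : K) (hy : y ^ 2 = 5) : False := by
  obtain ⟨p, q, ⟨h1, h2⟩ | ⟨h1, h2⟩⟩ := z8Qi hG i w hi hw 5 0 y (by rw [hy]; push_cast; ring)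
  · have : p * q = 0 := by linarith
    rcases mul_eq_zero.mp this with rfl | rfl
    · nlinarith [sq_nonneg q]
    · exact rat_sq_ne 5 (by norm_num) p (by linarith)
  · have : p * q = 0 := by linarith
    rcases mul_eq_zero.mp this with rfl | rfl
    · nlinarith [sq_nonneg q]
    · exact rat_sq_ne (5 / 2) (by norm_num) p (by linarith)

theorem c4sq0 (hG : Good K) (θ w : K) (hi : θ ^ 2 = 3) (hw : w ^ 2 = 2 * θ) (a b c d : ℚ) (y : K)
    (hy : y ^ 2 = a + b * θ + (c + d * θ) * w) :
    ∃ p q r s : ℚ, a = p ^ 2 + 3 * q ^ 2 + 12 * r * s ∧ b = 2 * p * q + 2 * (r ^ 2 + 3 * s ^ 2) ∧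
      c = 2 * p * r + 6 * q * s ∧ d = 2 * p * s + 2 * q * r := by
  obtain ⟨p, q, r, s, rfl⟩ := hG.c4 θ w hi hw y
  have hi' : θ ^ 2 = ((3 : ℚ) : K) := by rw [hi]; norm_num
  have hm1 : ¬ IsSquare (3 : ℚ) := by norm_num
  have h1 : ((p ^ 2 + 3 * q ^ 2 + 12 * r * s - a : ℚ) + (2 * p * q + 2 * (r ^ 2 + 3 * s ^ 2) - b : ℚ) * θ : K)
      + ((2 * p * r + 6 * q * s - c : ℚ) + (2 * p * s + 2 * q * r - d : ℚ) * θ) * w = 0 := by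
    push_cast
    linear_combination hy - (q ^ 2 + 2 * q * s * w + 4 * r * s + 2 * s ^ 2 * θ) * hi - (r + s * θ) ^ 2 * hw
  generalize hA : p ^ 2 + 3 * q ^ 2 + 12 * r * s - a = A at h1
  generalize hB : 2 * p * q + 2 * (r ^ 2 + 3 * s ^ 2) - b = B at h1
  generalize hC : 2 * p * r + 6 * q * s - c = C at h1
  generalize hD : 2 * p * s + 2 * q * r - d = D at h1
  have h2 : ((A ^ 2 + 3 * B ^ 2 - 12 * C * D : ℚ) : K) + ((2 * A * B - 2 * C ^ 2 - 6 * D ^ 2 : ℚ) : K) * θ = 0 := by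
    push_cast
    linear_combination (A + B * θ - (C + D * θ) * w) * h1 + (C + D * θ) ^ 2 * hw + (2 * D ^ 2 * θ + 4 * C * D - B ^ 2) * hi
  obtain ⟨h3, h4⟩ := lin2 θ 3 hi' hm1 _ _ h2
  have hCD : C = 0 ∧ D = 0 := by
    by_contra hne
    have hN : C ^ 2 - 3 * D ^ 2 ≠ 0 := by
      intro h0
      have := lin2 θ 3 hi' hm1 C D
      by_cases hD0 : D = 0
      · subst hD0; apply hne; exact ⟨by nlinarith, rfl⟩
      · refine rat_sq_ne 3 (by norm_num) (C / D) ?_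
        field_simp; linear_combination h0
    -- norm of `2 θ` would be a square
    have e2 : (A ^ 2 - 3 * B ^ 2) ^ 2 = -12 * (C ^ 2 - 3 * D ^ 2) ^ 2 := by
      linear_combination (A ^ 2 + 3 * B ^ 2 + 12 * C * D) * h3 - 3 * (2 * A * B + 2 * C ^ 2 + 6 * D ^ 2) * h4
    have : 0 < (C ^ 2 - 3 * D ^ 2) ^ 2 := by positivity
    nlinarith [sq_nonneg (A ^ 2 - 3 * B ^ 2)]
  obtain ⟨rfl, rfl⟩ := hCD
  simp only [Rat.cast_zero, zero_mul, add_zero] at h1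
  obtain ⟨rfl, rfl⟩ := lin2 θ 3 hi' hm1 _ _ h1
  exact ⟨p, q, r, s, by linarith, by linarith, by linarith, by linarith⟩

theorem c4sq (hG : Good K) (θ w : K) (hi : θ ^ 2 = 3) (hw : w ^ 2 = 2 * θ) (a b c d : ℚ) (y : K)
    (hy : y ^ 2 = a + b * θ + (c + d * θ) * w) :
    ∃ p q : ℚ, p ^ 2 + 3 * q ^ 2 = a ^ 2 + 3 * b ^ 2 - 12 * c * d ∧ p * q = a * b - c ^ 2 - 3 * d ^ 2 := by
  obtain ⟨p, q, r, s, rfl, rfl, rfl, rfl⟩ := c4sq0 hG θ w hi hw a b c d y hy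
  exact ⟨p ^ 2 + 3 * q ^ 2 - 12 * r * s, 2 * p * q - 2 * (r ^ 2 + 3 * s ^ 2), by ring, by ring⟩

theorem c4full (hG : Good K) (θ w : K) (hi : θ ^ 2 = 3) (hw : w ^ 2 = 2 * θ) (a b c d : ℚ) (y : K)
    (hy : y ^ 2 = a + b * θ + (c + d * θ) * w) :
    ∃ p q n m r s : ℚ, n ^ 2 + 3 * m ^ 2 = a ^ 2 + 3 * b ^ 2 - 12 * c * d ∧ n * m = a * b - c ^ 2 - 3 * d ^ 2 ∧
      2 * (p ^ 2 + 3 * q ^ 2) = a + n ∧ 4 * (p * q) = b + m ∧ 24 * (r * s) = a - n ∧ 4 * (r ^ 2 + 3 * s ^ 2) = b - m := by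
  obtain ⟨p, q, r, s, rfl, rfl, rfl, rfl⟩ := c4sq0 hG θ w hi hw a b c d y hy
  exact ⟨p, q, p ^ 2 + 3 * q ^ 2 - 12 * r * s, 2 * p * q - 2 * (r ^ 2 + 3 * s ^ 2), r, s, by ring, by ring, by ring, by ring, by ring, by ring⟩

/-- The concrete elements of `ℚ(c)`, `c⁴ = 12`, which are not squares. -/
theorem c4ns1 (hG : Good K) (θ w : K) (hi : θ ^ 2 = 3) (hw : w ^ 2 = 2 * θ) (y : K) : y ^ 2 ≠ 1 + θ + w := by
  intro hy
  obtain ⟨p, q, n, m, r, s, h1, h2, h3, h4, h5, h6⟩ := c4full hG θ w hi hw 1 1 1 0 y (by rw [hy]; push_cast; ring)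
  have h2 : n * m = 0 := by linarith
  rcases mul_eq_zero.mp h2 with rfl | rfl
  · exact rat_sq_ne (4 / 3) (by norm_num) m (by linarith)
  · have : (n - 2) * (n + 2) = 0 := by linear_combination h1
    rcases mul_eq_zero.mp this with h | h
    · obtain rfl : n = 2 := by linarith
      exact rat_sq_ne (3 / 2) (by norm_num) (p ^ 2 - 3 * q ^ 2) (by
        have e1 : p ^ 2 + 3 * q ^ 2 = 3 / 2 := by linarith
        have e2 : p * q = 1 / 4 := by linarith
        linear_combination (p ^ 2 + 3 * q ^ 2 + 3 / 2) * e1 - 12 * (p * q + 1 / 4) * e2)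
    · nlinarith [sq_nonneg p, sq_nonneg q]

theorem c4ns2 (hG : Good K) (θ w : K) (hi : θ ^ 2 = 3) (hw : w ^ 2 = 2 * θ) (y : K) : y ^ 2 ≠ 8 + 4 * θ + (2 + 2 * θ) * w := by
  intro hy
  obtain ⟨p, q, n, m, r, s, h1, h2, h3, h4, h5, h6⟩ := c4full hG θ w hi hw 8 4 2 2 y (by rw [hy]; push_cast; ring)
  have h2 : n * m = 16 := by linarith
  have : ((n - 4) * (n + 4)) * (n ^ 2 - 48) = 0 := by linear_combination n ^ 2 * h1 - 3 * (n * m + 16) * h2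
  rcases mul_eq_zero.mp this with h | h
  · rcases mul_eq_zero.mp h with h | h
    · obtain rfl : n = 4 := by linarith
      obtain rfl : m = 4 := by linarith
      have e1 : p ^ 2 + 3 * q ^ 2 = 6 := by linarith
      have e2 : p * q = 2 := by linarith
      have : (p ^ 2 - 3 * q ^ 2) ^ 2 = -12 := by
        linear_combination (p ^ 2 + 3 * q ^ 2 + 6) * e1 - 12 * (p * q + 2) * e2
      nlinarith [sq_nonneg (p ^ 2 - 3 * q ^ 2)]
    · obtain rfl : n = -4 := by linarith
      obtain rfl : m = -4 := by linarith
      have e2 : p * q = 0 := by linarith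
      rcases mul_eq_zero.mp e2 with rfl | rfl
      · exact rat_sq_ne (2 / 3) (by norm_num) q (by linarith)
      · exact rat_sq_ne 2 (by norm_num) p (by linarith)
  · exact rat_sq_ne 48 (by norm_num) n (by linarith)

theorem c4ns3 (hG : Good K) (θ w : K) (hi : θ ^ 2 = 3) (hw : w ^ 2 = 2 * θ) (y : K) : y ^ 2 ≠ 2 + 2 * θ := by
  intro hy
  obtain ⟨p, q, n, m, r, s, h1, h2, h3, h4, h5, h6⟩ := c4full hG θ w hi hw 2 2 0 0 y (by rw [hy]; push_cast; ring)
  have h2 : n * m = 4 := by linarith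
  have : ((n - 2) * (n + 2)) * (n ^ 2 - 12) = 0 := by linear_combination n ^ 2 * h1 - 3 * (n * m + 4) * h2
  rcases mul_eq_zero.mp this with h | h
  · rcases mul_eq_zero.mp h with h | h
    · obtain rfl : n = 2 := by linarith
      obtain rfl : m = 2 := by linarith
      have e1 : p ^ 2 + 3 * q ^ 2 = 2 := by linarith
      have e2 : p * q = 1 := by linarith
      have : (p ^ 2 - 3 * q ^ 2) ^ 2 = -8 := by
        linear_combination (p ^ 2 + 3 * q ^ 2 + 2) * e1 - 12 * (p * q + 1) * e2
      nlinarith [sq_nonneg (p ^ 2 - 3 * q ^ 2)]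
    · obtain rfl : n = -2 := by linarith
      obtain rfl : m = -2 := by linarith
      have e1 : r ^ 2 + 3 * s ^ 2 = 1 := by linarith
      have e2 : r * s = 1 / 6 := by linarith
      exact rat_sq_ne (2 / 3) (by norm_num) (r ^ 2 - 3 * s ^ 2) (by
        linear_combination (r ^ 2 + 3 * s ^ 2 + 1) * e1 - 12 * (r * s + 1 / 6) * e2)
  · exact rat_sq_ne 12 (by norm_num) n (by linarith)
end

end Part6

section Part7
section
variable {K : Type*} [Field K] [CharZero K]

def Extra6 (x : K) : Prop := ∃ i w : K, i ^ 2 = -1 ∧ w ^ 2 = 2 ∧ x = 2 + 2 * i + (1 - i) * w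

theorem Extra6.ns (hG : Good K) {x : K} (h : Extra6 x) (y : K) : y ^ 2 ≠ x := by
  obtain ⟨i, w, hi, hw, rfl⟩ := h
  intro h
  obtain ⟨p, q, h1, h2⟩ := z8sq hG i w hi hw 2 2 1 (-1) y (by rw [h]; push_cast; ring)
  have h3 : (p - q) * (p + q) = 0 := by linear_combination h1
  rcases mul_eq_zero.mp h3 with h3 | h3
  · exact rat_sq_ne 6 (by norm_num) p (by linear_combination h2 + p * h3)
  · nlinarith [sq_nonneg p]

theorem Extra6.ns3 (hG : Good K) {x : K} (h : Extra6 x) (y : K) : y ^ 2 ≠ x - 3 := by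
  obtain ⟨i, w, hi, hw, rfl⟩ := h
  intro h
  obtain ⟨p, q, h1, h2⟩ := z8sq hG i w hi hw (-1) 2 1 (-1) y (by rw [h]; push_cast; ring)
  have h3 : p * q = 0 := by linear_combination h2
  rcases mul_eq_zero.mp h3 with h3 | h3
  · subst h3; exact rat_sq_ne 3 (by norm_num) q (by linear_combination -h1)
  · subst h3; nlinarith [sq_nonneg p]

theorem Extra6.ns2 (hG : Good K) {x : K} (h : Extra6 x) (y : K) : 2 * y ^ 2 ≠ x := by
  obtain ⟨i, w, hi, hw, rfl⟩ := h
  intro h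
  obtain ⟨p, q, h1, h2⟩ := z8sq hG i w hi hw 1 1 (1 / 2) (-1 / 2) y (by push_cast; linear_combination h / 2)
  have h3 : (p - q) * (p + q) = 0 := by linear_combination h1
  rcases mul_eq_zero.mp h3 with h3 | h3
  · exact rat_sq_ne (3 / 2) (by norm_num) p (by linear_combination h2 + p * h3)
  · nlinarith [sq_nonneg p]

theorem list6 (hG : Good K) (x y : K) (h : y ^ 2 = x * (x - 3) * (x - 4)) :
    x = 0 ∨ x = 3 ∨ x = 4 ∨ x = 6 ∨ x = 2 ∨ Extra6 x := by
  have key := hG.ind6 (fun X => X + 3 = 0 ∨ X + 3 = 3 ∨ X + 3 = 4 ∨ X + 3 = 6 ∨ X + 3 = 2 ∨ Extra6 (X + 3)) ?_ ?_ (x - 3) y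
    (by rw [h]; ring)
  · simpa using key
  · intro X hX
    have : (X + 3) * (X * (X - 1)) = 0 := by linear_combination hX
    rcases mul_eq_zero.mp this with h | h
    · exact Or.inl h
    · rcases mul_eq_zero.mp h with h | h
      · right; left; rw [h]; ring
      · right; right; left; linear_combination h
  · intro X y hy hy0 hd
    obtain ⟨x, rfl⟩ : ∃ x, X = x - 3 := ⟨X + 3, by ring⟩
    have hy' : y ^ 2 = x * (x - 3) * (x - 4) := by rw [hy]; ring
    generalize hdd : (((x - 3) ^ 2 - -3) ^ 2 / (4 * y ^ 2)) + 3 = d at hd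
    have hq : ((x ^ 2 - 6 * x + 12) / (2 * y)) ^ 2 = d - 3 := by
      rw [← hdd, div_pow, mul_pow]; ring
    have hp : ((x ^ 2 - 12) / (2 * y)) ^ 2 = d := by
      have : d = ((x ^ 2 - 6 * x + 12) / (2 * y)) ^ 2 + 3 := by rw [hq]; ring
      rw [this]; field_simp; rw [hy']; ring
    have hr : ((x ^ 2 - 8 * x + 12) / (2 * y)) ^ 2 = d - 4 := by
      rw [← hp]; field_simp; rw [hy']; ring
    have e1 : x - 3 + 3 = x := by ring
    rw [e1]
    have hd0 : (x ^ 2 - 12) ^ 2 = 4 * d * (x * (x - 3) * (x - 4)) := by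
      rw [← hy', ← hp]; field_simp; ring
    have hrr : (x ^ 2 - 8 * x + 12) ^ 2 = 4 * (d - 4) * y ^ 2 := by
      rw [← hr]; field_simp; ring
    generalize (x ^ 2 - 6 * x + 12) / (2 * y) = q at *
    generalize (x ^ 2 - 12) / (2 * y) = p at *
    generalize (x ^ 2 - 8 * x + 12) / (2 * y) = r at *
    rcases hd with rfl | rfl | rfl | rfl | rfl | hd
    · exact (hG.no12 (r / 2) (q * r / 2) (by linear_combination hr / 4) (by linear_combination (r ^ 2 * hq - 3 * hr) / 4)).elim
    · exact (hG.no12 r p (by linear_combination hr) hp).elim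
    · have : x ^ 2 - 8 * x + 12 = 0 := by
        have : (x ^ 2 - 8 * x + 12) ^ 2 = 0 := by rw [hrr]; ring
        simpa using this
      have : (x - 6) * (x - 2) = 0 := by linear_combination this
      rcases mul_eq_zero.mp this with h | h
      · right; right; right; left; linear_combination h
      · right; right; right; right; left; linear_combination h
    · exact (hG.no6 p hp).elim
    · right; right; right; right; right
      have hi : q ^ 2 = -1 := by linear_combination hq
      have e2 : ((x - (2 + 2 * q + (1 - q) * p)) * (x - (2 + 2 * (-q) + (1 - (-q)) * p))) *
         ((x - (2 + 2 * q + (1 - q) * (-p))) * (x - (2 + 2 * (-q) + (1 - (-q)) * (-p)))) = 0 := by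
        have a1 : ((x - (2 + 2 * q + (1 - q) * p)) * (x - (2 + 2 * (-q) + (1 - (-q)) * p))) = x ^ 2 - (4 + 2 * p) * x + 12 := by
          linear_combination (1 * 2) * hp - (2 - p) ^ 2 * hi
        have a2 : ((x - (2 + 2 * q + (1 - q) * (-p))) * (x - (2 + 2 * (-q) + (1 - (-q)) * (-p)))) = x ^ 2 - (4 - 2 * p) * x + 12 := by
          linear_combination (1 * 2) * hp - (2 + p) ^ 2 * hi
        rw [a1, a2]
        linear_combination hd0 - 4 * x ^ 2 * hp
      rcases mul_eq_zero.mp e2 with h | h <;> rcases mul_eq_zero.mp h with h | h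
      · exact ⟨q, p, hi, hp, by linear_combination h⟩
      · exact ⟨-q, p, by linear_combination hi, hp, by linear_combination h⟩
      · exact ⟨q, -p, hi, by linear_combination hp, by linear_combination h⟩
      · exact ⟨-q, -p, by linear_combination hi, by linear_combination hp, by linear_combination h⟩
    · exact (hd.ns hG p hp).elim

def Extra8 (x : K) : Prop := ∃ i w : K, i ^ 2 = -1 ∧ w ^ 2 = 2 ∧ x = 1 + 2 * i + (1 + i) * w
def Extra4 (x : K) : Prop := ∃ θ c : K, θ ^ 2 = 3 ∧ c ^ 2 = 2 * θ ∧ (x = θ - c ∨ x = 6 + 3 * θ + (3 + 2 * θ) * c)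

theorem Extra8.ns (hG : Good K) {x : K} (h : Extra8 x) (y : K) : y ^ 2 ≠ x := by
  obtain ⟨i, w, hi, hw, rfl⟩ := h
  intro h
  obtain ⟨p, q, h1, h2⟩ := z8sq hG i w hi hw 1 2 1 1 y (by rw [h]; push_cast; ring)
  have h3 : p * q = 0 := by linear_combination h2
  rcases mul_eq_zero.mp h3 with h3 | h3
  · subst h3; exact rat_sq_ne 3 (by norm_num) q (by linear_combination -h1)
  · subst h3; nlinarith [sq_nonneg p]

theorem Extra4.ns (hG : Good K) {x : K} (h : Extra4 x) (y : K) : y ^ 2 ≠ x := by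
  obtain ⟨i, w, hi, hw, rfl | rfl⟩ := h
  · intro h
    obtain ⟨p, q, h1, h2⟩ := c4sq hG i w hi hw 0 1 (-1) 0 y (by rw [h]; push_cast; ring)
    have h2 : p * q = -1 := by linear_combination h2
    have h1 : p ^ 2 + 3 * q ^ 2 = 3 := by linear_combination h1
    have : (p ^ 2 + 3 * q ^ 2) ^ 2 = 9 := by rw [h1]; norm_num
    have h3 : (p * q) ^ 2 = 1 := by rw [h2]; norm_num
    nlinarith [sq_nonneg (p ^ 2 - 3 * q ^ 2)]
  · intro h
    obtain ⟨p, q, h1, h2⟩ := c4sq hG i w hi hw 6 3 3 2 y (by rw [h]; push_cast; ring)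
    nlinarith [sq_nonneg p, sq_nonneg q]

def List6m (x : K) : Prop :=
  x = 0 ∨ x = 3 ∨ x = -1 ∨ x ^ 2 = -3 ∨ (x = 1 ∧ ∃ i : K, i ^ 2 = -1) ∨ (x = -3 ∧ ∃ i : K, i ^ 2 = -1) ∨
  (∃ θ : K, θ ^ 2 = 3 ∧ x = 3 + 2 * θ) ∨ Extra8 x ∨ Extra4 x

theorem list6m (hG : Good K) (x y : K) (h : y ^ 2 = x * (x - 3) * (x + 1)) : List6m x := by
  refine hG.ind6m List6m ?_ ?_ x y (by rw [h]; ring)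
  · intro X hX
    have : X * ((X - 3) * (X + 1)) = 0 := by linear_combination hX
    rcases mul_eq_zero.mp this with h | h
    · exact Or.inl h
    · rcases mul_eq_zero.mp h with h | h
      · right; left; linear_combination h
      · right; right; left; linear_combination h
  · intro x y hy hy0 hd
    have hy' : y ^ 2 = x * (x - 3) * (x + 1) := by rw [hy]; ring
    generalize hdd : ((x ^ 2 - -3) ^ 2 / (4 * y ^ 2)) = d at hd
    have hp : ((x ^ 2 + 3) / (2 * y)) ^ 2 = d := by
      rw [← hdd, div_pow, mul_pow]; ring
    have hq : ((x ^ 2 - 6 * x - 3) / (2 * y)) ^ 2 = d - 3 := by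
      rw [← hp]; field_simp; rw [hy']; ring
    have hr : ((x ^ 2 + 2 * x - 3) / (2 * y)) ^ 2 = d + 1 := by
      rw [← hp]; field_simp; rw [hy']; ring
    have hpp : (x ^ 2 + 3) ^ 2 = 4 * d * y ^ 2 := by
      rw [← hp]; field_simp; ring
    have hqq : (x ^ 2 - 6 * x - 3) ^ 2 = 4 * (d - 3) * y ^ 2 := by
      rw [← hq]; field_simp; ring
    have hrr : (x ^ 2 + 2 * x - 3) ^ 2 = 4 * (d + 1) * y ^ 2 := by
      rw [← hr]; field_simp; ring
    generalize (x ^ 2 - 6 * x - 3) / (2 * y) = q at *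
    generalize (x ^ 2 + 3) / (2 * y) = p at *
    generalize (x ^ 2 + 2 * x - 3) / (2 * y) = r at *
    rcases hd with rfl | rfl | rfl | hd | ⟨rfl, hd⟩ | ⟨rfl, hd⟩ | ⟨θ, hθ, rfl⟩ | hd | hd
    · have : (x ^ 2 + 3) ^ 2 = 0 := by rw [hpp]; ring
      have : x ^ 2 + 3 = 0 := by simpa using this
      right; right; right; left; linear_combination this
    · have : (x ^ 2 - 6 * x - 3) ^ 2 = 0 := by rw [hqq]; ring
      have : x ^ 2 - 6 * x - 3 = 0 := by simpa using this
      right; right; right; right; right; right; left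
      exact ⟨(x - 3) / 2, by linear_combination this / 4, by ring⟩
    · have : (x ^ 2 + 2 * x - 3) ^ 2 = 0 := by rw [hrr]; ring
      have : x ^ 2 + 2 * x - 3 = 0 := by simpa using this
      have : (x - 1) * (x + 3) = 0 := by linear_combination this
      rcases mul_eq_zero.mp this with h | h
      · right; right; right; right; left; exact ⟨by linear_combination h, p, hp⟩
      · right; right; right; right; right; left; exact ⟨by linear_combination h, p, hp⟩
    · exfalso
      have h1 : (r ^ 2 - 1) ^ 2 = -3 := by rw [hr, ← hd]; ring
      have hr0 : r ≠ 0 := by rintro rfl; norm_num at h1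
      apply hG.no6 ((r ^ 2 + 2) / r)
      field_simp; linear_combination h1
    · right; right; right; right; right; right; right; left
      obtain ⟨i, hi⟩ := hd
      have hw : r ^ 2 = 2 := by rw [hr]; norm_num
      have e2 : ((x - (1 + 2 * i + (1 + i) * r)) * (x - (1 + 2 * i + (1 + i) * (-r)))) *
         ((x - (1 + 2 * (-i) + (1 + (-i)) * r)) * (x - (1 + 2 * (-i) + (1 + (-i)) * (-r)))) = 0 := by
        have a1 : ((x - (1 + 2 * i + (1 + i) * r)) * (x - (1 + 2 * i + (1 + i) * (-r)))) = x ^ 2 - (2 + 4 * i) * x - 3 := by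
          linear_combination (4 - r ^ 2) * hi - (2 * i) * hw
        have a2 : ((x - (1 + 2 * (-i) + (1 + (-i)) * r)) * (x - (1 + 2 * (-i) + (1 + (-i)) * (-r)))) = x ^ 2 - (2 - 4 * i) * x - 3 := by
          linear_combination (4 - r ^ 2) * hi + (2 * i) * hw
        rw [a1, a2]
        rw [hy'] at hpp
        linear_combination hpp - 16 * x ^ 2 * hi
      rcases mul_eq_zero.mp e2 with h | h <;> rcases mul_eq_zero.mp h with h | h
      · exact ⟨i, r, hi, hw, by linear_combination h⟩
      · exact ⟨i, -r, hi, by linear_combination hw, by linear_combination h⟩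
      · exact ⟨-i, r, by linear_combination hi, hw, by linear_combination h⟩
      · exact ⟨-i, -r, by linear_combination hi, by linear_combination hw, by linear_combination h⟩
    · exact (hG.no6 (p * r) (by rw [mul_pow, hp, hr]; norm_num)).elim
    · right; right; right; right; right; right; right; right
      have hc : q ^ 2 = 2 * θ := by rw [hq]; ring
      have e2 : ((x - (θ - q)) * (x - (6 + 3 * θ + (3 + 2 * θ) * q))) *
         ((x - (θ - (-q))) * (x - (6 + 3 * θ + (3 + 2 * θ) * (-q)))) = 0 := by
        have a1 : ((x - (θ - q)) * (x - (6 + 3 * θ + (3 + 2 * θ) * q))) = x ^ 2 - (6 + 4 * θ + 2 * (1 + θ) * q) * x - 3 := by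
          linear_combination (2 * q - 1) * hθ - (3 + 2 * θ) * hc
        have a2 : ((x - (θ - (-q))) * (x - (6 + 3 * θ + (3 + 2 * θ) * (-q)))) = x ^ 2 - (6 + 4 * θ - 2 * (1 + θ) * q) * x - 3 := by
          linear_combination (-2 * q - 1) * hθ - (3 + 2 * θ) * hc
        rw [a1, a2]
        rw [hy'] at hpp
        linear_combination hpp - 4 * (1 + θ) ^ 2 * x ^ 2 * hc - (8 * θ) * x ^ 2 * hθ
      rcases mul_eq_zero.mp e2 with h | h <;> rcases mul_eq_zero.mp h with h | h
      · exact ⟨θ, q, hθ, hc, Or.inl (by linear_combination h)⟩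
      · exact ⟨θ, q, hθ, hc, Or.inr (by linear_combination h)⟩
      · exact ⟨θ, -q, hθ, by linear_combination hc, Or.inl (by linear_combination h)⟩
      · exact ⟨θ, -q, hθ, by linear_combination hc, Or.inr (by linear_combination h)⟩
    · exact (hd.ns hG p hp).elim
    · exact (hd.ns hG p hp).elim

theorem Ea_list (hG : Good K) (s u : K) (h : u ^ 2 = s ^ 4 + 4 * s ^ 2 + 16) :
    s = 0 ∨ (s ^ 2 = 4 ∧ ∃ θ : K, θ ^ 2 = 3) ∨ s ^ 2 = -4 ∨ u = 0 ∨ (∃ i w : K, i ^ 2 = -1 ∧ w ^ 2 = 2 ∧ s ^ 2 = 4 * i) ∨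
    (∃ θ c : K, θ ^ 2 = 3 ∧ c ^ 2 = 2 * θ ∧ (s = 1 + θ + c ∨ s = - (1 + θ + c))) := by
  set x := (s ^ 2 + u + 2) / 2 with hx
  have hu : u = 2 * x - s ^ 2 - 2 := by rw [hx]; ring
  clear_value x
  have hxs : s ^ 2 * x = x ^ 2 - 2 * x - 3 := by subst hu; linear_combination -h / 4
  have hx0 : x ≠ 0 := by rintro rfl; norm_num at hxs
  rcases list6m hG x (s * x) (by linear_combination x * hxs) with rfl | rfl | rfl | h1 | ⟨rfl, h1⟩ | ⟨rfl, h1⟩ | ⟨θ, hθ, hx⟩ | ⟨i, w, hi, hw, hx⟩ | ⟨θ, c, hθ, hc, hx⟩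
  · exact absurd rfl hx0
  · left; have : s ^ 2 = 0 := by linear_combination hxs / 3
    simpa using this
  · left; have : s ^ 2 = 0 := by linear_combination -hxs
    simpa using this
  · right; right; right; left
    have : x * u = 0 := by rw [hu]; linear_combination h1 - hxs
    exact (mul_eq_zero.mp this).resolve_left hx0
  · right; right; left; linear_combination hxs
  · right; right; left; linear_combination - hxs / 3
  · right; left
    refine ⟨mul_right_cancel₀ hx0 ?_, θ, hθ⟩
    rw [hxs, hx]; linear_combination 4 * hθ
  · right; right; right; right; left
    refine ⟨i, w, hi, hw, mul_right_cancel₀ hx0 ?_⟩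
    rw [hxs, hx]; linear_combination (-4 + w ^ 2) * hi + 2 * i * hw
  · right; right; right; right; right
    refine ⟨θ, c, hθ, hc, ?_⟩
    have h2 : s ^ 2 = (1 + θ + c) ^ 2 := by
      refine mul_right_cancel₀ hx0 ?_
      rw [hxs]
      rcases hx with rfl | rfl
      · clear hxs hx0 hu hx h; grind
      · clear hxs hx0 hu hx h; grind
    have : (s - (1 + θ + c)) * (s + (1 + θ + c)) = 0 := by linear_combination h2
    rcases mul_eq_zero.mp this with h | h
    · left; linear_combination h
    · right; linear_combination h

theorem Eb_list (hG : Good K) (s u : K) (h : u ^ 2 = s ^ 4 + 14 * s ^ 2 + 1) :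
    s = 0 ∨ s ^ 2 = 1 ∨ (∃ i w : K, i ^ 2 = -1 ∧ w ^ 2 = 2 ∧ s ^ 2 = -3 + 2 * w) := by
  set x := (s ^ 2 + u + 7) / 2 with hx
  have hu : u = 2 * x - s ^ 2 - 7 := by rw [hx]; ring
  clear_value x
  have hxs : s ^ 2 * x = x ^ 2 - 7 * x + 12 := by subst hu; linear_combination -h / 4
  have hx0 : x ≠ 0 := by rintro rfl; norm_num at hxs
  rcases list6 hG x (s * x) (by linear_combination x * hxs) with rfl | rfl | rfl | rfl | rfl | ⟨i, w, hi, hw, hx⟩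
  · exact absurd rfl hx0
  · left; have : s ^ 2 = 0 := by linear_combination hxs / 3
    simpa using this
  · left; have : s ^ 2 = 0 := by linear_combination hxs / 4
    simpa using this
  · right; left; linear_combination hxs / 6
  · right; left; linear_combination hxs / 2
  · right; right
    refine ⟨i, w, hi, hw, mul_right_cancel₀ hx0 ?_⟩
    rw [hxs, hx]; linear_combination (2 - w) ^ 2 * hi - 2 * hw
end

end Part7

section Part8
section
variable {K : Type*} [Field K] [CharZero K]
theorem zA (hG : Good K) (i w y : K) (hi : i ^ 2 = -1) (hw : w ^ 2 = 2) : y ^ 2 ≠ 4 + 4 * i := by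
  intro hy
  have := z8norm hG i w hi hw 4 4 y (by rw [hy]; push_cast; ring)
  norm_num at this

theorem zB (hG : Good K) (i w y : K) (hi : i ^ 2 = -1) (hw : w ^ 2 = 2) : y ^ 2 ≠ 4 + 4 * i - 2 * (1 + i) * w := by
  intro hy
  obtain ⟨p, q, h1, h2⟩ := z8sq hG i w hi hw 4 4 (-2) (-2) y (by rw [hy]; push_cast; ring)
  have h3 : (p - q) * (p + q) = 0 := by linear_combination h1
  rcases mul_eq_zero.mp h3 with h3 | h3
  · exact rat_sq_ne 8 (by norm_num) p (by linear_combination h2 + p * h3)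
  · nlinarith [sq_nonneg p]

theorem zC (hG : Good K) (i w y : K) (hi : i ^ 2 = -1) (hw : w ^ 2 = 2) : y ^ 2 ≠ 32 * i - 16 * i * w := by
  intro hy
  obtain ⟨p, q, h1, h2⟩ := z8sq hG i w hi hw 0 32 0 (-16) y (by rw [hy]; push_cast; ring)
  have h3 : p * q = 0 := by linear_combination h2
  rcases mul_eq_zero.mp h3 with h3 | h3
  · subst h3; exact rat_sq_ne 512 (by norm_num) q (by linarith)
  · subst h3; nlinarith [sq_nonneg p]

theorem zD (hG : Good K) (i w y : K) (hi : i ^ 2 = -1) (hw : w ^ 2 = 2) : y ^ 2 ≠ 4 * (1 + i + w) := by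
  intro hy
  obtain ⟨p, q, h1, h2⟩ := z8sq hG i w hi hw 4 4 4 0 y (by rw [hy]; push_cast; ring)
  refine rat_sq_ne 2048 (by norm_num) (p ^ 2 + q ^ 2) ?_
  have h2 : p * q = 16 := by linarith
  have h1 : p ^ 2 - q ^ 2 = -32 := by linarith
  linear_combination (p ^ 2 - q ^ 2 - 32) * h1 + 4 * (p * q + 16) * h2
end

/-- The facts about the fixed field of `σ` that we use. -/
structure SG {L : Type*} [Field L] (σ : L →+* L) : Prop where
  inv : ∀ x, σ (σ x) = x
  no12 : ∀ i θ : L, σ i = i → σ θ = θ → i ^ 2 = -1 → θ ^ 2 = 3 → False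
  no6 : ∀ x : L, σ x = x → x ^ 2 ≠ 6
  no15 : ∀ x : L, σ x = x → x ^ 2 ≠ 15
  nom15 : ∀ x : L, σ x = x → x ^ 2 ≠ -15
  five : ∀ i w y : L, σ i = i → σ w = w → σ y = y → i ^ 2 = -1 → w ^ 2 = 2 → y ^ 2 ≠ 5
  zA : ∀ i w y : L, σ i = i → σ w = w → σ y = y → i ^ 2 = -1 → w ^ 2 = 2 → y ^ 2 ≠ 4 + 4 * i
  zB : ∀ i w y : L, σ i = i → σ w = w → σ y = y → i ^ 2 = -1 → w ^ 2 = 2 → y ^ 2 ≠ 4 + 4 * i - 2 * (1 + i) * w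
  zC : ∀ i w y : L, σ i = i → σ w = w → σ y = y → i ^ 2 = -1 → w ^ 2 = 2 → y ^ 2 ≠ 32 * i - 16 * i * w
  zD : ∀ i w y : L, σ i = i → σ w = w → σ y = y → i ^ 2 = -1 → w ^ 2 = 2 → y ^ 2 ≠ 4 * (1 + i + w)
  zdeg : ∀ i z : L, σ i = i → σ z = z → i ^ 2 = -1 → z ^ 8 + 4 * z ^ 6 - 4 * z ^ 5 + 6 * z ^ 4 + 2 ≠ 0
  c1 : ∀ θ c y : L, σ θ = θ → σ c = c → σ y = y → θ ^ 2 = 3 → c ^ 2 = 2 * θ → y ^ 2 ≠ 1 + θ + c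
  c2 : ∀ θ c y : L, σ θ = θ → σ c = c → σ y = y → θ ^ 2 = 3 → c ^ 2 = 2 * θ → y ^ 2 ≠ 8 + 4 * θ + (2 + 2 * θ) * c
  c3 : ∀ θ c y : L, σ θ = θ → σ c = c → σ y = y → θ ^ 2 = 3 → c ^ 2 = 2 * θ → y ^ 2 ≠ 2 + 2 * θ
  /-- the list on `E₆`, where `x / 2` is a square -/
  l6a : ∀ c y : L, σ c = c → σ y = y → y ^ 2 = 2 * c ^ 2 * (2 * c ^ 2 - 3) * (2 * c ^ 2 - 4) →
    c = 0 ∨ c ^ 2 = 2 ∨ c ^ 2 = 3 ∨ c ^ 2 = 1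
  /-- the list on `E₆`, where `x - 3` is a square -/
  l6b : ∀ x y c : L, σ x = x → σ y = y → σ c = c → y ^ 2 = x * (x - 3) * (x - 4) → c ^ 2 = x - 3 →
    x = 0 ∨ x = 3 ∨ x = 4 ∨ x = 6 ∨ x = 2
  ea : ∀ s u : L, σ s = s → σ u = u → u ^ 2 = s ^ 4 + 4 * s ^ 2 + 16 →
    s = 0 ∨ (s ^ 2 = 4 ∧ ∃ θ : L, σ θ = θ ∧ θ ^ 2 = 3) ∨ s ^ 2 = -4 ∨ u = 0 ∨
    (∃ i w : L, σ i = i ∧ σ w = w ∧ i ^ 2 = -1 ∧ w ^ 2 = 2 ∧ s ^ 2 = 4 * i) ∨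
    (∃ θ c : L, σ θ = θ ∧ σ c = c ∧ θ ^ 2 = 3 ∧ c ^ 2 = 2 * θ ∧ (s = 1 + θ + c ∨ s = - (1 + θ + c)))
  eb : ∀ s u : L, σ s = s → σ u = u → u ^ 2 = s ^ 4 + 14 * s ^ 2 + 1 →
    s = 0 ∨ s ^ 2 = 1 ∨ (∃ i w : L, σ i = i ∧ σ w = w ∧ i ^ 2 = -1 ∧ w ^ 2 = 2 ∧ s ^ 2 = -3 + 2 * w)

set_option linter.unusedSimpArgs false in
theorem SG_of {K L : Type*} [Field K] [CharZero K] [Field L] (hG : Good K) (f : K →+* L) (σ : L →+* L)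
    (inv : ∀ x, σ (σ x) = x) (hfix : ∀ x, σ x = x ↔ ∃ y, f y = x) : SG σ := by
  have F : ∀ x, σ (f x) = f x := fun x => (hfix _).mpr ⟨x, rfl⟩
  have hinj := f.injective
  have e2 : f 2 = 2 := map_ofNat f 2
  have e3 : f 3 = 3 := map_ofNat f 3
  have e4 : f 4 = 4 := map_ofNat f 4
  have e5 : f 5 = 5 := map_ofNat f 5
  have e6 : f 6 = 6 := map_ofNat f 6
  have e8 : f 8 = 8 := map_ofNat f 8
  have e14 : f 14 = 14 := map_ofNat f 14
  have e15 : f 15 = 15 := map_ofNat f 15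
  have e16 : f 16 = 16 := map_ofNat f 16
  have e32 : f 32 = 32 := map_ofNat f 32
  refine ⟨inv, ?_, ?_, ?_, ?_, ?_, ?_, ?_, ?_, ?_, ?_, ?_, ?_, ?_, ?_, ?_, ?_, ?_⟩
  · intro i θ hi hθ h1 h2
    obtain ⟨i, rfl⟩ := (hfix _).mp hi
    obtain ⟨θ, rfl⟩ := (hfix _).mp hθ
    exact hG.no12 i θ (hinj (by simpa [e2, e3, e4, e5, e6, e8, e14, e15, e16, e32] using h1)) (hinj (by simpa [e2, e3, e4, e5, e6, e8, e14, e15, e16, e32] using h2))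
  · intro i hi h1
    obtain ⟨i, rfl⟩ := (hfix _).mp hi
    exact hG.no6 i (hinj (by simpa [e2, e3, e4, e5, e6, e8, e14, e15, e16, e32] using h1))
  · intro i hi h1
    obtain ⟨i, rfl⟩ := (hfix _).mp hi
    exact hG.no15 i (hinj (by simpa [e2, e3, e4, e5, e6, e8, e14, e15, e16, e32] using h1))
  · intro i hi h1
    obtain ⟨i, rfl⟩ := (hfix _).mp hi
    exact hG.nom15 i (hinj (by simpa [e2, e3, e4, e5, e6, e8, e14, e15, e16, e32] using h1))
  · intro i w y hi hw hy h1 h2 h3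
    obtain ⟨i, rfl⟩ := (hfix _).mp hi
    obtain ⟨w, rfl⟩ := (hfix _).mp hw
    obtain ⟨y, rfl⟩ := (hfix _).mp hy
    exact z8five hG i w (hinj (by simpa [e2, e3, e4, e5, e6, e8, e14, e15, e16, e32] using h1)) (hinj (by simpa [e2, e3, e4, e5, e6, e8, e14, e15, e16, e32] using h2)) y (hinj (by simpa [e2, e3, e4, e5, e6, e8, e14, e15, e16, e32] using h3))
  · intro i w y hi hw hy h1 h2 h3
    obtain ⟨i, rfl⟩ := (hfix _).mp hi
    obtain ⟨w, rfl⟩ := (hfix _).mp hw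
    obtain ⟨y, rfl⟩ := (hfix _).mp hy
    exact _root_.zA hG i w y (hinj (by simpa [e2, e3, e4, e5, e6, e8, e14, e15, e16, e32] using h1)) (hinj (by simpa [e2, e3, e4, e5, e6, e8, e14, e15, e16, e32] using h2)) (hinj (by simpa [e2, e3, e4, e5, e6, e8, e14, e15, e16, e32] using h3))
  · intro i w y hi hw hy h1 h2 h3
    obtain ⟨i, rfl⟩ := (hfix _).mp hi
    obtain ⟨w, rfl⟩ := (hfix _).mp hw
    obtain ⟨y, rfl⟩ := (hfix _).mp hy
    exact _root_.zB hG i w y (hinj (by simpa [e2, e3, e4, e5, e6, e8, e14, e15, e16, e32] using h1)) (hinj (by simpa [e2, e3, e4, e5, e6, e8, e14, e15, e16, e32] using h2)) (hinj (by simpa [e2, e3, e4, e5, e6, e8, e14, e15, e16, e32] using h3))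
  · intro i w y hi hw hy h1 h2 h3
    obtain ⟨i, rfl⟩ := (hfix _).mp hi
    obtain ⟨w, rfl⟩ := (hfix _).mp hw
    obtain ⟨y, rfl⟩ := (hfix _).mp hy
    exact _root_.zC hG i w y (hinj (by simpa [e2, e3, e4, e5, e6, e8, e14, e15, e16, e32] using h1)) (hinj (by simpa [e2, e3, e4, e5, e6, e8, e14, e15, e16, e32] using h2)) (hinj (by simpa [e2, e3, e4, e5, e6, e8, e14, e15, e16, e32] using h3))
  · intro i w y hi hw hy h1 h2 h3
    obtain ⟨i, rfl⟩ := (hfix _).mp hi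
    obtain ⟨w, rfl⟩ := (hfix _).mp hw
    obtain ⟨y, rfl⟩ := (hfix _).mp hy
    exact _root_.zD hG i w y (hinj (by simpa [e2, e3, e4, e5, e6, e8, e14, e15, e16, e32] using h1)) (hinj (by simpa [e2, e3, e4, e5, e6, e8, e14, e15, e16, e32] using h2)) (hinj (by simpa [e2, e3, e4, e5, e6, e8, e14, e15, e16, e32] using h3))
  · intro i z hi hz h1 h2
    obtain ⟨i, rfl⟩ := (hfix _).mp hi
    obtain ⟨z, rfl⟩ := (hfix _).mp hz
    exact hG.z8deg i z (hinj (by simpa [e2, e3, e4, e5, e6, e8, e14, e15, e16, e32] using h1)) (hinj (by simpa [e2, e3, e4, e5, e6, e8, e14, e15, e16, e32] using h2))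
  · intro i w y hi hw hy h1 h2 h3
    obtain ⟨i, rfl⟩ := (hfix _).mp hi
    obtain ⟨w, rfl⟩ := (hfix _).mp hw
    obtain ⟨y, rfl⟩ := (hfix _).mp hy
    exact c4ns1 hG i w (hinj (by simpa [e2, e3, e4, e5, e6, e8, e14, e15, e16, e32] using h1)) (hinj (by simpa [e2, e3, e4, e5, e6, e8, e14, e15, e16, e32] using h2)) y (hinj (by simpa [e2, e3, e4, e5, e6, e8, e14, e15, e16, e32] using h3))
  · intro i w y hi hw hy h1 h2 h3
    obtain ⟨i, rfl⟩ := (hfix _).mp hi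
    obtain ⟨w, rfl⟩ := (hfix _).mp hw
    obtain ⟨y, rfl⟩ := (hfix _).mp hy
    exact c4ns2 hG i w (hinj (by simpa [e2, e3, e4, e5, e6, e8, e14, e15, e16, e32] using h1)) (hinj (by simpa [e2, e3, e4, e5, e6, e8, e14, e15, e16, e32] using h2)) y (hinj (by simpa [e2, e3, e4, e5, e6, e8, e14, e15, e16, e32] using h3))
  · intro i w y hi hw hy h1 h2 h3
    obtain ⟨i, rfl⟩ := (hfix _).mp hi
    obtain ⟨w, rfl⟩ := (hfix _).mp hw
    obtain ⟨y, rfl⟩ := (hfix _).mp hy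
    exact c4ns3 hG i w (hinj (by simpa [e2, e3, e4, e5, e6, e8, e14, e15, e16, e32] using h1)) (hinj (by simpa [e2, e3, e4, e5, e6, e8, e14, e15, e16, e32] using h2)) y (hinj (by simpa [e2, e3, e4, e5, e6, e8, e14, e15, e16, e32] using h3))
  · intro c y hc hy h1
    obtain ⟨c, rfl⟩ := (hfix _).mp hc
    obtain ⟨y, rfl⟩ := (hfix _).mp hy
    have h1 : y ^ 2 = 2 * c ^ 2 * (2 * c ^ 2 - 3) * (2 * c ^ 2 - 4) := hinj (by simpa [e2, e3, e4, e5, e6, e8, e14, e15, e16, e32] using h1)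
    have key : c = 0 ∨ c ^ 2 = 2 ∨ c ^ 2 = 3 ∨ c ^ 2 = 1 := by
      rcases list6 hG _ y h1 with h | h | h | h | h | h
      · left; simpa [e2, e3, e4, e5, e6, e8, e14, e15, e16, e32] using h
      · exact (hG.no6 (2 * c) (by linear_combination 2 * h)).elim
      · right; left; linear_combination h / 2
      · right; right; left; linear_combination h / 2
      · right; right; right; linear_combination h / 2
      · exact (h.ns2 hG c rfl).elim
    rcases key with rfl | h | h | h
    · simp [e2, e3, e4, e5, e6, e8, e14, e15, e16, e32]
    · right; left; rw [← map_pow, h, e2]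
    · right; right; left; rw [← map_pow, h, e3]
    · right; right; right; rw [← map_pow, h, map_one]
  · intro x y c hx hy hc h1 h2
    obtain ⟨c, rfl⟩ := (hfix _).mp hc
    obtain ⟨y, rfl⟩ := (hfix _).mp hy
    obtain ⟨x, rfl⟩ := (hfix _).mp hx
    have h1 : y ^ 2 = x * (x - 3) * (x - 4) := hinj (by simpa [e2, e3, e4, e5, e6, e8, e14, e15, e16, e32] using h1)
    have h2 : c ^ 2 = x - 3 := hinj (by simpa [e2, e3, e4, e5, e6, e8, e14, e15, e16, e32] using h2)
    rcases list6 hG _ y h1 with rfl | rfl | rfl | rfl | rfl | h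
    · simp [e2, e3, e4, e5, e6, e8, e14, e15, e16, e32]
    · simp [e2, e3, e4, e5, e6, e8, e14, e15, e16, e32]
    · simp [e2, e3, e4, e5, e6, e8, e14, e15, e16, e32]
    · simp [e2, e3, e4, e5, e6, e8, e14, e15, e16, e32]
    · simp [e2, e3, e4, e5, e6, e8, e14, e15, e16, e32]
    · exact (h.ns3 hG c h2).elim
  · intro s u hs hu h1
    obtain ⟨s, rfl⟩ := (hfix _).mp hs
    obtain ⟨u, rfl⟩ := (hfix _).mp hu
    have h1 : u ^ 2 = s ^ 4 + 4 * s ^ 2 + 16 := hinj (by simpa [e2, e3, e4, e5, e6, e8, e14, e15, e16, e32] using h1)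
    rcases Ea_list hG s u h1 with rfl | ⟨h, θ, hθ⟩ | h | rfl | ⟨i, w, h2, h3, h4⟩ | ⟨θ, c, h2, h3, h4⟩
    · simp [e2, e3, e4, e5, e6, e8, e14, e15, e16, e32]
    · right; left; exact ⟨by rw [← map_pow, h]; simp [e2, e3, e4, e5, e6, e8, e14, e15, e16, e32], f θ, F _, by rw [← map_pow, hθ]; simp [e2, e3, e4, e5, e6, e8, e14, e15, e16, e32]⟩
    · right; right; left; rw [← map_pow, h]; simp [e2, e3, e4, e5, e6, e8, e14, e15, e16, e32]
    · simp [e2, e3, e4, e5, e6, e8, e14, e15, e16, e32]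
    · right; right; right; right; left
      exact ⟨f i, f w, F _, F _, by rw [← map_pow, h2]; simp [e2, e3, e4, e5, e6, e8, e14, e15, e16, e32], by rw [← map_pow, h3]; simp [e2, e3, e4, e5, e6, e8, e14, e15, e16, e32], by rw [← map_pow, h4]; simp [e2, e3, e4, e5, e6, e8, e14, e15, e16, e32]⟩
    · right; right; right; right; right
      refine ⟨f θ, f c, F _, F _, by rw [← map_pow, h2]; simp [e2, e3, e4, e5, e6, e8, e14, e15, e16, e32], by rw [← map_pow, h3]; simp [e2, e3, e4, e5, e6, e8, e14, e15, e16, e32], ?_⟩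
      rcases h4 with rfl | rfl
      · left; simp [e2, e3, e4, e5, e6, e8, e14, e15, e16, e32]
      · right; simp [e2, e3, e4, e5, e6, e8, e14, e15, e16, e32]
  · intro s u hs hu h1
    obtain ⟨s, rfl⟩ := (hfix _).mp hs
    obtain ⟨u, rfl⟩ := (hfix _).mp hu
    have h1 : u ^ 2 = s ^ 4 + 14 * s ^ 2 + 1 := hinj (by simpa [e2, e3, e4, e5, e6, e8, e14, e15, e16, e32] using h1)
    rcases Eb_list hG s u h1 with rfl | h | ⟨i, w, h2, h3, h4⟩
    · simp [e2, e3, e4, e5, e6, e8, e14, e15, e16, e32]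
    · right; left; rw [← map_pow, h]; simp [e2, e3, e4, e5, e6, e8, e14, e15, e16, e32]
    · right; right
      exact ⟨f i, f w, F _, F _, by rw [← map_pow, h2]; simp [e2, e3, e4, e5, e6, e8, e14, e15, e16, e32], by rw [← map_pow, h3]; simp [e2, e3, e4, e5, e6, e8, e14, e15, e16, e32], by rw [← map_pow, h4]; simp [e2, e3, e4, e5, e6, e8, e14, e15, e16, e32]⟩

end Part8

section Part9
set_option linter.unusedSimpArgs false
set_option linter.unusedSectionVars false

section
variable {L : Type*} [Field L] [CharZero L] {σ : L →+* L}

/-- A non-trivial point in the coordinates `s = t - 1/t`, `W = t + 1/t`, `Yᵢ = Xᵢ / t`. -/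
structure Pt {L : Type*} [Field L] (s W Y1 Y3 : L) : Prop where
  hW : W ^ 2 = s ^ 2 + 4
  h1 : Y1 ^ 2 = s ^ 2 - 2 * s + 4
  h3 : Y3 ^ 2 = s ^ 2 + 2 * s + 4
  s0 : s ≠ 0
  W0 : W ≠ 0
  s4 : s ^ 2 ≠ 4
  Y10 : Y1 ≠ 0
  Y30 : Y3 ≠ 0

theorem pm {x : L} (h : σ x ^ 2 = x ^ 2) : σ x = x ∨ σ x = -x := sq_eq_sq_iff_eq_or_eq_neg.mp h

theorem Pt.neg {s W Y1 Y3 : L} (P : Pt s W Y1 Y3) : Pt (-s) W Y3 Y1 :=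
  ⟨by linear_combination P.hW, by linear_combination P.h3, by linear_combination P.h1, neg_ne_zero.mpr P.s0, P.W0,
    by simpa using P.s4, P.Y30, P.Y10⟩

theorem Pt.negW {s W Y1 Y3 : L} (P : Pt s W Y1 Y3) : Pt s (-W) Y1 Y3 :=
  ⟨by linear_combination P.hW, P.h1, P.h3, P.s0, neg_ne_zero.mpr P.W0, P.s4, P.Y10, P.Y30⟩

theorem Pt.r {s W Y1 Y3 : L} (P : Pt s W Y1 Y3) : Pt (4 / s) (2 * W / s) (2 * Y1 / s) (2 * Y3 / s) := by
  have s0 := P.s0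
  have c2 : (2 : L) ≠ 0 := two_ne_zero
  have c4 : (4 : L) ≠ 0 := by norm_num
  refine ⟨?_, ?_, ?_, div_ne_zero c4 s0, div_ne_zero (mul_ne_zero c2 P.W0) s0, ?_,
    div_ne_zero (mul_ne_zero c2 P.Y10) s0, div_ne_zero (mul_ne_zero c2 P.Y30) s0⟩
  · field_simp; linear_combination 4 * P.hW
  · field_simp; linear_combination 4 * P.h1
  · field_simp; linear_combination 4 * P.h3
  · intro h
    apply P.s4
    field_simp at h
    linear_combination -h

theorem Pt.u2 {s W Y1 Y3 : L} (P : Pt s W Y1 Y3) : (Y1 * Y3) ^ 2 = s ^ 4 + 4 * s ^ 2 + 16 := by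
  rw [mul_pow, P.h1, P.h3]; ring

theorem N1a (h : SG σ) {s W Y1 Y3 : L} (P : Pt s W Y1 Y3) (hs : σ s = s) (hW : σ W = W) (h1 : σ Y1 = -Y1)
    (h3 : σ Y3 = -Y3) : False := by
  rcases h.ea s (Y1 * Y3) hs (by rw [map_mul, h1, h3]; ring) P.u2 with e | ⟨e, -⟩ | e | e | ⟨i, w, hi, hw, hi2, hw2, e⟩ |
    ⟨θ, c, hθ, hc, hθ2, hc2, e⟩
  · exact P.s0 e
  · exact P.s4 e
  · exact P.W0 (pow_eq_zero_iff two_ne_zero |>.mp (by rw [P.hW, e]; ring))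
  · exact (mul_ne_zero P.Y10 P.Y30) e
  · exact h.zA i w W hi hw hW hi2 hw2 (by rw [P.hW, e]; ring)
  · refine h.c2 θ c W hθ hc hW hθ2 hc2 ?_
    have hPW := P.hW
    clear P
    rcases e with rfl | rfl <;> grind

theorem N1b1z (h : SG σ) {s W Y1 Y3 i w : L} (P : Pt s W Y1 Y3) (hs : σ s = s) (hW : σ W = -W)
    (hi : σ i = i) (hw : σ w = w) (hi2 : i ^ 2 = -1) (hw2 : w ^ 2 = 2) (e : s = (1 + i) * w) : False := by
  have hPW := P.hW
  have hP1 := P.h1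
  have : σ Y1 = Y1 ∨ σ Y1 = -Y1 := pm (by rw [← map_pow, P.h1]; simp only [map_add, map_sub, map_mul, map_pow, map_ofNat, hs])
  clear P
  rcases this with h1 | h1
  · refine h.zB i w Y1 hi hw h1 hi2 hw2 ?_
    grind
  · refine h.zC i w (Y1 * W) hi hw (by rw [map_mul, h1, hW]; ring) hi2 hw2 ?_
    rw [mul_pow, hPW, hP1]
    clear hPW hP1
    grind

theorem N1b1c (h : SG σ) {s W Y1 Y3 θ c : L} (P : Pt s W Y1 Y3) (hs : σ s = s) (hW : σ W = -W)
    (hθ : σ θ = θ) (hc : σ c = c) (hθ2 : θ ^ 2 = 3) (hc2 : c ^ 2 = 2 * θ) (e : s = 1 + θ + c) : False := by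
  have hPW := P.hW
  have hP1 := P.h1
  have s0 := P.s0
  have : σ Y1 = Y1 ∨ σ Y1 = -Y1 := pm (by rw [← map_pow, P.h1]; simp only [map_add, map_sub, map_mul, map_pow, map_ofNat, hs])
  have c0 : c ≠ 0 := by
    rintro rfl
    have : θ = 0 := by grind
    subst this
    norm_num at hθ2
  clear P
  have k1 : W ^ 2 = (2 + 2 * θ) * s := by grind
  have k2 : Y1 ^ 2 = c ^ 2 * s := by grind
  rcases this with h1 | h1
  · refine h.c1 θ c (Y1 / c) hθ hc (by rw [map_div₀, h1, hc]) hθ2 hc2 ?_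
    rw [div_pow, k2]
    field_simp
    exact e
  · refine h.c3 θ c (Y1 * W / (s * c)) hθ hc (by rw [map_div₀, map_mul, map_mul, h1, hW, hc, hs]; ring) hθ2 hc2 ?_
    rw [div_pow, mul_pow, k2, k1]
    field_simp

theorem N1b1 (h : SG σ) {s W Y1 Y3 : L} (P : Pt s W Y1 Y3) (hs : σ s = s) (hW : σ W = -W)
    (hu : σ (Y1 * Y3) = Y1 * Y3) : False := by
  rcases h.ea s (Y1 * Y3) hs hu P.u2 with e | ⟨e, -⟩ | e | e | ⟨i, w, hi, hw, hi2, hw2, e⟩ |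
    ⟨θ, c, hθ, hc, hθ2, hc2, e | e⟩
  · exact P.s0 e
  · exact P.s4 e
  · exact P.W0 (pow_eq_zero_iff two_ne_zero |>.mp (by rw [P.hW, e]; ring))
  · exact (mul_ne_zero P.Y10 P.Y30) e
  · have : s = (1 + i) * w ∨ s = - ((1 + i) * w) := sq_eq_sq_iff_eq_or_eq_neg.mp (by rw [e]; clear P; grind)
    rcases this with e | e
    · exact N1b1z h P hs hW hi hw hi2 hw2 e
    · exact N1b1z (w := -w) h P hs hW hi (by rw [map_neg, hw]) hi2 (by rw [neg_pow_two, hw2]) (by rw [e]; ring)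
  · exact N1b1c h P hs hW hθ hc hθ2 hc2 e
  · exact N1b1c h P.neg (by rw [map_neg, hs]) hW hθ hc hθ2 hc2 (by rw [e]; ring)

theorem N1b2 (h : SG σ) {s W Y1 Y3 : L} (P : Pt s W Y1 Y3) (hs : σ s = s) (hW : σ W = -W)
    (h1 : σ Y1 = Y1) (h3 : σ Y3 = -Y3) : False := by
  have hPW := P.hW
  have hP1 := P.h1
  have hP3 := P.h3
  have W0 := P.W0
  have s0 := P.s0
  have Y10 := P.Y10
  have Y30 := P.Y30
  clear P
  have hc2 : (Y3 / W) ^ 2 * W ^ 2 = Y3 ^ 2 := by field_simp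
  have hc : σ (Y3 / W) = Y3 / W := by rw [map_div₀, hW, h3, neg_div_neg_eq]
  have c0 : Y3 / W ≠ 0 := by positivity
  generalize Y3 / W = c at *
  have hy : σ (2 * c * (Y1 * (s - 2) / W ^ 2)) = 2 * c * (Y1 * (s - 2) / W ^ 2) := by
    simp only [map_mul, map_div₀, map_sub, map_pow, map_ofNat, hc, h1, hs, hW, neg_pow_two]
  rcases h.l6a c _ hc hy (by
    field_simp
    rw [hP1]
    have e : W ^ 4 = (W ^ 2) ^ 2 := by ring
    have e1 : (2 * c ^ 2 - 3) * W ^ 2 = 2 * Y3 ^ 2 - 3 * W ^ 2 := by linear_combination 2 * hc2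
    have e2 : (2 * c ^ 2 - 4) * W ^ 2 = 2 * Y3 ^ 2 - 4 * W ^ 2 := by linear_combination 2 * hc2
    have : (W ^ 2) ^ 2 * (2 * c ^ 2 - 3) * (2 * c ^ 2 - 4) = (2 * Y3 ^ 2 - 3 * W ^ 2) * (2 * Y3 ^ 2 - 4 * W ^ 2) := by
      rw [← e1, ← e2]; ring
    rw [hP3, hPW] at this
    rw [e, hPW]
    linear_combination -this) with e | e | e | e
  · exact c0 e
  · apply Y10
    have : Y1 ^ 2 = 0 := by rw [hP1]; rw [e, hPW, hP3] at hc2; linear_combination hc2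
    simpa using this
  · rw [e, hPW, hP3] at hc2
    exact h.nom15 (2 * s - 1) (by simp only [map_sub, map_mul, map_ofNat, map_one, hs]) (by linear_combination 2 * hc2)
  · rw [e, hPW, hP3] at hc2
    apply s0
    linear_combination -hc2 / 2

theorem N1 (h : SG σ) {s W Y1 Y3 : L} (P : Pt s W Y1 Y3) (hs : σ s = s) : σ W = W ∧ (σ Y1 = Y1 ∨ σ Y3 = Y3) := by
  have hW : σ W = W ∨ σ W = -W := pm (by rw [← map_pow, P.hW]; simp only [map_add, map_sub, map_mul, map_pow, map_ofNat, hs])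
  have h1 : σ Y1 = Y1 ∨ σ Y1 = -Y1 := pm (by rw [← map_pow, P.h1]; simp only [map_add, map_sub, map_mul, map_pow, map_ofNat, hs])
  have h3 : σ Y3 = Y3 ∨ σ Y3 = -Y3 := pm (by rw [← map_pow, P.h3]; simp only [map_add, map_sub, map_mul, map_pow, map_ofNat, hs])
  rcases hW with hW | hW
  · refine ⟨hW, ?_⟩
    rcases h1 with h1 | h1
    · exact Or.inl h1
    rcases h3 with h3 | h3
    · exact Or.inr h3
    exact (N1a h P hs hW h1 h3).elim
  · exfalso
    rcases h1 with h1 | h1 <;> rcases h3 with h3 | h3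
    · exact N1b1 h P hs hW (by rw [map_mul, h1, h3])
    · exact N1b2 h P hs hW h1 h3
    · exact N1b2 h P.neg (by rw [map_neg, hs]) hW h3 h1
    · exact N1b1 h P hs hW (by rw [map_mul, h1, h3]; ring)
end

end Part9

section Part10
set_option linter.unusedSimpArgs false
set_option linter.unusedSectionVars false
section
variable {L : Type*} [Field L] [CharZero L] {σ : L →+* L}

/-- relation for `t = (s + W) / 2` -/
theorem Pt.ht {s W Y1 Y3 : L} (P : Pt s W Y1 Y3) : ((s + W) / 2) ^ 2 = s * ((s + W) / 2) + 1 := by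
  linear_combination P.hW / 4

theorem N2a (h : SG σ) {s W Y1 Y3 : L} (P : Pt s W Y1 Y3) (hs : σ s = -s) (hW : σ W = -W) : False := by
  have hswap : ∃ e : L, e ^ 2 = 1 ∧ σ e = e ∧ σ Y1 = e * Y3 ∧ σ Y3 = e * Y1 := by
    have h1 : σ Y1 = Y3 ∨ σ Y1 = -Y3 := sq_eq_sq_iff_eq_or_eq_neg.mp (by
      rw [← map_pow, P.h1, P.h3]; simp only [map_add, map_sub, map_mul, map_pow, map_ofNat, hs]; ring)
    rcases h1 with h1 | h1
    · refine ⟨1, by ring, map_one σ, by rw [h1, one_mul], ?_⟩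
      rw [← h1, h.inv, one_mul]
    · refine ⟨-1, by ring, by simp, by rw [h1]; ring, ?_⟩
      have := h.inv Y1
      rw [h1, map_neg] at this
      linear_combination -this
  obtain ⟨e, he, hse, h1, h3⟩ := hswap
  have hu : σ (Y1 * Y3) = Y1 * Y3 := by
    rw [map_mul, h1, h3]; linear_combination Y1 * Y3 * he
  have ht := P.ht
  have htW : W * ((s + W) / 2) = ((s + W) / 2) ^ 2 + 1 := by linear_combination P.hW / 4
  have hσt : σ ((s + W) / 2) = - ((s + W) / 2) := by
    simp only [map_add, map_div₀, map_ofNat, hs, hW]; ring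
  generalize (s + W) / 2 = t at *
  have t0 : t ≠ 0 := by rintro rfl; norm_num at ht
  have hT : σ (t ^ 2) = t ^ 2 := by rw [map_pow, hσt]; ring
  have hu2 := P.u2
  have hst : s * t = t ^ 2 - 1 := by linear_combination -ht
  rcases h.eb (t ^ 2) (Y1 * Y3 * t ^ 2) hT (by rw [map_mul, hu, hT]) (by
    rw [mul_pow, hu2]
    have e4 : (s * t) ^ 4 = (t ^ 2 - 1) ^ 4 := by rw [hst]
    have e2 : (s * t) ^ 2 = (t ^ 2 - 1) ^ 2 := by rw [hst]
    linear_combination e4 + 4 * t ^ 2 * e2) with e0 | e0 | ⟨i, w, hi, hw, hi2, hw2, e0⟩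
  · exact t0 (by simpa using e0)
  · have : (s * t) * (W * t) = 0 := by rw [hst, htW]; linear_combination e0
    exact mul_ne_zero (mul_ne_zero P.s0 t0) (mul_ne_zero P.W0 t0) this
  · have q : t ^ 8 + 6 * t ^ 4 + 1 = 0 := by
      linear_combination (t ^ 4 + 6 + (-3 + 2 * w)) * e0 + 4 * hw2
    have hj : ((s ^ 2 + 2) / 2) ^ 2 = -1 := by
      have : t ^ 4 * (((s ^ 2 + 2) / 2) ^ 2 + 1) = 0 := by
        have e4 : (s * t) ^ 4 = (t ^ 2 - 1) ^ 4 := by rw [hst]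
        have e2 : (s * t) ^ 2 = (t ^ 2 - 1) ^ 2 := by rw [hst]
        linear_combination e4 / 4 + t ^ 2 * e2 + q / 4
      rcases mul_eq_zero.mp this with h0 | h0
      · exact (pow_ne_zero 4 t0 h0).elim
      · linear_combination h0
    refine h.zD ((s ^ 2 + 2) / 2) (e * (Y1 * Y3) / 2) (Y1 + e * Y3) ?_ ?_ ?_ hj ?_ ?_
    · simp only [map_add, map_div₀, map_pow, map_ofNat, hs]; ring
    · rw [map_div₀, map_mul, hse, hu, map_ofNat]
    · rw [map_add, map_mul, hse, h1, h3]; linear_combination Y1 * he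
    · linear_combination (Y1 * Y3) ^ 2 / 4 * he + hu2 / 4 + hj
    · linear_combination P.h1 + P.h3 + Y3 ^ 2 * he

theorem N2 (h : SG σ) {s W Y1 Y3 : L} (P : Pt s W Y1 Y3) (hs : σ s = -s) : False := by
  have hW : σ W = W ∨ σ W = -W := pm (by
    rw [← map_pow, P.hW]; simp only [map_add, map_sub, map_mul, map_pow, map_ofNat, hs]; ring)
  rcases hW with hW | hW
  · refine N2a h P.r ?_ ?_
    · simp only [map_div₀, map_ofNat, hs]; ring
    · simp only [map_div₀, map_mul, map_ofNat, hs, hW]; ring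
  · exact N2a h P hs hW

theorem N3 (h : SG σ) {s W Y1 Y3 : L} (P : Pt s W Y1 Y3) (hs : σ s = -4 / s) : False := by
  have s0 := P.s0
  have hW : σ W = 2 * W / s ∨ σ W = - (2 * W / s) := sq_eq_sq_iff_eq_or_eq_neg.mp (by
    rw [← map_pow, P.hW, div_pow, mul_pow, P.hW]; simp only [map_add, map_sub, map_mul, map_pow, map_ofNat, hs]
    field_simp; ring)
  have hi := h.inv W
  have key : 2 * W = 0 := by
    rcases hW with hW | hW
    · rw [hW] at hi
      simp only [map_div₀, map_mul, map_ofNat, hs, hW] at hi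
      field_simp at hi
      linear_combination -hi / 4
    · rw [hW] at hi
      simp only [map_div₀, map_neg, map_mul, map_ofNat, hs, hW] at hi
      field_simp at hi
      linear_combination -hi / 4
  exact P.W0 (by simpa using key)

theorem N4core (h : SG σ) {k a b : L} (hk : σ k = k) (ha : σ a = a) (hb : σ b = b) (ha2 : a ^ 2 = k ^ 2 - 4)
    (hb2 : b ^ 2 = k * (k - 4)) : k = 0 ∨ k = 2 ∨ k = -2 ∨ k = 4 ∨ k = 1 := by
  have hx : σ (((k - 1) ^ 2 + a * b + 3) / 2) = ((k - 1) ^ 2 + a * b + 3) / 2 := by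
    simp only [map_add, map_sub, map_mul, map_pow, map_div₀, map_ofNat, map_one, hk, ha, hb]
  have hc : σ ((a + b) / 2) = (a + b) / 2 := by
    simp only [map_add, map_sub, map_mul, map_pow, map_div₀, map_ofNat, map_one, hk, ha, hb]
  have hc2 : ((a + b) / 2) ^ 2 = ((k - 1) ^ 2 + a * b + 3) / 2 - 3 := by
    linear_combination ha2 / 4 + hb2 / 4
  have rel : (((k - 1) ^ 2 + a * b + 3) / 2) * (((k - 1) ^ 2 + a * b + 3) / 2 - 3) =
      (k - 1) ^ 2 * (((k - 1) ^ 2 + a * b + 3) / 2 - 4) := by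
    linear_combination b ^ 2 / 4 * ha2 + (k ^ 2 - 4) / 4 * hb2
  generalize ((k - 1) ^ 2 + a * b + 3) / 2 = x at *
  have hy : σ ((k - 1) * (x - 4)) = (k - 1) * (x - 4) := by
    simp only [map_add, map_sub, map_mul, map_pow, map_div₀, map_ofNat, map_one, hk, hx]
  rcases h.l6b x _ _ hx hy hc (by linear_combination -(x - 4) * rel) hc2 with e | e | e | e | e
  · have : (k - 1) ^ 2 = 0 := by rw [e] at rel; linear_combination rel / 4
    have : k - 1 = 0 := by simpa using this
    right; right; right; right; linear_combination this
  · have : (k - 1) ^ 2 = 0 := by rw [e] at rel; linear_combination rel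
    have : k - 1 = 0 := by simpa using this
    right; right; right; right; linear_combination this
  · rw [e] at rel
    norm_num at rel
  · have : (k - 4) * (k + 2) = 0 := by rw [e] at rel; linear_combination -rel / 2
    rcases mul_eq_zero.mp this with h0 | h0
    · right; right; right; left; linear_combination h0
    · right; right; left; linear_combination h0
  · have : k * (k - 2) = 0 := by rw [e] at rel; linear_combination rel / 2
    rcases mul_eq_zero.mp this with h0 | h0
    · left; exact h0
    · right; left; linear_combination h0

theorem N4one (h : SG σ) {s W Y1 Y3 : L} (P : Pt s W Y1 Y3) (hs : σ s = 4 / s) (hk : s ^ 2 + 4 = s)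
    (hno : ∀ i, σ i = i → i ^ 2 = -1 → False) : False := by
  have s0 := P.s0
  have W0 := P.W0
  have hi2 : (Y1 / W) ^ 2 = -1 := by
    rw [div_pow, P.h1, P.hW, hk]
    field_simp
    linear_combination hk
  have := pm (σ := σ) (x := Y1 / W) (by rw [← map_pow, hi2]; simp)
  rcases this with e | e
  · exact hno _ e hi2
  · refine h.no15 (Y1 / W * (s - 4 / s)) ?_ ?_
    · rw [map_mul, e]
      simp only [map_sub, map_div₀, map_ofNat, hs]
      field_simp
      ring
    · rw [mul_pow, hi2]
      field_simp
      linear_combination -(s ^ 2 + 4 + s) * hk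

theorem N4 (h : SG σ) {s W Y1 Y3 : L} (P : Pt s W Y1 Y3) (hs : σ s = 4 / s) (hu : σ (Y1 * Y3 / s) = Y1 * Y3 / s) :
    False := by
  have s0 := P.s0
  have hu2 := P.u2
  have hPW := P.hW
  have hW : ∃ e : L, e ^ 2 = 1 ∧ σ e = e ∧ σ W = e * (2 * W / s) := by
    have : σ W = 2 * W / s ∨ σ W = - (2 * W / s) := sq_eq_sq_iff_eq_or_eq_neg.mp (by
      rw [← map_pow, P.hW, div_pow, mul_pow, P.hW]; simp only [map_add, map_sub, map_mul, map_pow, map_ofNat, hs]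
      field_simp; ring)
    rcases this with h1 | h1
    · exact ⟨1, by ring, by simp, by rw [h1, one_mul]⟩
    · exact ⟨-1, by ring, by simp, by rw [h1]; ring⟩
  obtain ⟨e, he, hse, hW⟩ := hW
  have hk : σ (-e * (s + 4 / s)) = -e * (s + 4 / s) := by
    simp only [map_mul, map_neg, map_add, map_div₀, map_ofNat, hs, hse]
    field_simp; ring
  have hb : σ (W + e * (2 * W / s)) = W + e * (2 * W / s) := by
    rw [← hW, map_add, h.inv, add_comm]
  have hα2 : (Y1 * Y3 / s) ^ 2 = (s + 4 / s) ^ 2 - 4 := by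
    rw [div_pow, hu2]; field_simp; ring
  have hno1 : (s + 4 / s) ^ 2 = 1 → ∀ i, σ i = i → i ^ 2 = -1 → False := by
    intro hk1 i hi hi2
    refine h.no12 i (i * (Y1 * Y3 / s)) hi (by rw [map_mul, hi, hu]) hi2 ?_
    linear_combination i ^ 2 * hα2 + (i ^ 2) * hk1 - 3 * hi2
  have key := N4core h hk hu hb (by rw [hα2]; linear_combination -(s + 4 / s) ^ 2 * he) (by
    have : (W + e * (2 * W / s)) ^ 2 = W ^ 2 * (1 + 2 * e / s) ^ 2 := by field_simp
    rw [this, hPW]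
    field_simp
    linear_combination (-(s ^ 2 + 4) * s ^ 2) * he)
  have k0 : s + 4 / s ≠ 0 := by
    intro h0
    field_simp at h0
    apply P.W0
    have : W ^ 2 = 0 := by rw [hPW]; linear_combination h0
    simpa using this
  have k2 : s + 4 / s ≠ 2 := by
    intro h0
    field_simp at h0
    apply P.Y10
    have : Y1 ^ 2 = 0 := by rw [P.h1]; linear_combination h0
    simpa using this
  have k2m : s + 4 / s ≠ -2 := by
    intro h0
    field_simp at h0
    apply P.Y30
    have : Y3 ^ 2 = 0 := by rw [P.h3]; linear_combination h0
    simpa using this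
  have k4 : s + 4 / s ≠ 4 := by
    intro h0
    field_simp at h0
    apply P.s4
    have : (s - 2) ^ 2 = 0 := by linear_combination h0
    have : s - 2 = 0 := by simpa using this
    linear_combination (s + 2) * this
  have k4m : s + 4 / s ≠ -4 := by
    intro h0
    field_simp at h0
    apply P.s4
    have : (s + 2) ^ 2 = 0 := by linear_combination h0
    have : s + 2 = 0 := by simpa using this
    linear_combination (s - 2) * this
  have k1 : s + 4 / s ≠ 1 := by
    intro h0
    have := hno1 (by rw [h0]; ring)
    field_simp at h0
    exact N4one h P hs h0 this
  have k1m : s + 4 / s ≠ -1 := by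
    intro h0
    have := hno1 (by rw [h0]; ring)
    field_simp at h0
    exact N4one h P.neg (by rw [map_neg, hs, div_neg]) (by linear_combination h0) this
  have : e = 1 ∨ e = -1 := sq_eq_sq_iff_eq_or_eq_neg.mp (by rw [he, one_pow])
  generalize s + 4 / s = k at *
  rcases this with rfl | rfl
  · rcases key with e | e | e | e | e
    · exact k0 (by linear_combination -e)
    · exact k2m (by linear_combination -e)
    · exact k2 (by linear_combination -e)
    · exact k4m (by linear_combination -e)
    · exact k1m (by linear_combination -e)
  · rcases key with e | e | e | e | e
    · exact k0 (by linear_combination e)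
    · exact k2 (by linear_combination e)
    · exact k2m (by linear_combination e)
    · exact k4 (by linear_combination e)
    · exact k1 (by linear_combination e)
end

end Part10

section Part11
set_option linter.unusedSimpArgs false
set_option linter.unusedSectionVars false
section
variable {L : Type*} [Field L] [CharZero L] {σ : L →+* L}

theorem PA_rel {s z a b u v s3 : L} (hsz : s ≠ z) (hu : u ^ 2 = s ^ 4 + 4 * s ^ 2 + 16)
    (hv : v ^ 2 = z ^ 4 + 4 * z ^ 2 + 16) (eu : u = s ^ 2 + a * s + b) (ev : v = z ^ 2 + a * z + b)
    (a0 : a ≠ 0) (h3 : 2 * a * (s + z + s3) = 4 - a ^ 2 - 2 * b) :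
    s * z + (s + z) * s3 = b ∧ 2 * a * (s * z * s3) = 16 - b ^ 2 := by
  subst eu ev
  have p1 : 2 * a * s ^ 3 - 2 * a * (s + z + s3) * s ^ 2 + 2 * a * b * s + b ^ 2 - 16 = 0 := by
    rw [h3]; linear_combination hu
  have p2 : 2 * a * z ^ 3 - 2 * a * (s + z + s3) * z ^ 2 + 2 * a * b * z + b ^ 2 - 16 = 0 := by
    rw [h3]; linear_combination hv
  have e : s * z + (s + z) * s3 = b := by
    have : (2 * a * (s - z)) * (s * z + (s + z) * s3 - b) = 0 := by linear_combination p2 - p1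
    rcases mul_eq_zero.mp this with h0 | h0
    · exact (mul_ne_zero (mul_ne_zero two_ne_zero a0) (sub_ne_zero.mpr hsz) h0).elim
    · linear_combination h0
  refine ⟨e, ?_⟩
  subst e
  linear_combination p1

theorem PA_f1 {s z a b y y' s3 : L} (hy : y ^ 2 = s ^ 2 - 2 * s + 4) (hy' : y' ^ 2 = z ^ 2 - 2 * z + 4)
    (h3 : 2 * a * (s + z + s3) = 4 - a ^ 2 - 2 * b) (h1 : s * z + (s + z) * s3 = b)
    (h2 : 2 * a * (s * z * s3) = 16 - b ^ 2) :
    (4 * (a + 2) ^ 2 + 2 * (a + 2) * (b - 4) + (b - 4) ^ 2) ^ 2 = (s3 ^ 2 - 2 * s3 + 4) * (2 * a * (y * y')) ^ 2 := by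
  have e : (2 * a * (y * y')) ^ 2 = 4 * a ^ 2 * ((s ^ 2 - 2 * s + 4) * (z ^ 2 - 2 * z + 4)) := by
    rw [← hy, ← hy']; ring
  rw [e]
  have hA : 2 * a * (b - 2 * (s + z + s3)) = 2 * (a + 2) * (a + b - 2) := by linear_combination -2 * h3
  have hB : 2 * a * (4 * (s + z + s3) - 8 - s * z * s3) = (b - 4) ^ 2 - 4 * (a + 2) ^ 2 := by
    linear_combination 4 * h3 - h2
  have key : (s3 ^ 2 - 2 * s3 + 4) * ((s ^ 2 - 2 * s + 4) * (z ^ 2 - 2 * z + 4)) =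
      4 * (b - 2 * (s + z + s3)) ^ 2 + 2 * (b - 2 * (s + z + s3)) * (4 * (s + z + s3) - 8 - s * z * s3) +
      (4 * (s + z + s3) - 8 - s * z * s3) ^ 2 := by
    rw [← h1]; ring
  generalize hA' : b - 2 * (s + z + s3) = A at *
  generalize hB' : 4 * (s + z + s3) - 8 - s * z * s3 = B at *
  have : (s3 ^ 2 - 2 * s3 + 4) * (4 * a ^ 2 * ((s ^ 2 - 2 * s + 4) * (z ^ 2 - 2 * z + 4))) =
    4 * (2 * a * A) ^ 2 + 2 * (2 * a * A) * (2 * a * B) + (2 * a * B) ^ 2 := by linear_combination 4 * a ^ 2 * key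
  rw [this, hA, hB]
  ring

theorem six_aux (h : SG σ) {v x : L} (hv : σ v = v) (hvx : v ^ 2 = 4 * x) (e : x ^ 2 - 2 * x + 4 = 0) : False := by
  have v0 : v ≠ 0 := by
    rintro rfl
    have : x = 0 := by linear_combination -hvx / 4
    subst this
    norm_num at e
  refine h.no6 ((v ^ 2 / 4 + 2) * 2 / v) ?_ ?_
  · simp only [map_add, map_div₀, map_pow, map_mul, map_ofNat, hv]
  · field_simp
    linear_combination 4 * (v ^ 2 + 4 * x - 8) * hvx + 64 * e

theorem caseC_N {a b m n s3 : L} (a0 : a ≠ 0) (h3 : 2 * a * (m + s3) = 4 - a ^ 2 - 2 * b) (h1 : n + m * s3 = b)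
    (hs3 : s3 ^ 2 = -4) (hu : (s3 ^ 2 + a * s3 + b) ^ 2 = 16) :
    (n ^ 2 + 4 * (m ^ 2 - 2 * n) + 16) ^ 2 = 64 * n ^ 2 := by
  have hu : (a * s3 + b - 4) ^ 2 = 4 ^ 2 := by rw [hs3] at hu; linear_combination hu
  rcases sq_eq_sq_iff_eq_or_eq_neg.mp hu with hb | hb
  · have hb : b = 8 - a * s3 := by linear_combination hb
    subst hb
    have hm : 2 * a * m = -(a ^ 2 + 12) := by linear_combination h3
    have hn : 2 * a * n = 16 * a - s3 * (a ^ 2 - 12) := by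
      linear_combination 2 * a * h1 - s3 * hm
    have : 4 * a ^ 2 * (n ^ 2 + 4 * (m ^ 2 - 2 * n) + 16 - 8 * n) = 0 := by
      have e1 : (2 * a * n) ^ 2 = (16 * a - s3 * (a ^ 2 - 12)) ^ 2 := by rw [hn]
      have e2 : (2 * a * m) ^ 2 = (a ^ 2 + 12) ^ 2 := by rw [hm]; ring
      linear_combination e1 + 4 * e2 - 32 * a * hn + (a ^ 2 - 12) ^ 2 * hs3
    rcases mul_eq_zero.mp this with h0 | h0
    · exact (mul_ne_zero (by norm_num) (pow_ne_zero 2 a0) h0).elim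
    · linear_combination (n ^ 2 + 4 * (m ^ 2 - 2 * n) + 16 + 8 * n) * h0
  · have hb : b = - a * s3 := by linear_combination hb
    subst hb
    have hm : 2 * a * m = 4 - a ^ 2 := by linear_combination h3
    have hn : 2 * a * n = - s3 * (a ^ 2 + 4) := by
      linear_combination 2 * a * h1 - s3 * hm
    have : 4 * a ^ 2 * (n ^ 2 + 4 * (m ^ 2 - 2 * n) + 16 + 8 * n) = 0 := by
      have e1 : (2 * a * n) ^ 2 = (s3 * (a ^ 2 + 4)) ^ 2 := by rw [hn]; ring
      have e2 : (2 * a * m) ^ 2 = (4 - a ^ 2) ^ 2 := by rw [hm]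
      linear_combination e1 + 4 * e2 + (a ^ 2 + 4) ^ 2 * hs3
    rcases mul_eq_zero.mp this with h0 | h0
    · exact (mul_ne_zero (by norm_num) (pow_ne_zero 2 a0) h0).elim
    · linear_combination (n ^ 2 + 4 * (m ^ 2 - 2 * n) + 16 - 8 * n) * h0

theorem pencilA (h : SG σ) {s W Y1 Y3 : L} (P : Pt s W Y1 Y3) (hs : σ s ≠ s) :
    (∃ θ : L, σ θ = θ ∧ θ ^ 2 = 3) ∨
    (∃ i w : L, σ i = i ∧ σ w = w ∧ i ^ 2 = -1 ∧ w ^ 2 = 2 ∧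
      ((s ^ 2 + 4) * (σ s ^ 2 + 4)) ^ 2 = 64 * (s * σ s) ^ 2) := by
  have hsz : s - σ s ≠ 0 := sub_ne_zero.mpr (Ne.symm hs)
  have hu2 := P.u2
  have hv2 : σ (Y1 * Y3) ^ 2 = σ s ^ 4 + 4 * σ s ^ 2 + 16 := by
    rw [← map_pow, hu2]; simp only [map_add, map_mul, map_pow, map_ofNat]
  obtain ⟨a, ha⟩ : ∃ a, a = (Y1 * Y3 - σ (Y1 * Y3)) / (s - σ s) - (s + σ s) := ⟨_, rfl⟩
  have hσa : σ a = a := by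
    rw [ha]
    simp only [map_sub, map_add, map_div₀, h.inv]
    rw [← neg_sub s, ← neg_sub (Y1 * Y3), neg_div_neg_eq, add_comm s]
  have ha' : (a + s + σ s) * (s - σ s) = Y1 * Y3 - σ (Y1 * Y3) := by rw [ha]; field_simp; ring
  obtain ⟨b, hb⟩ : ∃ b, b = Y1 * Y3 - s ^ 2 - a * s := ⟨_, rfl⟩
  have eu : Y1 * Y3 = s ^ 2 + a * s + b := by rw [hb]; ring
  have ev : σ (Y1 * Y3) = σ s ^ 2 + a * σ s + b := by rw [hb]; linear_combination ha'
  have hσb : σ b = b := by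
    have : σ b = σ (Y1 * Y3) - σ s ^ 2 - a * σ s := by
      rw [hb]; simp only [map_sub, map_mul, map_pow, hσa]
    rw [this, ev]; ring
  by_cases a0 : a = 0
  · exfalso
    rw [a0] at eu ev
    rw [eu] at hu2
    rw [ev] at hv2
    have : (2 * b - 4) * (s - σ s) * (s + σ s) = 0 := by linear_combination hu2 - hv2
    rcases mul_eq_zero.mp this with h0 | h0
    · rcases mul_eq_zero.mp h0 with h0 | h0
      · have : b = 2 := by linear_combination h0 / 2
        rw [this] at hu2
        have : (12 : L) = 0 := by linear_combination -hu2
        norm_num at this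
      · exact hsz h0
    · exact N2 h P (by linear_combination h0)
  have hs3 : ∃ s3, 2 * a * (s + σ s + s3) = 4 - a ^ 2 - 2 * b ∧ σ s3 = s3 := by
    refine ⟨(4 - a ^ 2 - 2 * b) / (2 * a) - (s + σ s), by field_simp; ring, ?_⟩
    simp only [map_sub, map_add, map_div₀, map_mul, map_pow, map_ofNat, h.inv, hσa, hσb]
    ring
  obtain ⟨s3, h3, hσ3⟩ := hs3
  obtain ⟨r1, r2⟩ := PA_rel (Ne.symm hs) hu2 hv2 eu ev a0 h3
  have hu3 : (s3 ^ 2 + a * s3 + b) ^ 2 = s3 ^ 4 + 4 * s3 ^ 2 + 16 := by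
    linear_combination s3 ^ 2 * h3 + r2 - 2 * a * s3 * r1
  have hf1 : ∃ v, σ v = v ∧ v ^ 2 = s3 ^ 2 - 2 * s3 + 4 := by
    have := PA_f1 (y := Y1) (y' := σ Y1) P.h1 (by rw [← map_pow, P.h1]; simp only [map_add, map_sub, map_mul, map_pow, map_ofNat])
      h3 r1 r2
    have y0 : Y1 ≠ 0 := P.Y10
    have y0' : σ Y1 ≠ 0 := (map_ne_zero σ).mpr P.Y10
    refine ⟨(4 * (a + 2) ^ 2 + 2 * (a + 2) * (b - 4) + (b - 4) ^ 2) / (2 * a * (Y1 * σ Y1)), ?_, ?_⟩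
    · simp only [map_sub, map_add, map_div₀, map_mul, map_pow, map_ofNat, h.inv, hσa, hσb, mul_comm (σ Y1)]
    · rw [div_pow, this]
      field_simp
  have hf3 : ∃ v, σ v = v ∧ v ^ 2 = s3 ^ 2 + 2 * s3 + 4 := by
    have := PA_f1 (s := -s) (z := -σ s) (a := -a) (b := b) (s3 := -s3) (y := Y3) (y' := σ Y3) (by linear_combination P.h3)
      (by rw [← map_pow, P.h3]; simp only [map_add, map_sub, map_mul, map_pow, map_ofNat]; ring)
      (by linear_combination h3) (by linear_combination r1) (by linear_combination r2)
    have y0 : Y3 ≠ 0 := P.Y30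
    have y0' : σ Y3 ≠ 0 := (map_ne_zero σ).mpr P.Y30
    refine ⟨(4 * (-a + 2) ^ 2 + 2 * (-a + 2) * (b - 4) + (b - 4) ^ 2) / (2 * -a * (Y3 * σ Y3)), ?_, ?_⟩
    · simp only [map_sub, map_add, map_div₀, map_mul, map_pow, map_neg, map_ofNat, h.inv, hσa, hσb, mul_comm (σ Y3)]
    · rw [div_pow, this]
      field_simp
      ring
  obtain ⟨v1, hv1, ev1⟩ := hf1
  obtain ⟨v3, hv3, ev3⟩ := hf3
  have s0 := P.s0
  rcases h.ea s3 (s3 ^ 2 + a * s3 + b) hσ3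
    (by simp only [map_add, map_mul, map_pow, hσ3, hσa, hσb]) hu3 with e | ⟨-, θ, hθ⟩ | e | e |
    ⟨i, w, hi, hw, hi2, hw2, e⟩ | ⟨θ, c, hθ, hc, hθ2, hc2, e⟩
  · exfalso
    have hn : s * σ s = b := by rw [e] at r1; linear_combination r1
    have hb2 : b ^ 2 = 4 ^ 2 := by rw [e] at r2; linear_combination r2
    rcases sq_eq_sq_iff_eq_or_eq_neg.mp hb2 with hb4 | hb4
    · refine N4 h P (by rw [eq_div_iff s0]; linear_combination hn + hb4) ?_
      have : Y1 * Y3 / s = s + σ s + a := by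
        rw [eu, div_eq_iff s0]; linear_combination -hn
      rw [this]
      simp only [map_add, h.inv, hσa]
      ring
    · exact N3 h P (by rw [eq_div_iff s0]; linear_combination hn + hb4)
  · exact Or.inl ⟨θ, hθ⟩
  · right
    have hi2 : (s3 / 2) ^ 2 = -1 := by linear_combination e / 4
    have hi : σ (s3 / 2) = s3 / 2 := by rw [map_div₀, hσ3, map_ofNat]
    have hne : 1 - s3 / 2 ≠ 0 := by
      intro h0
      have : s3 / 2 = 1 := by linear_combination -h0
      rw [this] at hi2
      norm_num at hi2
    refine ⟨s3 / 2, v1 / (1 - s3 / 2), hi, ?_, hi2, ?_, ?_⟩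
    · rw [map_div₀, map_sub, hv1, hi, map_one]
    · rw [div_pow, ev1, div_eq_iff (pow_ne_zero 2 hne)]
      linear_combination e / 2
    · have := caseC_N a0 h3 r1 e (by rw [hu3]; linear_combination (s3 ^ 2) * e)
      linear_combination this
  · exfalso
    rw [e] at hu3
    have : (s3 ^ 2 - 2 * s3 + 4) * (s3 ^ 2 + 2 * s3 + 4) = 0 := by linear_combination -hu3
    rcases mul_eq_zero.mp this with h0 | h0
    · exact six_aux h hv3 (x := s3) (by linear_combination ev3 + h0) h0
    · exact six_aux h hv1 (x := -s3) (by linear_combination ev1 + h0) (by linear_combination h0)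
  · exfalso
    have : s3 = (1 + i) * w ∨ s3 = - ((1 + i) * w) :=
      sq_eq_sq_iff_eq_or_eq_neg.mp (by linear_combination e - (1 + i) ^ 2 * hw2 - 2 * hi2)
    rcases this with e1 | e1
    · refine h.zB i w v1 hi hw hv1 hi2 hw2 ?_
      rw [ev1, e, e1]; ring
    · refine h.zB i (-w) v1 hi (by rw [map_neg, hw]) hv1 hi2 (by rw [neg_pow_two, hw2]) ?_
      rw [ev1, e, e1]; ring
  · exact Or.inl ⟨θ, hθ, hθ2⟩
end

end Part11

section Part12
set_option linter.unusedSimpArgs false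
set_option linter.unusedSectionVars false
section
variable {L : Type*} [Field L] [CharZero L] {σ : L →+* L}

theorem PB_rel {s z a b u v s3 : L} (hsz : s ≠ z) (hu : u ^ 2 = s ^ 4 + 14 * s ^ 2 + 1)
    (hv : v ^ 2 = z ^ 4 + 14 * z ^ 2 + 1) (eu : u = s ^ 2 + a * s + b) (ev : v = z ^ 2 + a * z + b)
    (a0 : a ≠ 0) (h3 : 2 * a * (s + z + s3) = 14 - a ^ 2 - 2 * b) :
    s * z + (s + z) * s3 = b ∧ 2 * a * (s * z * s3) = 1 - b ^ 2 := by
  subst eu ev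
  have p1 : 2 * a * s ^ 3 - 2 * a * (s + z + s3) * s ^ 2 + 2 * a * b * s + b ^ 2 - 1 = 0 := by
    rw [h3]; linear_combination hu
  have p2 : 2 * a * z ^ 3 - 2 * a * (s + z + s3) * z ^ 2 + 2 * a * b * z + b ^ 2 - 1 = 0 := by
    rw [h3]; linear_combination hv
  have e : s * z + (s + z) * s3 = b := by
    have : (2 * a * (s - z)) * (s * z + (s + z) * s3 - b) = 0 := by linear_combination p2 - p1
    rcases mul_eq_zero.mp this with h0 | h0
    · exact (mul_ne_zero (mul_ne_zero two_ne_zero a0) (sub_ne_zero.mpr hsz) h0).elim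
    · linear_combination h0
  refine ⟨e, ?_⟩
  subst e
  linear_combination p1

/-- the case `T₃² = 1` -/
theorem PB_one {a b m n x : L} (a0 : a ≠ 0) (h3 : 2 * a * (m + x) = 14 - a ^ 2 - 2 * b) (h1 : n + m * x = b)
    (hx : x ^ 2 = 1) (hu : (x ^ 2 + a * x + b) ^ 2 = 16) :
    (n ^ 2 - m ^ 2 + 2 * n + 1) ^ 2 = 64 * n ^ 2 := by
  have hu : (a * x + b + 1) ^ 2 = 4 ^ 2 := by rw [hx] at hu; linear_combination hu
  rcases sq_eq_sq_iff_eq_or_eq_neg.mp hu with hb | hb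
  · have hb : b = 3 - a * x := by linear_combination hb
    subst hb
    have hm : 2 * a * m = 8 - a ^ 2 := by linear_combination h3
    have hn : 2 * a * n = 6 * a - x * (a ^ 2 + 8) := by
      linear_combination 2 * a * h1 - x * hm
    have : 4 * a ^ 2 * (n ^ 2 - m ^ 2 + 2 * n + 1 - 8 * n) = 0 := by
      have e1 : (2 * a * n) ^ 2 = (6 * a - x * (a ^ 2 + 8)) ^ 2 := by rw [hn]
      have e2 : (2 * a * m) ^ 2 = (8 - a ^ 2) ^ 2 := by rw [hm]
      linear_combination e1 - e2 - 12 * a * hn + (a ^ 2 + 8) ^ 2 * hx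
    rcases mul_eq_zero.mp this with h0 | h0
    · exact (mul_ne_zero (by norm_num) (pow_ne_zero 2 a0) h0).elim
    · linear_combination (n ^ 2 - m ^ 2 + 2 * n + 1 + 8 * n) * h0
  · have hb : b = -5 - a * x := by linear_combination hb
    subst hb
    have hm : 2 * a * m = 24 - a ^ 2 := by linear_combination h3
    have hn : 2 * a * n = -10 * a - x * (a ^ 2 + 24) := by
      linear_combination 2 * a * h1 - x * hm
    have : 4 * a ^ 2 * (n ^ 2 - m ^ 2 + 2 * n + 1 + 8 * n) = 0 := by
      have e1 : (2 * a * n) ^ 2 = (-10 * a - x * (a ^ 2 + 24)) ^ 2 := by rw [hn]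
      have e2 : (2 * a * m) ^ 2 = (24 - a ^ 2) ^ 2 := by rw [hm]
      linear_combination e1 - e2 + 20 * a * hn + (a ^ 2 + 24) ^ 2 * hx
    rcases mul_eq_zero.mp this with h0 | h0
    · exact (mul_ne_zero (by norm_num) (pow_ne_zero 2 a0) h0).elim
    · linear_combination (n ^ 2 - m ^ 2 + 2 * n + 1 - 8 * n) * h0

theorem PB_ext1 {a M N x : L} (hx : x ^ 4 + 6 * x ^ 2 + 1 = 0)
    (hM : M = 14 - a ^ 2 - 2 * (x * (x ^ 2 + 3) - x ^ 2))
    (hN : N = 2 * a * (x * (x ^ 2 + 3) - x ^ 2 - a * x) - M * x) :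
    N ^ 4 + 6 * N ^ 2 * (M ^ 2 - 4 * a * N) + (M ^ 2 - 4 * a * N) ^ 2 + 34 * (4 * a ^ 2) * N ^ 2 +
      24 * a ^ 2 * (M ^ 2 - 4 * a * N) + 16 * a ^ 4 =
    4 * (x ^ 3 + 7 * x) * (2 * a * N) * (N ^ 2 - M ^ 2 + 4 * a * N + 4 * a ^ 2) ∨
    N ^ 4 + 6 * N ^ 2 * (M ^ 2 - 4 * a * N) + (M ^ 2 - 4 * a * N) ^ 2 + 34 * (4 * a ^ 2) * N ^ 2 +
      24 * a ^ 2 * (M ^ 2 - 4 * a * N) + 16 * a ^ 4 =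
    -4 * (x ^ 3 + 7 * x) * (2 * a * N) * (N ^ 2 - M ^ 2 + 4 * a * N + 4 * a ^ 2) := by
  subst hN hM
  first
  | left; grind
  | right; grind

theorem PB_ext2 {a b m n x : L} (a0 : a ≠ 0) (h3 : 2 * a * (m + x) = 14 - a ^ 2 - 2 * b) (h1 : n + m * x = b)
    (hx : x ^ 4 + 6 * x ^ 2 + 1 = 0) (hu : x ^ 2 + a * x + b = x * (x ^ 2 + 3)) :
    ∃ l : L, l ^ 2 = -128 ∧ n ^ 4 + 6 * n ^ 2 * (m ^ 2 - 2 * n) + (m ^ 2 - 2 * n) ^ 2 + 34 * n ^ 2 +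
      6 * (m ^ 2 - 2 * n) + 1 = l * n * (n ^ 2 - m ^ 2 + 2 * n + 1) := by
  have hb : b = x * (x ^ 2 + 3) - x ^ 2 - a * x := by linear_combination hu
  have hM : 2 * a * m = 14 - a ^ 2 - 2 * (x * (x ^ 2 + 3) - x ^ 2) := by
    linear_combination h3 - 2 * hb
  have hN : 2 * a * n = 2 * a * (x * (x ^ 2 + 3) - x ^ 2 - a * x) - 2 * a * m * x := by
    linear_combination 2 * a * h1 + 2 * a * hb
  have hl : (4 * (x ^ 3 + 7 * x)) ^ 2 = -128 := by
    linear_combination (16 * x ^ 2 + 128) * hx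
  have a4 : 16 * a ^ 4 ≠ 0 := mul_ne_zero (by norm_num) (pow_ne_zero 4 a0)
  rcases PB_ext1 hx hM hN with e | e
  · refine ⟨4 * (x ^ 3 + 7 * x), hl, ?_⟩
    apply mul_left_cancel₀ a4
    linear_combination e
  · refine ⟨-(4 * (x ^ 3 + 7 * x)), by rw [neg_pow_two, hl], ?_⟩
    apply mul_left_cancel₀ a4
    linear_combination e

theorem PB_ext {a b m n x : L} (a0 : a ≠ 0) (h3 : 2 * a * (m + x) = 14 - a ^ 2 - 2 * b) (h1 : n + m * x = b)
    (hx : x ^ 4 + 6 * x ^ 2 + 1 = 0) (hu : (x ^ 2 + a * x + b) ^ 2 = (x * (x ^ 2 + 3)) ^ 2) :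
    ∃ l : L, l ^ 2 = -128 ∧ n ^ 4 + 6 * n ^ 2 * (m ^ 2 - 2 * n) + (m ^ 2 - 2 * n) ^ 2 + 34 * n ^ 2 +
      6 * (m ^ 2 - 2 * n) + 1 = l * n * (n ^ 2 - m ^ 2 + 2 * n + 1) := by
  rcases sq_eq_sq_iff_eq_or_eq_neg.mp hu with e | e
  · exact PB_ext2 a0 h3 h1 hx e
  · obtain ⟨l, hl, e⟩ := PB_ext2 (a := -a) (b := b) (m := -m) (n := n) (x := -x) (neg_ne_zero.mpr a0)
      (by linear_combination h3) (by linear_combination h1) (by linear_combination hx) (by linear_combination e)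
    exact ⟨l, hl, by linear_combination e⟩

theorem pencilB (h : SG σ) {s W Y1 Y3 : L} (P : Pt s W Y1 Y3) :
    σ (s * W) ^ 2 = (s * W) ^ 2 ∨ ((s * W) * σ (s * W)) ^ 2 = 64 ∨
    (∃ i w l : L, σ i = i ∧ σ w = w ∧ i ^ 2 = -1 ∧ w ^ 2 = 2 ∧ l ^ 2 = -128 ∧
      ((s * W) ^ 2 + 8) * (σ (s * W) ^ 2 + 8) = l * ((s * W) * σ (s * W))) := by
  obtain ⟨T, Z, T0, hk, hZ⟩ : ∃ T Z : L, T ≠ 0 ∧ (s * W) * T = T ^ 2 - 1 ∧ Z ^ 2 = T ^ 4 + 14 * T ^ 2 + 1 := by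
    have ht := P.ht
    have htW : W * ((s + W) / 2) = ((s + W) / 2) ^ 2 + 1 := by linear_combination P.hW / 4
    generalize (s + W) / 2 = t at *
    have t0 : t ≠ 0 := by rintro rfl; norm_num at ht
    have hst : s * t = t ^ 2 - 1 := by linear_combination -ht
    refine ⟨t ^ 2, Y1 * Y3 * t ^ 2, pow_ne_zero 2 t0, ?_, ?_⟩
    · linear_combination W * t * hst + (t ^ 2 - 1) * htW
    · rw [mul_pow, P.u2]
      have e4 : (s * t) ^ 4 = (t ^ 2 - 1) ^ 4 := by rw [hst]
      have e2 : (s * t) ^ 2 = (t ^ 2 - 1) ^ 2 := by rw [hst]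
      linear_combination e4 + 4 * t ^ 2 * e2
  generalize s * W = k at *
  clear P
  have T0' : σ T ≠ 0 := (map_ne_zero σ).mpr T0
  have hk' : σ k * σ T = σ T ^ 2 - 1 := by rw [← map_mul, hk]; simp only [map_sub, map_pow, map_one]
  have hZ' : σ Z ^ 2 = σ T ^ 4 + 14 * σ T ^ 2 + 1 := by
    rw [← map_pow, hZ]; simp only [map_add, map_mul, map_pow, map_ofNat, map_one]
  by_cases hT : σ T = T
  · left
    have : (σ k - k) * T = 0 := by rw [hT] at hk'; linear_combination hk' - hk
    rcases mul_eq_zero.mp this with h0 | h0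
    · linear_combination (σ k + k) * h0
    · exact (T0 h0).elim
  have hsz : T - σ T ≠ 0 := sub_ne_zero.mpr (Ne.symm hT)
  obtain ⟨a, ha⟩ : ∃ a, a = (Z - σ Z) / (T - σ T) - (T + σ T) := ⟨_, rfl⟩
  have hσa : σ a = a := by
    rw [ha]
    simp only [map_sub, map_add, map_div₀, h.inv]
    rw [← neg_sub T, ← neg_sub Z, neg_div_neg_eq, add_comm T]
  have ha' : (a + T + σ T) * (T - σ T) = Z - σ Z := by rw [ha]; field_simp; ring
  obtain ⟨b, hb⟩ : ∃ b, b = Z - T ^ 2 - a * T := ⟨_, rfl⟩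
  have eu : Z = T ^ 2 + a * T + b := by rw [hb]; ring
  have ev : σ Z = σ T ^ 2 + a * σ T + b := by rw [hb]; linear_combination ha'
  have hσb : σ b = b := by
    have : σ b = σ Z - σ T ^ 2 - a * σ T := by
      rw [hb]; simp only [map_sub, map_mul, map_pow, hσa]
    rw [this, ev]; ring
  by_cases a0 : a = 0
  · left
    rw [a0] at eu ev
    rw [eu] at hZ
    rw [ev] at hZ'
    have : (2 * b - 14) * (T - σ T) * (T + σ T) = 0 := by linear_combination hZ - hZ'
    rcases mul_eq_zero.mp this with h0 | h0
    · rcases mul_eq_zero.mp h0 with h0 | h0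
      · have : b = 7 := by linear_combination h0 / 2
        rw [this] at hZ
        have : (48 : L) = 0 := by linear_combination hZ
        norm_num at this
      · exact (hsz h0).elim
    · have hT' : σ T = -T := by linear_combination h0
      have : (σ k + k) * T = 0 := by rw [hT'] at hk'; linear_combination -hk' + hk
      rcases mul_eq_zero.mp this with h0 | h0
      · linear_combination (σ k - k) * h0
      · exact (T0 h0).elim
  have hs3 : ∃ s3, 2 * a * (T + σ T + s3) = 14 - a ^ 2 - 2 * b ∧ σ s3 = s3 := by
    refine ⟨(14 - a ^ 2 - 2 * b) / (2 * a) - (T + σ T), by field_simp; ring, ?_⟩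
    simp only [map_sub, map_add, map_div₀, map_mul, map_pow, map_ofNat, h.inv, hσa, hσb]
    ring
  obtain ⟨s3, h3, hσ3⟩ := hs3
  obtain ⟨r1, r2⟩ := PB_rel (Ne.symm hT) hZ hZ' eu ev a0 h3
  have hu3 : (s3 ^ 2 + a * s3 + b) ^ 2 = s3 ^ 4 + 14 * s3 ^ 2 + 1 := by
    linear_combination s3 ^ 2 * h3 + r2 - 2 * a * s3 * r1
  have n0 : T * σ T ≠ 0 := mul_ne_zero T0 T0'
  have hkk : (T * σ T) * (k * σ k) = (T * σ T) ^ 2 - (T + σ T) ^ 2 + 2 * (T * σ T) + 1 := by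
    linear_combination σ k * σ T * hk + (T ^ 2 - 1) * hk'
  rcases h.eb s3 (s3 ^ 2 + a * s3 + b) hσ3
    (by simp only [map_add, map_mul, map_pow, hσ3, hσa, hσb]) hu3 with e | e | ⟨i, w, hi, hw, hi2, hw2, e⟩
  · left
    have hn : T * σ T = b := by rw [e] at r1; linear_combination r1
    have hb2 : b ^ 2 = 1 ^ 2 := by rw [e] at r2; linear_combination r2
    have hn2 : (T * σ T) ^ 2 = 1 := by rw [hn, hb2, one_pow]
    have : (T * σ T) ^ 2 * (σ k ^ 2 - k ^ 2) = 0 := by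
      have e1 : (k * T) ^ 2 = (T ^ 2 - 1) ^ 2 := by rw [hk]
      have e2 : (σ k * σ T) ^ 2 = (σ T ^ 2 - 1) ^ 2 := by rw [hk']
      linear_combination T ^ 2 * e2 - σ T ^ 2 * e1 + (σ T ^ 2 - T ^ 2) * hn2
    rcases mul_eq_zero.mp this with h0 | h0
    · exact (pow_ne_zero 2 n0 h0).elim
    · linear_combination h0
  · right; left
    have := PB_one a0 h3 r1 e (by rw [hu3]; linear_combination (s3 ^ 2 + 15) * e)
    rw [← hkk] at this
    apply mul_left_cancel₀ (pow_ne_zero 2 n0)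
    linear_combination this
  · right; right
    have hq : s3 ^ 4 + 6 * s3 ^ 2 + 1 = 0 := by
      linear_combination (s3 ^ 2 + 6 + (-3 + 2 * w)) * e + 4 * hw2
    obtain ⟨l, hl, el⟩ := PB_ext a0 h3 r1 hq (by rw [hu3]; linear_combination (1 - s3 ^ 2) * hq)
    refine ⟨i, w, l, hi, hw, hi2, hw2, hl, ?_⟩
    apply mul_left_cancel₀ (pow_ne_zero 2 n0)
    have e1 : (k ^ 2 + 8) * T ^ 2 = T ^ 4 + 6 * T ^ 2 + 1 := by linear_combination (k * T + T ^ 2 - 1) * hk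
    have e2 : (σ k ^ 2 + 8) * σ T ^ 2 = σ T ^ 4 + 6 * σ T ^ 2 + 1 := by
      linear_combination (σ k * σ T + σ T ^ 2 - 1) * hk'
    linear_combination (σ k ^ 2 + 8) * σ T ^ 2 * e1 + (T ^ 4 + 6 * T ^ 2 + 1) * e2 + el - l * (T * σ T) * hkk
end

end Part12

section Part13
set_option linter.unusedSimpArgs false
set_option linter.unusedSectionVars false
section
variable {L : Type*} [Field L] [CharZero L] {σ : L →+* L}

theorem caseC_pol (h : SG σ) {i w v n l : L} (hi : σ i = i) (hw : σ w = w) (hv : σ v = v) (hi2 : i ^ 2 = -1)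
    (hw2 : w ^ 2 = 2) (hl : l ^ 2 = -128) (v0 : v ≠ 0) (hN : (v ^ 2) ^ 2 = (8 * n) ^ 2)
    (e : n ^ 4 / 2 + 24 * n ^ 2 - 8 * v ^ 2 + 64 = l * (n * v)) : False := by
  obtain ⟨r, hr, hr2, hlr⟩ : ∃ r : L, σ r = r ∧ r ^ 2 = -2 ∧ l = 8 * r := by
    have : l = 8 * (i * w) ∨ l = - (8 * (i * w)) := sq_eq_sq_iff_eq_or_eq_neg.mp (by
      rw [hl]; linear_combination -64 * w ^ 2 * hi2 + 64 * hw2)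
    have e2 : (i * w) ^ 2 = -2 := by rw [mul_pow, hi2, hw2]; ring
    rcases this with e | e
    · exact ⟨i * w, by rw [map_mul, hi, hw], e2, e⟩
    · exact ⟨-(i * w), by rw [map_neg, map_mul, hi, hw], by rw [neg_pow_two, e2], by rw [e]; ring⟩
  have r0 : r ≠ 0 := by rintro rfl; norm_num at hr2
  obtain ⟨z, hz, hvz⟩ : ∃ z : L, z * v = 4 * r ∧ σ z = z := by
    refine ⟨4 * r / v, by field_simp, ?_⟩
    simp only [map_div₀, map_mul, map_ofNat, hr, hv]
  have v8 : v ^ 8 ≠ 0 := pow_ne_zero 8 v0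
  have z2 : z ^ 2 * v ^ 2 = -32 := by linear_combination (z * v + 4 * r) * hz + 16 * hr2
  have z4 : z ^ 4 * v ^ 4 = 1024 := by linear_combination (z ^ 2 * v ^ 2 - 32) * z2
  have z5 : z ^ 5 * v ^ 5 = 4096 * r := by linear_combination z * v * z4 + 1024 * hz
  have z6 : z ^ 6 * v ^ 6 = -32768 := by linear_combination z ^ 2 * v ^ 2 * z4 + 1024 * z2
  have z8 : z ^ 8 * v ^ 8 = 1048576 := by linear_combination (z ^ 4 * v ^ 4 + 1024) * z4
  subst hlr
  rcases sq_eq_sq_iff_eq_or_eq_neg.mp hN with hn | hn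
  · have hn : n = v ^ 2 / 8 := by linear_combination -hn / 8
    subst hn
    refine h.zdeg i z hi hvz hi2 ?_
    apply (mul_eq_zero.mp _).resolve_right v8
    linear_combination z8 + 4 * v ^ 2 * z6 - 4 * v ^ 3 * z5 + 6 * v ^ 4 * z4 + 16384 * e
  · have hn : n = - (v ^ 2) / 8 := by linear_combination hn / 8
    subst hn
    refine h.zdeg i (-z) hi (by rw [map_neg, hvz]) hi2 ?_
    apply (mul_eq_zero.mp _).resolve_right v8
    linear_combination z8 + 4 * v ^ 2 * z6 + 4 * v ^ 3 * z5 + 6 * v ^ 4 * z4 + 16384 * e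

theorem Pt.hV {s W Y1 Y3 : L} (P : Pt s W Y1 Y3) : σ W ^ 2 = σ s ^ 2 + 4 := by
  rw [← map_pow, P.hW]; simp only [map_add, map_pow, map_ofNat]

theorem caseC_f4 (h : SG σ) {s W Y1 Y3 i w l : L} (P : Pt s W Y1 Y3) (hi : σ i = i) (hw : σ w = w) (hi2 : i ^ 2 = -1)
    (hw2 : w ^ 2 = 2) (hl : l ^ 2 = -128)
    (hN : ((s ^ 2 + 4) * (σ s ^ 2 + 4)) ^ 2 = 64 * (s * σ s) ^ 2)
    (e : ((s * W) ^ 2 + 8) * (σ (s * W) ^ 2 + 8) = l * ((s * W) * σ (s * W))) : False := by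
  have hW := P.hW
  have hV := P.hV (σ := σ)
  have hv2 : (W * σ W) ^ 2 = (s ^ 2 + 4) * (σ s ^ 2 + 4) := by rw [mul_pow, hW, hV]
  refine caseC_pol h (v := W * σ W) (n := s * σ s) hi hw (by rw [map_mul, h.inv, mul_comm]) hi2 hw2 hl
    (mul_ne_zero P.W0 ((map_ne_zero σ).mpr P.W0)) ?_ ?_
  · rw [hv2, hN]; ring
  · have e1 : l * (s * σ s * (W * σ W)) = ((s ^ 2 * (s ^ 2 + 4)) + 8) * ((σ s ^ 2 * (σ s ^ 2 + 4)) + 8) := by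
      rw [← hW, ← hV, ← mul_pow, ← mul_pow, ← map_mul, e, map_mul]; ring
    rw [e1, hv2]
    linear_combination -hN / 2

/-- combining the two pencils -/
theorem combine (h : SG σ) {s W Y1 Y3 : L} (P : Pt s W Y1 Y3) (hs : σ s ≠ s) :
    ((s * σ s) ^ 2 * ((s ^ 2 + 4) * (σ s ^ 2 + 4)) = 64 ∧ 64 * ((s ^ 2 + 4) * (σ s ^ 2 + 4)) = (s * σ s) ^ 4) ∨
    ((s * σ s) ^ 2 = 4 ∧ s ^ 2 + σ s ^ 2 = -1) ∨
    ((s * σ s) ^ 2 = 64 ∧ s ^ 2 + σ s ^ 2 = -4) ∨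
    (∃ i w : L, σ i = i ∧ σ w = w ∧ i ^ 2 = -1 ∧ w ^ 2 = 2 ∧ 
      (((s ^ 2 + 4) * (σ s ^ 2 + 4)) ^ 2 = 64 * (s * σ s) ^ 2 → False)) := by
  have s0 := P.s0
  have z0 : σ s ≠ 0 := (map_ne_zero σ).mpr s0
  have hW := P.hW
  have hV := P.hV (σ := σ)
  have n0 := mul_ne_zero s0 z0
  have hd : σ s ^ 2 - s ^ 2 ≠ 0 := by
    intro h0
    rcases pm (sub_eq_zero.mp h0) with e | e
    · exact hs e
    · exact N2 h P e
  have A : s ^ 2 + σ s ^ 2 = -4 ∨ (s * σ s) ^ 2 * ((s ^ 2 + 4) * (σ s ^ 2 + 4)) = 64 ∨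
    (∃ i w : L, σ i = i ∧ σ w = w ∧ i ^ 2 = -1 ∧ w ^ 2 = 2 ∧ 
      (((s ^ 2 + 4) * (σ s ^ 2 + 4)) ^ 2 = 64 * (s * σ s) ^ 2 → False)) := by
    rcases pencilB h P with e | e | ⟨i, w, l, hi, hw, hi2, hw2, hl, e⟩
    · left
      rw [map_mul, mul_pow, mul_pow, hW, hV] at e
      have : (σ s ^ 2 - s ^ 2) * (s ^ 2 + σ s ^ 2 + 4) = 0 := by linear_combination e
      linear_combination (mul_eq_zero.mp this).resolve_left hd
    · right; left
      rw [← e, map_mul, ← hW, ← hV]; ring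
    · exact Or.inr (Or.inr ⟨i, w, hi, hw, hi2, hw2, fun hN => caseC_f4 h P hi hw hi2 hw2 hl hN e⟩)
  have B : (s * σ s) ^ 2 + 4 * (s ^ 2 + σ s ^ 2) = 0 ∨ 64 * ((s ^ 2 + 4) * (σ s ^ 2 + 4)) = (s * σ s) ^ 4 ∨
    (∃ i w : L, σ i = i ∧ σ w = w ∧ i ^ 2 = -1 ∧ w ^ 2 = 2 ∧ 
      (((s ^ 2 + 4) * (σ s ^ 2 + 4)) ^ 2 = 64 * (s * σ s) ^ 2 → False)) := by
    have hk : σ (4 / s * (2 * W / s)) = 4 / σ s * (2 * σ W / σ s) := by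
      simp only [map_mul, map_div₀, map_ofNat]
    rcases pencilB h P.r with e | e | ⟨i, w, l, hi, hw, hi2, hw2, hl, e⟩
    · left
      rw [hk] at e
      field_simp at e
      have e : σ W ^ 2 * s ^ 4 = W ^ 2 * σ s ^ 4 := by linear_combination e
      rw [hW, hV] at e
      have : (σ s ^ 2 - s ^ 2) * ((s * σ s) ^ 2 + 4 * (s ^ 2 + σ s ^ 2)) = 0 := by linear_combination -e
      exact (mul_eq_zero.mp this).resolve_left hd
    · right; left
      rw [hk] at e
      field_simp at e
      rw [← hW, ← hV]
      linear_combination e / 64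
    · refine Or.inr (Or.inr ⟨i, w, hi, hw, hi2, hw2, fun hN => caseC_f4 h P.r hi hw hi2 hw2 hl ?_ e⟩)
      simp only [map_div₀, map_ofNat]
      have : ((4 / s) ^ 2 + 4) * ((4 / σ s) ^ 2 + 4) = 16 * ((s ^ 2 + 4) * (σ s ^ 2 + 4)) / (s * σ s) ^ 2 := by
        field_simp; ring
      rw [this, div_pow, mul_pow, hN]
      field_simp
      norm_num
  rcases A with A | A | A
  · rcases B with B | B | B
    · exfalso
      have hn : (s * σ s) ^ 2 = 16 := by linear_combination B - 4 * A
      have : (Y1 * Y3) ^ 2 = 0 := by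
        rw [P.u2]; linear_combination -hn + s ^ 2 * A
      exact mul_ne_zero P.Y10 P.Y30 (by simpa using this)
    · right; right; left
      refine ⟨?_, A⟩
      have : (s * σ s) ^ 2 * ((s * σ s) ^ 2 - 64) = 0 := by linear_combination -B + 256 * A
      linear_combination (mul_eq_zero.mp this).resolve_left (pow_ne_zero 2 n0)
    · exact Or.inr (Or.inr (Or.inr B))
  · rcases B with B | B | B
    · right; left
      have hn : (s * σ s) ^ 2 = 4 := by linear_combination A / 16 - (s * σ s) ^ 2 * B / 16
      exact ⟨hn, by linear_combination B / 4 - hn / 4⟩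
    · exact Or.inl ⟨A, B⟩
    · exact Or.inr (Or.inr (Or.inr B))
  · exact Or.inr (Or.inr (Or.inr A))
end

end Part13

section Part14
set_option linter.unusedSectionVars false
section
variable {L : Type*} [Field L] [CharZero L] {σ : L →+* L}

theorem n_cases {n : L} {a : L} (h : n ^ 2 = a ^ 2) : n = a ∨ n = -a := sq_eq_sq_iff_eq_or_eq_neg.mp h

theorem caseC (h : SG σ) {s W Y1 Y3 i w : L} (P : Pt s W Y1 Y3) (hs : σ s ≠ s) (hi : σ i = i) (hw : σ w = w)
    (hi2 : i ^ 2 = -1) (hw2 : w ^ 2 = 2)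
    (hN : ((s ^ 2 + 4) * (σ s ^ 2 + 4)) ^ 2 = 64 * (s * σ s) ^ 2) : False := by
  have n0 := mul_ne_zero P.s0 ((map_ne_zero σ).mpr P.s0)
  have hm : σ (s + σ s) = s + σ s := by rw [map_add, h.inv, add_comm]
  have hm2 : (s + σ s) ^ 2 = s ^ 2 + σ s ^ 2 + 2 * (s * σ s) := by ring
  rcases combine h P hs with ⟨A, B⟩ | ⟨A, B⟩ | ⟨A, B⟩ | ⟨_, _, _, _, _, _, A⟩
  · generalize (s ^ 2 + 4) * (σ s ^ 2 + 4) = N at *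
    generalize s * σ s = n at *
    have n6 : n ^ 6 = 4096 := by linear_combination 64 * A - n ^ 2 * B
    have : n ^ 2 = 0 := by
      have : (64 * N) ^ 2 = n ^ 2 * 4096 := by rw [B, ← n6]; ring
      linear_combination (this - 4096 * hN) / 258048
    exact n0 (by simpa using this)
  · rw [B] at hm2
    rcases n_cases (n := s * σ s) (a := 2) (by rw [A]; norm_num) with e | e
    · rw [e] at hm2
      exact h.no12 i _ hi hm hi2 (by rw [hm2]; norm_num)
    · rw [e] at hm2
      exact h.five i w (i * (s + σ s)) hi hw (by rw [map_mul, hi, hm]) hi2 hw2 (by rw [mul_pow, hi2, hm2]; norm_num)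
  · rw [B] at hm2
    rcases n_cases (n := s * σ s) (a := 8) (by rw [A]; norm_num) with e | e
    · rw [e] at hm2
      exact h.no12 i ((s + σ s) / 2) hi (by rw [map_div₀, hm, map_ofNat]) hi2 (by rw [div_pow, hm2]; norm_num)
    · rw [e] at hm2
      exact h.five i w (i * (s + σ s) / 2) hi hw (by rw [map_div₀, map_mul, hi, hm, map_ofNat]) hi2 hw2
        (by rw [div_pow, mul_pow, hi2, hm2]; norm_num)
  · exact A hN

theorem caseB (h : SG σ) {s W Y1 Y3 θ : L} (P : Pt s W Y1 Y3) (hs : σ s ≠ s) (hθ : σ θ = θ) (hθ2 : θ ^ 2 = 3) :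
    False := by
  have hno : ∀ i, σ i = i → i ^ 2 = -1 → False := fun i hi hi2 => h.no12 i θ hi hθ hi2 hθ2
  have s0 := P.s0
  have z0 : σ s ≠ 0 := (map_ne_zero σ).mpr s0
  have θ0 : θ ≠ 0 := by rintro rfl; norm_num at hθ2
  have hn : σ (s * σ s) = s * σ s := by rw [map_mul, h.inv, mul_comm]
  have hW := P.hW
  have hV := P.hV (σ := σ)
  have hA : σ (W + σ W) = W + σ W := by rw [map_add, h.inv, add_comm]
  have hv2 : (W * σ W) ^ 2 = (s * σ s) ^ 2 + 4 * (s ^ 2 + σ s ^ 2) + 16 := by rw [mul_pow, hW, hV]; ring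
  have hA2 : (W + σ W) ^ 2 = s ^ 2 + σ s ^ 2 + 8 + 2 * (W * σ W) := by linear_combination hW + hV
  have hδ : ∀ c, σ c = c → (s - σ s) ^ 2 = c ^ 2 → False := by
    intro c hc e
    have : σ (s - σ s) = s - σ s := by
      rcases n_cases e with e | e
      · rw [e, hc]
      · rw [e, map_neg, hc]
    rw [map_sub, h.inv] at this
    exact hs (by linear_combination this / 2)
  have hδ2 : (s - σ s) ^ 2 = s ^ 2 + σ s ^ 2 - 2 * (s * σ s) := by ring
  have hc2 : σ (2 * θ) = 2 * θ := by rw [map_mul, hθ, map_ofNat]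
  rcases combine h P hs with ⟨A, B⟩ | ⟨A, B⟩ | ⟨A, B⟩ | ⟨i, _, hi, _, hi2, _, A⟩
  · have n6 : (s * σ s - 4) * ((s * σ s) ^ 2 + 4 * (s * σ s) + 16) * ((s * σ s + 4) * ((s * σ s) ^ 2 - 4 * (s * σ s) + 16)) = 0 := by
      linear_combination 64 * A - (s * σ s) ^ 2 * B
    rcases mul_eq_zero.mp n6 with e | e <;> rcases mul_eq_zero.mp e with e | e
    · have e : s * σ s = 4 := by linear_combination e
      have e2 : σ s = 4 / s := by field_simp; linear_combination e
      have m2 : (s + σ s) ^ 2 = 1 ^ 2 := by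
        have B' : 64 * ((s * σ s) ^ 2 + 4 * (s ^ 2 + σ s ^ 2) + 16) = (s * σ s) ^ 4 := by rw [← B]; ring
        rw [e] at B'
        linear_combination B' / 256 + 2 * e
      rcases n_cases m2 with m | m
      · exact N4one h P e2 (by linear_combination s * m - e) hno
      · exact N4one h P.neg (by rw [map_neg, e2, div_neg]) (by linear_combination s * m - e) hno
    · refine hno ((s * σ s + 2) / (2 * θ)) (by rw [map_div₀, map_add, hn, hc2, map_ofNat]) ?_
      rw [div_pow, mul_pow, hθ2]
      linear_combination e / 12
    · refine N3 h P ?_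
      field_simp; linear_combination e
    · refine hno ((s * σ s - 2) / (2 * θ)) (by rw [map_div₀, map_sub, hn, hc2, map_ofNat]) ?_
      rw [div_pow, mul_pow, hθ2]
      linear_combination e / 12
  · rcases n_cases (n := s * σ s) (a := 2) (by rw [A]; norm_num) with e | e
    · rw [B] at hA2
      rcases n_cases (n := W * σ W) (a := 4) (by rw [hv2, A, B]; norm_num) with k | k <;> rw [k] at hA2
      · exact h.no15 _ hA (by rw [hA2]; norm_num)
      · exact hno _ hA (by rw [hA2]; norm_num)
    · exact hδ θ hθ (by rw [hδ2, B, e, hθ2]; norm_num)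
  · rcases n_cases (n := s * σ s) (a := 8) (by rw [A]; norm_num) with e | e
    · rw [B] at hA2
      rcases n_cases (n := W * σ W) (a := 8) (by rw [hv2, A, B]; norm_num) with k | k <;> rw [k] at hA2
      · exact h.no15 ((W + σ W) * θ / 2) (by rw [map_div₀, map_mul, hA, hθ, map_ofNat]) (by rw [div_pow, mul_pow, hA2, hθ2]; norm_num)
      · exact hno ((W + σ W) * θ / 6) (by rw [map_div₀, map_mul, hA, hθ, map_ofNat]) (by rw [div_pow, mul_pow, hA2, hθ2]; norm_num)
    · exact hδ (2 * θ) hc2 (by rw [hδ2, B, e, mul_pow, hθ2]; norm_num)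
  · exact hno i hi hi2

theorem Pt_main (h : SG σ) {s W Y1 Y3 : L} (P : Pt s W Y1 Y3) : σ s = s ∧ σ W = W ∧ (σ Y1 = Y1 ∨ σ Y3 = Y3) := by
  have hs : σ s = s := by
    by_contra hs
    rcases pencilA h P hs with ⟨θ, h1, h2⟩ | ⟨i, w, h1, h2, h3, h4, h5⟩
    · exact caseB h P hs h1 h2
    · exact caseC h P hs h1 h2 h3 h4 h5
  exact ⟨hs, N1 h P hs⟩
end

theorem exists_conj (K L : Type*) [Field K] [NumberField K] [Field L] [NumberField L] [Algebra K L]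
    (hquad : Module.finrank K L = 2) : ∃ σ : L →+* L, (∀ x, σ (σ x) = x) ∧
      ∀ x, σ x = x ↔ ∃ y, algebraMap K L y = x := by
  have : FiniteDimensional K L := FiniteDimensional.of_finrank_pos (by omega)
  have : Algebra.IsQuadraticExtension K L := ⟨hquad⟩
  have : IsGalois K L := ⟨⟩
  have hc : Nat.card (L ≃ₐ[K] L) = 2 := by rw [IsGalois.card_aut_eq_finrank, hquad]
  obtain ⟨τ, hτ⟩ : ∃ τ : L ≃ₐ[K] L, τ ≠ 1 := by
    have : Nontrivial (L ≃ₐ[K] L) := Finite.one_lt_card_iff_nontrivial.mp (by omega)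
    exact exists_ne 1
  have hall : ∀ g : L ≃ₐ[K] L, g = 1 ∨ g = τ := by
    intro g
    by_contra! hg
    have := Fintype.ofFinite (L ≃ₐ[K] L)
    classical
    have h3 := Finset.card_le_univ ({1, τ, g} : Finset (L ≃ₐ[K] L))
    rw [← Nat.card_eq_fintype_card, hc, Finset.card_eq_three.mpr ⟨1, τ, g, hτ.symm, hg.1.symm, hg.2.symm, rfl⟩] at h3
    omega
  have hsq : τ * τ = 1 := by
    rw [← sq, ← hc]; exact pow_card_eq_one'
  refine ⟨(τ : L →ₐ[K] L).toRingHom, fun x => ?_, fun x => ⟨fun hx => ?_, ?_⟩⟩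
  · exact congrArg (fun g : L ≃ₐ[K] L => g x) hsq
  · refine IsGalois.mem_range_algebraMap_iff_fixed x |>.mpr fun g => ?_
    rcases hall g with rfl | rfl
    · rfl
    · exact hx
  · rintro ⟨y, rfl⟩
    exact τ.commutes y

theorem final_conj {K L : Type*} [Field K] [NumberField K] [Field L] [NumberField L] [Algebra K L]
    (hG : Good K) (hquad : Module.finrank K L = 2) {t X₁ X₃ : L}
    (h1 : X₁ ^ 2 = t ^ 4 - 2 * t ^ 3 + 2 * t ^ 2 + 2 * t + 1)
    (h3 : X₃ ^ 2 = t ^ 4 + 2 * t ^ 3 + 2 * t ^ 2 - 2 * t + 1)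
    (t0 : t ≠ 0) (t1 : t ≠ 1) (tm : t ≠ -1) (x1 : X₁ ≠ 0) (x3 : X₃ ≠ 0)
    (a1 : t ^ 2 + 1 ≠ 0) (a2 : t ^ 2 - 2 * t - 1 ≠ 0) (a3 : t ^ 2 + 2 * t - 1 ≠ 0) :
    t ∈ Set.range (algebraMap K L) ∧
      (X₁ ∈ Set.range (algebraMap K L) ∨ X₃ ∈ Set.range (algebraMap K L)) := by
  obtain ⟨σ, inv, hfix⟩ := exists_conj K L hquad
  have h := SG_of hG (algebraMap K L) σ inv hfix
  have P : Pt (t - 1 / t) (t + 1 / t) (X₁ / t) (X₃ / t) := by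
    refine ⟨?_, ?_, ?_, ?_, ?_, ?_, div_ne_zero x1 t0, div_ne_zero x3 t0⟩
    · field_simp; ring
    · rw [div_pow, h1]; field_simp; ring
    · rw [div_pow, h3]; field_simp; ring
    · intro e
      field_simp at e
      have : (t - 1) * (t + 1) = 0 := by linear_combination e
      rcases mul_eq_zero.mp this with e | e
      · exact t1 (by linear_combination e)
      · exact tm (by linear_combination e)
    · intro e
      field_simp at e
      exact a1 (by linear_combination e)
    · intro e
      field_simp at e
      have : (t ^ 2 - 2 * t - 1) * (t ^ 2 + 2 * t - 1) = 0 := by linear_combination e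
      exact (mul_ne_zero a2 a3) this
  obtain ⟨e1, e2, e3⟩ := Pt_main h P
  have ht : σ t = t := by
    have e : t = ((t - 1 / t) + (t + 1 / t)) / 2 := by ring
    have : σ (((t - 1 / t) + (t + 1 / t)) / 2) = ((t - 1 / t) + (t + 1 / t)) / 2 := by
      rw [map_div₀, map_add, e1, e2, map_ofNat]
    rwa [← e] at this
  refine ⟨(hfix t).mp ht, ?_⟩
  rcases e3 with e | e
  · left
    refine (hfix _).mp ?_
    rw [map_div₀, ht] at e
    field_simp at e
    exact e
  · right
    refine (hfix _).mp ?_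
    rw [map_div₀, ht] at e
    field_simp at e
    exact e

end Part14

theorem quadratic_points_on_C_class_number_one
    (K L : Type*) [Field K] [NumberField K] [Field L] [NumberField L] [Algebra K L]
    (hquad : Module.finrank K L = 2)
    (hKcyc : ¬ IsCyclotomicExtension {12} ℚ K)
    (hclass : NumberField.classNumber K = 1)
    (hcond : condA K ∨ condB K)
    (t X₁ X₃ : L) (hpt : CPt t X₁ X₃) (hnt : CNontrivial t X₁ X₃) :
    t ∈ Set.range (algebraMap K L) ∧
      (X₁ ∈ Set.range (algebraMap K L) ∨ X₃ ∈ Set.range (algebraMap K L)) := by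
  obtain ⟨h1, h3⟩ := hpt
  obtain ⟨t0, t1, tm, x1, x3, a1, a2, a3⟩ := hnt
  have hG : Good K := by
    refine good_of K hKcyc ?_
    rcases hcond with h | h
    · exact Or.inl ⟨h.1, h.2.1⟩
    · exact Or.inr h
  exact final_conj hG hquad h1 h3 t0 t1 tm x1 x3 a1 a2 a3
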